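/- Discreteness of the capacity-achieving input distribution: the unique probability measure F* ∈ Ω achieving I(F*) = C = sup_{F ∈ Ω} I(F) is discrete with a finite number of mass points; that is, there exists a finite set S ⊆ [0, A] such that F*(S) = 1 (assuming Ω is nonempty and C is finite). -/

import Mathlib

open MeasureTheory ProbabilityTheory Real ENNReal NNReal

noncomputable section
open scoped Classical

/-- Kullback–Leibler divergence `D_KL(μ ‖ ν)` with values in `ℝ≥0∞`:
`∫ log (dμ/dν) dμ` when `μ ≪ ν` (and the log-likelihood ratio is integrable),
and `+∞` otherwise. -/
def klDiv' (μ ν : Measure ℝ) : ℝ≥0∞ :=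
  if μ ≪ ν ∧ Integrable (llr μ ν) μ then ENNReal.ofReal (∫ y, llr μ ν y ∂μ) else ⊤

/-- The law `κ(x)` of the channel output `Y = K·x·e^{2G} + N`, where
`G ~ N(m, s²)` and `N ~ N(0, sg²)` are independent real Gaussians. -/
def channelLaw (K m s sg : ℝ) (x : ℝ) : Measure ℝ :=
  Measure.map (fun p : ℝ × ℝ => K * x * Real.exp (2 * p.1) + p.2)
    ((gaussianReal m (Real.toNNReal (s ^ 2))).prod (gaussianReal 0 (Real.toNNReal (sg ^ 2))))

/-- The output distribution `P_F = ∫ κ(x) dF(x)`. -/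
def outputDist (K m s sg : ℝ) (F : Measure ℝ) : Measure ℝ :=
  F.bind (channelLaw K m s sg)

/-- The marginal information density `i(x; F) = D_KL(κ(x) ‖ P_F)`. -/
def infoDensity (K m s sg : ℝ) (F : Measure ℝ) (x : ℝ) : ℝ≥0∞ :=
  klDiv' (channelLaw K m s sg x) (outputDist K m s sg F)

/-- The mutual information `I(F) = ∫ i(x; F) dF(x) ∈ [0, ∞]`. -/
def mutualInfo (K m s sg : ℝ) (F : Measure ℝ) : ℝ≥0∞ :=
  ∫⁻ x, infoDensity K m s sg F x ∂F

/-- Membership in the feasible set `Ω`: `F` is a probability measure on `[0, A]`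
with `∫ x dF ≤ ε` and `∫ b·x·ln(1 + c·x) dF ≥ E_th`. -/
def feasible (A ε b c Eth : ℝ) (F : Measure ℝ) : Prop :=
  IsProbabilityMeasure F ∧ F (Set.Icc 0 A)ᶜ = 0 ∧
    (∫ x, x ∂F) ≤ ε ∧ Eth ≤ ∫ x, b * x * Real.log (1 + c * x) ∂F

/-- The capacity `C = sup_{F ∈ Ω} I(F)`. -/
def capacity (K m s sg A ε b c Eth : ℝ) : ℝ≥0∞ :=
  ⨆ F ∈ {F : Measure ℝ | feasible A ε b c Eth F}, mutualInfo K m s sg F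

set_option linter.unusedVariables false
set_option linter.style.longLine false

/-! ### Part A : basics -/

/-- law of the log-amplitude -/
def gam (m s : ℝ) : Measure ℝ := gaussianReal m (Real.toNNReal (s ^ 2))

instance (m s : ℝ) : IsProbabilityMeasure (gam m s) := by unfold gam; infer_instance

/-- noise density -/
def ph (sg y : ℝ) : ℝ := (√(2 * π * sg ^ 2))⁻¹ * Real.exp (-y ^ 2 / (2 * sg ^ 2))

/-- output density given the input -/
def pd (K m s sg x y : ℝ) : ℝ := ∫ g, ph sg (y - K * x * Real.exp (2 * g)) ∂(gam m s)

/-- output density -/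
def Pd (K m s sg : ℝ) (F : Measure ℝ) (y : ℝ) : ℝ := ∫ x, pd K m s sg x y ∂F

lemma ph_eq (sg y : ℝ) : ph sg y = gaussianPDFReal 0 (Real.toNNReal (sg ^ 2)) y := by
  simp [ph, gaussianPDFReal, Real.coe_toNNReal _ (sq_nonneg sg)]

lemma var_ne {sg : ℝ} (h : 0 < sg) : Real.toNNReal (sg ^ 2) ≠ 0 := by
  have : 0 < sg ^ 2 := by positivity
  simpa using this.ne'

lemma ph_pos {sg : ℝ} (h : 0 < sg) (y : ℝ) : 0 < ph sg y := by
  unfold ph; have := Real.pi_pos; positivity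

lemma ph_cont (sg : ℝ) : Continuous (ph sg) := by
  unfold ph; fun_prop

lemma ph_le (sg : ℝ) (y : ℝ) : ph sg y ≤ ph sg 0 := by
  unfold ph
  have h : -y ^ 2 / (2 * sg ^ 2) ≤ -0 ^ 2 / (2 * sg ^ 2) := by
    apply div_le_div_of_nonneg_right _ (by positivity)
    nlinarith [sq_nonneg y]
  exact mul_le_mul_of_nonneg_left (Real.exp_le_exp.2 h) (by positivity)

lemma ph_anti {sg : ℝ} {a b : ℝ} (hab : |a| ≤ |b|) : ph sg b ≤ ph sg a := by
  unfold ph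
  have h : -b ^ 2 / (2 * sg ^ 2) ≤ -a ^ 2 / (2 * sg ^ 2) := by
    apply div_le_div_of_nonneg_right _ (by positivity)
    nlinarith [sq_le_sq.2 hab]
  exact mul_le_mul_of_nonneg_left (Real.exp_le_exp.2 h) (by positivity)

lemma ph_nonneg (sg y : ℝ) : 0 ≤ ph sg y := by unfold ph; positivity

lemma ph_int {sg : ℝ} : Integrable (ph sg) := by
  have : ph sg = gaussianPDFReal 0 (Real.toNNReal (sg ^ 2)) := funext (ph_eq sg)
  rw [this]; exact integrable_gaussianPDFReal _ _

lemma log_ph {sg : ℝ} (h : 0 < sg) (y : ℝ) :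
    Real.log (ph sg y) = Real.log (ph sg 0) - y ^ 2 / (2 * sg ^ 2) := by
  have hp := Real.pi_pos
  unfold ph
  rw [Real.log_mul (by positivity) (by positivity), Real.log_mul (by positivity) (by positivity),
    Real.log_exp, Real.log_exp]
  ring

lemma pd_integrable (K m s sg x y : ℝ) :
    Integrable (fun g => ph sg (y - K * x * Real.exp (2 * g))) (gam m s) := by
  apply Integrable.mono' (integrable_const (ph sg 0))
  · exact ((ph_cont sg).comp (by fun_prop)).aestronglyMeasurable
  · filter_upwards with g
    rw [Real.norm_of_nonneg (ph_nonneg _ _)]; exact ph_le _ _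

lemma pd_cont (K m s sg : ℝ) : Continuous (fun p : ℝ × ℝ => pd K m s sg p.1 p.2) := by
  unfold pd
  apply continuous_of_dominated (bound := fun _ => ph sg 0)
  · intro p; exact ((ph_cont sg).comp (by fun_prop)).aestronglyMeasurable
  · intro p; filter_upwards with g
    rw [Real.norm_of_nonneg (ph_nonneg _ _)]; exact ph_le _ _
  · exact integrable_const _
  · filter_upwards with g
    exact (ph_cont sg).comp (by fun_prop)

lemma pd_cont_y (K m s sg x : ℝ) : Continuous (fun y => pd K m s sg x y) :=
  (pd_cont K m s sg).comp (by fun_prop : Continuous (fun y : ℝ => (x, y)))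

lemma pd_cont_x (K m s sg y : ℝ) : Continuous (fun x => pd K m s sg x y) :=
  (pd_cont K m s sg).comp (by fun_prop : Continuous (fun x : ℝ => (x, y)))

lemma pd_nonneg (K m s sg x y : ℝ) : 0 ≤ pd K m s sg x y :=
  integral_nonneg fun _ => ph_nonneg _ _

lemma pd_le (K m s sg x y : ℝ) : pd K m s sg x y ≤ ph sg 0 := by
  have := integral_mono (pd_integrable K m s sg x y) (integrable_const (ph sg 0))
    (fun g => ph_le _ _)
  simpa [pd] using this

lemma gam_Iic_pos (m : ℝ) {s : ℝ} (hs : 0 < s) : 0 < (gam m s).real (Set.Iic 0) := by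
  have : (gam m s) (Set.Iic 0) ≠ 0 := by
    intro h
    have h2 := gaussianReal_absolutelyContinuous' m (var_ne hs) h
    simp at h2
  exact ENNReal.toReal_pos this (measure_ne_top _ _)

lemma pd_lower {K m s sg : ℝ} (hK : 0 < K) (B x y : ℝ) (hx : |x| ≤ B) :
    (gam m s).real (Set.Iic 0) * ph sg (|y| + K * B) ≤ pd K m s sg x y := by
  have hB : 0 ≤ B := (abs_nonneg x).trans hx
  have h1 : ∫ g in Set.Iic 0, ph sg (|y| + K * B) ∂(gam m s) ≤
      ∫ g in Set.Iic 0, ph sg (y - K * x * Real.exp (2 * g)) ∂(gam m s) := by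
    apply setIntegral_mono_on (integrable_const _).integrableOn
      (pd_integrable K m s sg x y).integrableOn measurableSet_Iic
    intro g hg
    apply ph_anti
    have he : Real.exp (2 * g) ≤ 1 := by
      rw [Real.exp_le_one_iff]; simp at hg; linarith
    have : |K * x * Real.exp (2 * g)| ≤ K * B := by
      rw [abs_mul, abs_mul, abs_of_pos hK, abs_of_pos (Real.exp_pos _)]
      have : |x| * Real.exp (2*g) ≤ B * 1 := by
        apply mul_le_mul hx he (Real.exp_pos _).le hB
      nlinarith
    rw [abs_of_nonneg (by positivity : 0 ≤ |y| + K * B)]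
    exact (abs_sub _ _).trans (by linarith)
  have h2 : ∫ g in Set.Iic 0, ph sg (y - K * x * Real.exp (2 * g)) ∂(gam m s) ≤ pd K m s sg x y :=
    setIntegral_le_integral (pd_integrable K m s sg x y) (by
      filter_upwards with g using ph_nonneg _ _)
  simpa using h1.trans h2

lemma pd_pos {K m s sg : ℝ} (hK : 0 < K) (hs : 0 < s) (hsg : 0 < sg) (x y : ℝ) :
    0 < pd K m s sg x y :=
  lt_of_lt_of_le (mul_pos (gam_Iic_pos m hs) (ph_pos hsg _)) (pd_lower hK |x| x y le_rfl)

/-- uniform logarithmic lower bound -/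
lemma log_lower {K m s sg : ℝ} (hK : 0 < K) (hs : 0 < s) (hsg : 0 < sg) (B : ℝ) (hB : 0 ≤ B) :
    ∃ C : ℝ, 0 < C ∧ ∀ y t : ℝ,
      (gam m s).real (Set.Iic 0) * ph sg (|y| + K * B) ≤ t → t ≤ ph sg 0 →
      |Real.log t| ≤ C * (1 + y ^ 2) := by
  set a := |Real.log ((gam m s).real (Set.Iic 0))| with ha
  set b := |Real.log (ph sg 0)| with hb
  refine ⟨a + b + (1 + (K * B) ^ 2) / sg ^ 2, by positivity, ?_⟩
  intro y t h1 h2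
  have hg := gam_Iic_pos m hs
  have hp := ph_pos hsg (|y| + K * B)
  have ht : 0 < t := lt_of_lt_of_le (mul_pos hg hp) h1
  have h3 := Real.log_le_log (mul_pos hg hp) h1
  rw [Real.log_mul hg.ne' hp.ne', log_ph hsg] at h3
  have h4 := Real.log_le_log ht h2
  have h5 : (|y| + K * B) ^ 2 / (2 * sg ^ 2) ≤ (1 + (K * B) ^ 2) / sg ^ 2 * (1 + y ^ 2) := by
    rw [div_mul_eq_mul_div, div_le_div_iff₀ (by positivity) (by positivity)]
    have : (|y| + K * B) ^ 2 ≤ 2 * (1 + (K * B) ^ 2) * (1 + y ^ 2) := by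
      nlinarith [sq_abs y, sq_nonneg (|y| - K * B), sq_nonneg (K * B * y)]
    have hs2 : 0 < sg ^ 2 := by positivity
    nlinarith
  have ha1 := neg_abs_le (Real.log ((gam m s).real (Set.Iic 0)))
  have hb1 := neg_abs_le (Real.log (ph sg 0))
  have hb2 := le_abs_self (Real.log (ph sg 0))
  have hy : 0 ≤ y ^ 2 := sq_nonneg y
  have hapos : 0 ≤ a := abs_nonneg _
  have hbpos : 0 ≤ b := abs_nonneg _
  have hc : 0 ≤ (1 + (K * B) ^ 2) / sg ^ 2 := by positivity
  rw [abs_le]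
  constructor
  · nlinarith [mul_nonneg hapos hy, mul_nonneg hbpos hy]
  · nlinarith [mul_nonneg hapos hy, mul_nonneg hbpos hy, mul_nonneg hc hy]

lemma log_pd_bound {K m s sg : ℝ} (hK : 0 < K) (hs : 0 < s) (hsg : 0 < sg) (B : ℝ) (hB : 0 ≤ B) :
    ∃ C : ℝ, 0 < C ∧ ∀ x y : ℝ, |x| ≤ B → |Real.log (pd K m s sg x y)| ≤ C * (1 + y ^ 2) := by
  obtain ⟨C, hC, h⟩ := log_lower (m := m) hK hs hsg B hB
  exact ⟨C, hC, fun x y hx => h y _ (pd_lower hK B x y hx) (pd_le _ _ _ _ _ _)⟩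

lemma exp_gam_integrable (m s t : ℝ) : Integrable (fun g => Real.exp (t * g)) (gam m s) := by
  unfold gam; exact integrable_exp_mul_gaussianReal t

lemma channelLaw_eq {K m s sg : ℝ} (hsg : 0 < sg) (x : ℝ) :
    channelLaw K m s sg x = volume.withDensity (fun y => ENNReal.ofReal (pd K m s sg x y)) := by
  ext A hA
  unfold channelLaw
  have hme : Measurable (fun p : ℝ × ℝ => K * x * Real.exp (2 * p.1) + p.2) := by fun_prop
  rw [Measure.map_apply hme hA, Measure.prod_apply (hme hA), withDensity_apply _ hA]
  have h1 : ∀ g : ℝ, (gaussianReal 0 (Real.toNNReal (sg ^ 2)))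
      (Prod.mk g ⁻¹' ((fun p : ℝ × ℝ => K * x * Real.exp (2 * p.1) + p.2) ⁻¹' A)) =
      ∫⁻ y in A, ENNReal.ofReal (ph sg (y - K * x * Real.exp (2 * g))) := by
    intro g
    have hA' : MeasurableSet ((fun n : ℝ => K * x * Real.exp (2 * g) + n) ⁻¹' A) :=
      (measurable_const_add _) hA
    have : Prod.mk g ⁻¹' ((fun p : ℝ × ℝ => K * x * Real.exp (2 * p.1) + p.2) ⁻¹' A) =
      (fun n : ℝ => K * x * Real.exp (2 * g) + n) ⁻¹' A := rfl
    rw [this, gaussianReal_apply _ (var_ne hsg), ← lintegral_indicator hA', ← lintegral_indicator hA,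
      ← lintegral_add_left_eq_self (μ := volume) (A.indicator _) (K * x * Real.exp (2 * g))]
    apply lintegral_congr
    intro n
    simp only [Set.indicator, Set.mem_preimage]
    split_ifs
    · rw [add_sub_cancel_left, ph_eq]; rfl
    · rfl
  simp_rw [h1]
  rw [lintegral_lintegral_swap]
  · apply lintegral_congr
    intro y
    unfold pd
    rw [ofReal_integral_eq_lintegral_ofReal (pd_integrable K m s sg x y)
      (by filter_upwards with g using ph_nonneg _ _)]
    rfl
  · apply Measurable.aemeasurable
    have := ph_cont sg
    apply ENNReal.measurable_ofReal.comp
    exact (this.comp (by fun_prop)).measurable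

instance channelLaw_prob (K m s sg x : ℝ) : IsProbabilityMeasure (channelLaw K m s sg x) := by
  unfold channelLaw
  exact Measure.isProbabilityMeasure_map (by fun_prop)

lemma channelLaw_meas {K m s sg : ℝ} (hsg : 0 < sg) : Measurable (channelLaw K m s sg) := by
  apply Measure.measurable_of_measurable_coe
  intro A hA
  simp_rw [channelLaw_eq hsg, withDensity_apply _ hA]
  apply Measurable.lintegral_prod_right'
    (f := fun p : ℝ × ℝ => ENNReal.ofReal (pd K m s sg p.1 p.2))
  exact ENNReal.measurable_ofReal.comp (pd_cont K m s sg).measurable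

lemma pd_int_F (K m s sg y : ℝ) (F : Measure ℝ) [IsFiniteMeasure F] :
    Integrable (fun x => pd K m s sg x y) F := by
  apply Integrable.mono' (integrable_const (ph sg 0))
  · exact (pd_cont_x _ _ _ _ _).aestronglyMeasurable
  · filter_upwards with g
    rw [Real.norm_of_nonneg (pd_nonneg _ _ _ _ _ _)]; exact pd_le _ _ _ _ _ _

lemma Pd_cont (K m s sg : ℝ) (F : Measure ℝ) [IsFiniteMeasure F] :
    Continuous (Pd K m s sg F) := by
  unfold Pd
  apply continuous_of_dominated (bound := fun _ => ph sg 0)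
  · intro p; exact (pd_cont_x _ _ _ _ _).aestronglyMeasurable
  · intro p; filter_upwards with g
    rw [Real.norm_of_nonneg (pd_nonneg _ _ _ _ _ _)]; exact pd_le _ _ _ _ _ _
  · exact integrable_const _
  · filter_upwards with x using pd_cont_y _ _ _ _ _

lemma outputDist_eq {K m s sg : ℝ} (hsg : 0 < sg) (F : Measure ℝ) [IsFiniteMeasure F] :
    outputDist K m s sg F = volume.withDensity (fun y => ENNReal.ofReal (Pd K m s sg F y)) := by
  ext A hA
  unfold outputDist
  rw [Measure.bind_apply hA (channelLaw_meas hsg).aemeasurable, withDensity_apply _ hA]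
  simp_rw [channelLaw_eq hsg, withDensity_apply _ hA]
  rw [lintegral_lintegral_swap]
  · apply lintegral_congr
    intro y
    unfold Pd
    rw [ofReal_integral_eq_lintegral_ofReal (pd_int_F K m s sg y F)
      (by filter_upwards with g using pd_nonneg _ _ _ _ _ _)]
  · exact (ENNReal.measurable_ofReal.comp (pd_cont K m s sg).measurable).aemeasurable

lemma integrable_channel_iff {K m s sg : ℝ} (hsg : 0 < sg) (x : ℝ) (f : ℝ → ℝ) :
    Integrable f (channelLaw K m s sg x) ↔ Integrable (fun y => pd K m s sg x y * f y) := by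
  rw [channelLaw_eq hsg, integrable_withDensity_iff_integrable_smul₀'
    (f := fun y => ENNReal.ofReal (pd K m s sg x y)) ((ENNReal.measurable_ofReal.comp (pd_cont_y K m s sg x).measurable).aemeasurable)
    (by filter_upwards with y using ENNReal.ofReal_lt_top)]
  simp [ENNReal.toReal_ofReal (pd_nonneg _ _ _ _ _ _)]

lemma integral_channel {K m s sg : ℝ} (hsg : 0 < sg) (x : ℝ) (f : ℝ → ℝ) :
    ∫ y, f y ∂(channelLaw K m s sg x) = ∫ y, pd K m s sg x y * f y := by
  rw [channelLaw_eq hsg, integral_withDensity_eq_integral_toReal_smul₀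
    (f := fun y => ENNReal.ofReal (pd K m s sg x y)) ((ENNReal.measurable_ofReal.comp (pd_cont_y K m s sg x).measurable).aemeasurable)
    (by filter_upwards with y using ENNReal.ofReal_lt_top)]
  simp [ENNReal.toReal_ofReal (pd_nonneg _ _ _ _ _ _)]

/-- second moment bound -/
lemma mom2_integrable {K m s sg : ℝ} (hsg : 0 < sg) (x : ℝ) :
    Integrable (fun y => pd K m s sg x y * (1 + y ^ 2)) := by
  rw [← integrable_channel_iff hsg]
  unfold channelLaw
  rw [integrable_map_measure (by fun_prop) (by fun_prop)]
  have h1 : Integrable (fun p : ℝ × ℝ => Real.exp (4 * p.1))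
      ((gaussianReal m (Real.toNNReal (s ^ 2))).prod (gaussianReal 0 (Real.toNNReal (sg ^ 2)))) :=
    (exp_gam_integrable m s 4).comp_fst _
  have h2 : Integrable (fun p : ℝ × ℝ => p.2 ^ 2)
      ((gaussianReal m (Real.toNNReal (s ^ 2))).prod (gaussianReal 0 (Real.toNNReal (sg ^ 2)))) := by
    have : Integrable (fun n : ℝ => n ^ 2) (gaussianReal 0 (Real.toNNReal (sg ^ 2))) := by
      have := (memLp_id_gaussianReal (μ := 0) (v := Real.toNNReal (sg ^ 2)) 2).integrable_sq
      simpa using this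
    exact this.comp_snd _
  apply Integrable.mono' ((integrable_const (1:ℝ)).add ((h1.const_mul (2 * K ^ 2 * x ^ 2)).add
    (h2.const_mul 2)))
  · exact Continuous.aestronglyMeasurable (by fun_prop)
  · filter_upwards with p
    simp only [Function.comp, Pi.add_apply]
    rw [Real.norm_of_nonneg (by positivity)]
    have : Real.exp (4 * p.1) = Real.exp (2 * p.1) ^ 2 := by
      rw [← Real.exp_nat_mul]; congr 1; push_cast; ring
    rw [this]
    nlinarith [sq_nonneg (K * x * Real.exp (2 * p.1) - p.2)]

lemma pd_mul_integrable {K m s sg : ℝ} (hsg : 0 < sg) (x : ℝ) {f : ℝ → ℝ} (hf : Measurable f)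
    {C : ℝ} (hC : ∀ y, |f y| ≤ C * (1 + y ^ 2)) :
    Integrable (fun y => pd K m s sg x y * f y) := by
  apply Integrable.mono' ((mom2_integrable (K := K) (m := m) (s := s) hsg x).const_mul C)
  · exact ((pd_cont_y K m s sg x).measurable.mul hf).aestronglyMeasurable
  · filter_upwards with y
    rw [norm_mul, Real.norm_of_nonneg (pd_nonneg _ _ _ _ _ _), Real.norm_eq_abs]
    calc _ ≤ pd K m s sg x y * (C * (1 + y ^ 2)) :=
          mul_le_mul_of_nonneg_left (hC y) (pd_nonneg _ _ _ _ _ _)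
      _ = _ := by ring

lemma pd_integrable_y {K m s sg : ℝ} (hsg : 0 < sg) (x : ℝ) :
    Integrable (fun y => pd K m s sg x y) := by
  have := pd_mul_integrable (K := K) (m := m) (s := s) hsg x (f := fun _ => 1) measurable_const
    (C := 1) (by intro y; simp; positivity)
  simpa using this

lemma pd_integral_y {K m s sg : ℝ} (hsg : 0 < sg) (x : ℝ) :
    ∫ y, pd K m s sg x y = 1 := by
  have := integral_channel (K := K) (m := m) (s := s) hsg x (fun _ => 1)
  simpa using this.symm
/-! ### Part B : information formulas and first order condition -/

/-- real-valued marginal information density -/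
def ii (K m s sg : ℝ) (F : Measure ℝ) (x : ℝ) : ℝ :=
  ∫ y, pd K m s sg x y * (Real.log (pd K m s sg x y) - Real.log (Pd K m s sg F y))

lemma mom2_le {K m s sg : ℝ} (hsg : 0 < sg) (B : ℝ) :
    ∃ C : ℝ, ∀ x, |x| ≤ B → ∫ y, pd K m s sg x y * (1 + y ^ 2) ≤ C := by
  set μ := ((gaussianReal m (Real.toNNReal (s ^ 2))).prod (gaussianReal 0 (Real.toNNReal (sg ^ 2))))
    with hμ
  have h1 : Integrable (fun p : ℝ × ℝ => Real.exp (4 * p.1)) μ :=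
    (exp_gam_integrable m s 4).comp_fst _
  have h2 : Integrable (fun p : ℝ × ℝ => p.2 ^ 2) μ := by
    have : Integrable (fun n : ℝ => n ^ 2) (gaussianReal 0 (Real.toNNReal (sg ^ 2))) := by
      have := (memLp_id_gaussianReal (μ := 0) (v := Real.toNNReal (sg ^ 2)) 2).integrable_sq
      simpa using this
    exact this.comp_snd _
  have h3 : Integrable (fun p : ℝ × ℝ => 1 + (2 * K ^ 2 * B ^ 2 * Real.exp (4 * p.1) + 2 * p.2 ^ 2)) μ :=
    (integrable_const (1:ℝ)).add ((h1.const_mul (2 * K ^ 2 * B ^ 2)).add (h2.const_mul 2))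
  refine ⟨∫ p, (1 + (2 * K ^ 2 * B ^ 2 * Real.exp (4 * p.1) + 2 * p.2 ^ 2)) ∂μ, fun x hx => ?_⟩
  have h4 := (integrable_channel_iff (K := K) (m := m) (s := s) hsg x _).2 (mom2_integrable hsg x)
  rw [← integral_channel hsg]
  unfold channelLaw at h4 ⊢
  rw [integrable_map_measure (by fun_prop) (by fun_prop)] at h4
  rw [integral_map (by fun_prop) (by fun_prop)]
  apply integral_mono h4 h3
  intro p
  simp only [Function.comp]
  have : Real.exp (4 * p.1) = Real.exp (2 * p.1) ^ 2 := by
    rw [← Real.exp_nat_mul]; congr 1; push_cast; ring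
  rw [this]
  have hx2 : x ^ 2 ≤ B ^ 2 := by
    have := abs_nonneg x
    nlinarith [sq_abs x]
  have h5 : K ^ 2 * x ^ 2 * Real.exp (2 * p.1) ^ 2 ≤ K ^ 2 * B ^ 2 * Real.exp (2 * p.1) ^ 2 := by
    gcongr
  nlinarith [sq_nonneg (K * x * Real.exp (2 * p.1) - p.2)]

lemma Pd_bounds {K m s sg : ℝ} (hK : 0 < K) {A : ℝ} (F : Measure ℝ) [IsProbabilityMeasure F]
    (hF : F (Set.Icc 0 A)ᶜ = 0) (y : ℝ) :
    (gam m s).real (Set.Iic 0) * ph sg (|y| + K * A) ≤ Pd K m s sg F y ∧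
      Pd K m s sg F y ≤ ph sg 0 := by
  have hae : ∀ᵐ x ∂F, x ∈ Set.Icc 0 A := by
    rw [ae_iff]; exact hF
  constructor
  · have : ∫ x, (gam m s).real (Set.Iic 0) * ph sg (|y| + K * A) ∂F ≤ Pd K m s sg F y := by
      apply integral_mono_ae (integrable_const _) (pd_int_F _ _ _ _ _ _)
      filter_upwards [hae] with x hx
      exact pd_lower hK A x y (by rw [abs_of_nonneg hx.1]; exact hx.2)
    simpa using this
  · have : Pd K m s sg F y ≤ ∫ x, ph sg 0 ∂F :=
      integral_mono (pd_int_F _ _ _ _ _ _) (integrable_const _) (fun x => pd_le _ _ _ _ _ _)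
    simpa using this

lemma Pd_pos {K m s sg : ℝ} (hK : 0 < K) (hs : 0 < s) (hsg : 0 < sg) {A : ℝ} (F : Measure ℝ)
    [IsProbabilityMeasure F] (hF : F (Set.Icc 0 A)ᶜ = 0) (y : ℝ) : 0 < Pd K m s sg F y :=
  lt_of_lt_of_le (mul_pos (gam_Iic_pos m hs) (ph_pos hsg _)) (Pd_bounds hK F hF y).1

lemma log_Pd_bound {K m s sg : ℝ} (hK : 0 < K) (hs : 0 < s) (hsg : 0 < sg) {A : ℝ} (hA : 0 < A)
    (F : Measure ℝ) [IsProbabilityMeasure F] (hF : F (Set.Icc 0 A)ᶜ = 0) :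
    ∃ C : ℝ, 0 < C ∧ ∀ y : ℝ, |Real.log (Pd K m s sg F y)| ≤ C * (1 + y ^ 2) := by
  obtain ⟨C, hC, h⟩ := log_lower (m := m) hK hs hsg A hA.le
  exact ⟨C, hC, fun y => h y _ (Pd_bounds hK F hF y).1 (Pd_bounds hK F hF y).2⟩

lemma log_diff_bound {K m s sg : ℝ} (hK : 0 < K) (hs : 0 < s) (hsg : 0 < sg) {A : ℝ} (hA : 0 < A)
    (F : Measure ℝ) [IsProbabilityMeasure F] (hF : F (Set.Icc 0 A)ᶜ = 0) (B : ℝ) (hB : 0 ≤ B) :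
    ∃ C : ℝ, 0 < C ∧ ∀ x y : ℝ, |x| ≤ B →
      |Real.log (pd K m s sg x y) - Real.log (Pd K m s sg F y)| ≤ C * (1 + y ^ 2) := by
  obtain ⟨C, hC, h⟩ := log_Pd_bound (m := m) hK hs hsg hA F hF
  obtain ⟨C', hC', h'⟩ := log_pd_bound (m := m) hK hs hsg B hB
  refine ⟨C' + C, by positivity, fun x y hx => (abs_sub _ _).trans ?_⟩
  have := h y; have := h' x y hx
  linarith

lemma ii_integrable {K m s sg : ℝ} (hK : 0 < K) (hs : 0 < s) (hsg : 0 < sg) {A : ℝ} (hA : 0 < A)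
    (F : Measure ℝ) [IsProbabilityMeasure F] (hF : F (Set.Icc 0 A)ᶜ = 0) (x : ℝ) :
    Integrable (fun y => pd K m s sg x y *
      (Real.log (pd K m s sg x y) - Real.log (Pd K m s sg F y))) := by
  obtain ⟨C, hC, h⟩ := log_diff_bound (m := m) hK hs hsg hA F hF |x| (abs_nonneg x)
  apply pd_mul_integrable hsg x _ (C := C) (fun y => h x y le_rfl)
  exact (Real.measurable_log.comp (pd_cont_y _ _ _ _ _).measurable).sub
    (Real.measurable_log.comp (Pd_cont _ _ _ _ _).measurable)

lemma ii_bound {K m s sg : ℝ} (hK : 0 < K) (hs : 0 < s) (hsg : 0 < sg) {A : ℝ} (hA : 0 < A)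
    (F : Measure ℝ) [IsProbabilityMeasure F] (hF : F (Set.Icc 0 A)ᶜ = 0) :
    ∃ C : ℝ, ∀ x ∈ Set.Icc 0 A, |ii K m s sg F x| ≤ C := by
  obtain ⟨C, hC, h⟩ := log_diff_bound (m := m) hK hs hsg hA F hF A hA.le
  obtain ⟨C', h'⟩ := mom2_le (K := K) (m := m) (s := s) hsg A
  refine ⟨C * C', fun x hx => ?_⟩
  have hx' : |x| ≤ A := by rw [abs_of_nonneg hx.1]; exact hx.2
  unfold ii
  calc _ ≤ ∫ y, |pd K m s sg x y * (Real.log (pd K m s sg x y) - Real.log (Pd K m s sg F y))| :=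
        abs_integral_le_integral_abs
    _ ≤ ∫ y, C * (pd K m s sg x y * (1 + y ^ 2)) := by
        apply integral_mono (ii_integrable hK hs hsg hA F hF x).abs
          ((mom2_integrable hsg x).const_mul C)
        intro y
        simp only
        rw [abs_mul, abs_of_nonneg (pd_nonneg _ _ _ _ _ _)]
        nlinarith [h x y hx', pd_nonneg K m s sg x y,
          mul_le_mul_of_nonneg_left (h x y hx') (pd_nonneg K m s sg x y)]
    _ ≤ C * C' := by
        rw [integral_const_mul]
        exact mul_le_mul_of_nonneg_left (h' x hx') hC.le

lemma ii_meas (K m s sg : ℝ) (F : Measure ℝ) [IsProbabilityMeasure F] :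
    StronglyMeasurable (ii K m s sg F) := by
  unfold ii
  apply StronglyMeasurable.integral_prod_right'
    (f := fun p : ℝ × ℝ => pd K m s sg p.1 p.2 *
      (Real.log (pd K m s sg p.1 p.2) - Real.log (Pd K m s sg F p.2)))
  apply Measurable.stronglyMeasurable
  have h1 := (pd_cont K m s sg).measurable
  exact h1.mul ((Real.measurable_log.comp h1).sub
    (Real.measurable_log.comp ((Pd_cont K m s sg F).measurable.comp measurable_snd)))

lemma ii_F_integrable {K m s sg : ℝ} (hK : 0 < K) (hs : 0 < s) (hsg : 0 < sg) {A : ℝ} (hA : 0 < A)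
    (F : Measure ℝ) [IsProbabilityMeasure F] (hF : F (Set.Icc 0 A)ᶜ = 0)
    (G : Measure ℝ) [IsFiniteMeasure G] (hG : G (Set.Icc 0 A)ᶜ = 0) :
    Integrable (ii K m s sg F) G := by
  obtain ⟨C, h⟩ := ii_bound (m := m) hK hs hsg hA F hF
  have hae : ∀ᵐ x ∂G, x ∈ Set.Icc 0 A := by rw [ae_iff]; exact hG
  apply Integrable.mono' (integrable_const C) (ii_meas K m s sg F).aestronglyMeasurable
  filter_upwards [hae] with x hx using h x hx

lemma Pd_prod_integrable {K m s sg : ℝ} (hsg : 0 < sg) (F : Measure ℝ) [IsFiniteMeasure F] :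
    Integrable (fun p : ℝ × ℝ => pd K m s sg p.1 p.2) (F.prod volume) := by
  rw [integrable_prod_iff (pd_cont K m s sg).aestronglyMeasurable]
  constructor
  · filter_upwards with x using pd_integrable_y hsg x
  · have : (fun x => ∫ y, ‖pd K m s sg x y‖) = fun x => 1 := by
      ext x
      simp_rw [Real.norm_of_nonneg (pd_nonneg K m s sg x _)]
      exact pd_integral_y hsg x
    simp only [this]
    exact integrable_const _

lemma Pd_integrable {K m s sg : ℝ} (hsg : 0 < sg) (F : Measure ℝ) [IsFiniteMeasure F] :
    Integrable (Pd K m s sg F) := (Pd_prod_integrable hsg F).integral_prod_right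

lemma Pd_integral {K m s sg : ℝ} (hsg : 0 < sg) (F : Measure ℝ) [IsProbabilityMeasure F] :
    ∫ y, Pd K m s sg F y = 1 := by
  unfold Pd
  rw [integral_integral_swap (f := fun y x => pd K m s sg x y) (Pd_prod_integrable hsg F).swap]
  simp_rw [pd_integral_y hsg]
  simp

lemma ii_nonneg {K m s sg : ℝ} (hK : 0 < K) (hs : 0 < s) (hsg : 0 < sg) {A : ℝ} (hA : 0 < A)
    (F : Measure ℝ) [IsProbabilityMeasure F] (hF : F (Set.Icc 0 A)ᶜ = 0) (x : ℝ) :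
    0 ≤ ii K m s sg F x := by
  have h1 : ∫ y, (pd K m s sg x y - Pd K m s sg F y) ≤ ii K m s sg F x := by
    apply integral_mono ((pd_integrable_y hsg x).sub (Pd_integrable hsg F))
      (ii_integrable hK hs hsg hA F hF x)
    intro y
    simp only [Pi.sub_apply]
    have hp := pd_pos (m := m) hK hs hsg x y
    have hP := Pd_pos (m := m) hK hs hsg F hF y
    have := Real.log_le_sub_one_of_pos (div_pos hP hp)
    rw [Real.log_div hP.ne' hp.ne'] at this
    have h2 := mul_le_mul_of_nonneg_left this hp.le
    have h3 : pd K m s sg x y * (Pd K m s sg F y / pd K m s sg x y - 1) =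
      Pd K m s sg F y - pd K m s sg x y := by field_simp
    rw [h3] at h2
    linarith
  rw [integral_sub (pd_integrable_y hsg x) (Pd_integrable hsg F), pd_integral_y hsg,
    Pd_integral hsg] at h1
  simpa using h1

lemma infoDensity_eq {K m s sg : ℝ} (hK : 0 < K) (hs : 0 < s) (hsg : 0 < sg) {A : ℝ} (hA : 0 < A)
    (F : Measure ℝ) [IsProbabilityMeasure F] (hF : F (Set.Icc 0 A)ᶜ = 0) (x : ℝ) :
    infoDensity K m s sg F x = ENNReal.ofReal (ii K m s sg F x) := by
  have hpm : Measurable (fun y => ENNReal.ofReal (pd K m s sg x y)) :=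
    ENNReal.measurable_ofReal.comp (pd_cont_y _ _ _ _ _).measurable
  have hPm : Measurable (fun y => ENNReal.ofReal (Pd K m s sg F y)) :=
    ENNReal.measurable_ofReal.comp (Pd_cont _ _ _ _ _).measurable
  have h1 : channelLaw K m s sg x = (outputDist K m s sg F).withDensity
      (fun y => ENNReal.ofReal (pd K m s sg x y / Pd K m s sg F y)) := by
    have hm : Measurable (fun y => ENNReal.ofReal (pd K m s sg x y / Pd K m s sg F y)) :=
      ENNReal.measurable_ofReal.comp
        ((pd_cont_y _ _ _ _ _).measurable.div (Pd_cont _ _ _ _ _).measurable)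
    rw [outputDist_eq hsg, ← withDensity_mul _ hPm hm, channelLaw_eq hsg]
    congr 1
    ext y
    simp only [Pi.mul_apply]
    have hP := Pd_pos (m := m) hK hs hsg F hF y
    rw [← ENNReal.ofReal_mul hP.le]
    congr 1
    field_simp
  have hsf : SigmaFinite (outputDist K m s sg F) := by
    have : IsFiniteMeasure (outputDist K m s sg F) := by
      rw [outputDist_eq hsg]
      exact isFiniteMeasure_withDensity_ofReal (Pd_integrable hsg F).2
    infer_instance
  have hac : channelLaw K m s sg x ≪ outputDist K m s sg F := by
    rw [h1]; exact withDensity_absolutelyContinuous _ _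
  have h2 : llr (channelLaw K m s sg x) (outputDist K m s sg F) =ᵐ[channelLaw K m s sg x]
      fun y => Real.log (pd K m s sg x y) - Real.log (Pd K m s sg F y) := by
    apply hac.ae_le
    have hm : Measurable (fun y => ENNReal.ofReal (pd K m s sg x y / Pd K m s sg F y)) :=
      ENNReal.measurable_ofReal.comp
        ((pd_cont_y _ _ _ _ _).measurable.div (Pd_cont _ _ _ _ _).measurable)
    have := Measure.rnDeriv_withDensity (outputDist K m s sg F) hm
    rw [← h1] at this
    filter_upwards [this] with y hy
    have hp := pd_pos (m := m) hK hs hsg x y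
    have hP := Pd_pos (m := m) hK hs hsg F hF y
    rw [llr_def]
    simp only [hy]
    rw [ENNReal.toReal_ofReal (div_pos hp hP).le, Real.log_div hp.ne' hP.ne']
  have h3 : Integrable (llr (channelLaw K m s sg x) (outputDist K m s sg F))
      (channelLaw K m s sg x) := by
    rw [integrable_congr h2, integrable_channel_iff hsg]
    exact ii_integrable hK hs hsg hA F hF x
  unfold infoDensity klDiv'
  rw [if_pos ⟨hac, h3⟩, integral_congr_ae h2, integral_channel hsg]
  rfl

lemma mutualInfo_eq {K m s sg : ℝ} (hK : 0 < K) (hs : 0 < s) (hsg : 0 < sg) {A : ℝ} (hA : 0 < A)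
    (F : Measure ℝ) [IsProbabilityMeasure F] (hF : F (Set.Icc 0 A)ᶜ = 0) :
    mutualInfo K m s sg F = ENNReal.ofReal (∫ x, ii K m s sg F x ∂F) := by
  unfold mutualInfo
  simp_rw [infoDensity_eq hK hs hsg hA F hF]
  rw [ofReal_integral_eq_lintegral_ofReal (ii_F_integrable hK hs hsg hA F hF F hF)]
  filter_upwards with x using ii_nonneg hK hs hsg hA F hF x


/-! ### Part C : first order condition -/

lemma integral_tilt (F : Measure ℝ) [IsProbabilityMeasure F] {w : ℝ → ℝ} (hw : Measurable w)
    (hpos : ∀ x, 0 ≤ w x) (f : ℝ → ℝ) :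
    ∫ x, f x ∂(F.withDensity (fun x => ENNReal.ofReal (w x))) = ∫ x, w x * f x ∂F := by
  rw [integral_withDensity_eq_integral_toReal_smul₀
    (f := fun x => ENNReal.ofReal (w x)) ((ENNReal.measurable_ofReal.comp hw).aemeasurable)
    (by filter_upwards with y using ENNReal.ofReal_lt_top)]
  simp [ENNReal.toReal_ofReal (hpos _)]

lemma integrable_bdd_on {F : Measure ℝ} [IsFiniteMeasure F] {A : ℝ}
    (hF : F (Set.Icc 0 A)ᶜ = 0) {f : ℝ → ℝ} (hf : AEStronglyMeasurable f F) {C : ℝ}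
    (h : ∀ x ∈ Set.Icc 0 A, |f x| ≤ C) : Integrable f F := by
  have hae : ∀ᵐ x ∂F, x ∈ Set.Icc 0 A := by rw [ae_iff]; exact hF
  apply Integrable.mono' (integrable_const C) hf
  filter_upwards [hae] with x hx using h x hx

lemma gfun_meas (b c : ℝ) : Measurable (fun x : ℝ => b * x * Real.log (1 + c * x)) := by
  fun_prop

lemma gfun_cont {b c : ℝ} (hc : 0 < c) (A : ℝ) :
    ContinuousOn (fun x : ℝ => b * x * Real.log (1 + c * x)) (Set.Icc 0 A) := by
  apply ContinuousOn.mul (by fun_prop)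
  apply ContinuousOn.log (by fun_prop)
  intro x hx
  have := mul_nonneg hc.le hx.1
  linarith

lemma gfun_bound {b c : ℝ} (hc : 0 < c) (A : ℝ) :
    ∃ C, ∀ x ∈ Set.Icc 0 A, |b * x * Real.log (1 + c * x)| ≤ C := by
  obtain ⟨C, hC⟩ := isCompact_Icc.exists_bound_of_continuousOn (gfun_cont (b := b) hc A)
  exact ⟨C, hC⟩

lemma first_order {K m s sg A ε b c Eth : ℝ}
    (hK : 0 < K) (hs : 0 < s) (hsg : 0 < sg) (hA : 0 < A) (hc : 0 < c)
    (F : Measure ℝ) (hF : feasible A ε b c Eth F)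
    (hopt : mutualInfo K m s sg F = capacity K m s sg A ε b c Eth)
    (φ : ℝ → ℝ) (hφm : Measurable φ) (M : ℝ) (hM : 0 < M) (hφ : ∀ x, |φ x| ≤ M)
    (h0 : ∫ x, φ x ∂F = 0) (h1 : ∫ x, x * φ x ∂F = 0)
    (h2 : ∫ x, (b * x * Real.log (1 + c * x)) * φ x ∂F = 0) :
    ∫ x, ii K m s sg F x * φ x ∂F = 0 := by
  obtain ⟨hFp, hFs, hFε, hFE⟩ := hF
  have hφi : ∀ f : ℝ → ℝ, Integrable f F → Integrable (fun x => f x * φ x) F := by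
    intro f hf
    exact hf.mul_bdd (c := M) hφm.aestronglyMeasurable (by filter_upwards with x using hφ x)
  have hiiF := ii_F_integrable (m := m) hK hs hsg hA F hFs F hFs
  set J := ∫ x, ii K m s sg F x * φ x ∂F with hJ
  set I := ∫ x, ii K m s sg F x ∂F with hI
  have hIn : 0 ≤ I := integral_nonneg fun x => ii_nonneg hK hs hsg hA F hFs x
  set P := Pd K m s sg F with hP
  set R : ℝ → ℝ := fun y => ∫ x, pd K m s sg x y * φ x ∂F with hR
  have hPpos : ∀ y, 0 < P y := Pd_pos hK hs hsg F hFs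
  have hRP : ∀ y, |R y| ≤ M * P y := by
    intro y
    calc |R y| ≤ ∫ x, |pd K m s sg x y * φ x| ∂F := abs_integral_le_integral_abs
      _ ≤ ∫ x, M * pd K m s sg x y ∂F := by
        apply integral_mono (hφi _ (pd_int_F _ _ _ _ _ _)).abs ((pd_int_F _ _ _ _ _ _).const_mul M)
        intro x
        simp only
        rw [abs_mul, abs_of_nonneg (pd_nonneg _ _ _ _ _ _), mul_comm]
        exact mul_le_mul_of_nonneg_right (hφ x) (pd_nonneg _ _ _ _ _ _)
      _ = M * P y := by rw [integral_const_mul]; rfl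
  have hRprod : Integrable (fun p : ℝ × ℝ => pd K m s sg p.1 p.2 * φ p.1) (F.prod volume) := by
    apply (Pd_prod_integrable hsg F).mul_bdd (c := M)
      (hφm.comp measurable_fst).aestronglyMeasurable (by filter_upwards with x using hφ x.1)
  have hRi : Integrable R := hRprod.integral_prod_right
  have hRm : AEStronglyMeasurable R := hRi.1
  have hR0 : ∫ y, R y = 0 := by
    have := integral_integral_swap (f := fun y x => pd K m s sg x y * φ x) hRprod.swap
    simp only [hR]
    rw [this]
    simp_rw [integral_mul_const, pd_integral_y hsg, one_mul]
    exact h0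
  have hPc : Continuous P := Pd_cont _ _ _ _ _
  have hR2i : Integrable (fun y => R y * (R y / P y)) := by
    apply hRi.mul_bdd (c := M) (hRm.div₀ hPc.aestronglyMeasurable)
    filter_upwards with y
    rw [Pi.div_apply, norm_div, Real.norm_eq_abs, Real.norm_of_nonneg (hPpos y).le,
      div_le_iff₀ (hPpos y)]
    exact hRP y
  have hR2 : ∫ y, R y * (R y / P y) ≤ M ^ 2 := by
    calc _ ≤ ∫ y, M ^ 2 * P y := by
          apply integral_mono hR2i ((Pd_integrable hsg F).const_mul _)
          intro y
          simp only
          rw [← mul_div_assoc, div_le_iff₀ (hPpos y)]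
          have := hRP y
          have h4 := sq_le_sq' (by linarith [neg_abs_le (R y)]) ((le_abs_self _).trans this)
          nlinarith
      _ = M ^ 2 := by rw [integral_const_mul, Pd_integral hsg, mul_one]
  have key : ∀ t : ℝ, |t| * M ≤ 1 / 2 → t * J ≤ t ^ 2 * M ^ 2 := by
    intro t ht
    set w : ℝ → ℝ := fun x => 1 + t * φ x with hw
    have hwm : Measurable w := by fun_prop
    have htφ : ∀ x, |t * φ x| ≤ 1 / 2 := by
      intro x; rw [abs_mul]
      exact (mul_le_mul_of_nonneg_left (hφ x) (abs_nonneg t)).trans ht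
    have hwpos : ∀ x, 0 ≤ w x := by
      intro x; have := neg_abs_le (t * φ x); have := htφ x; simp only [hw]; linarith
    set Ft := F.withDensity (fun x => ENNReal.ofReal (w x)) with hFt
    have hIntg : ∀ f : ℝ → ℝ, Integrable f F →
        ∫ x, f x ∂Ft = ∫ x, f x ∂F + t * ∫ x, f x * φ x ∂F := by
      intro f hf
      rw [hFt, integral_tilt F hwm hwpos]
      have : ∀ x, w x * f x = f x + t * (f x * φ x) := by intro x; simp only [hw]; ring
      simp_rw [this]
      rw [integral_add hf ((hφi f hf).const_mul t), integral_const_mul]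
    have hwi : Integrable w F := by
      have := (hφi (fun _ => 1) (integrable_const _)).const_mul t
      simpa [hw] using (integrable_const (1:ℝ)).add this
    have hFtfin : IsFiniteMeasure Ft := isFiniteMeasure_withDensity_ofReal hwi.2
    have hFtp : IsProbabilityMeasure Ft := by
      have h3 := hIntg (fun _ => 1) (integrable_const _)
      simp only [integral_const, smul_eq_mul, mul_one, one_mul, h0, mul_zero, add_zero,
        probReal_univ] at h3
      refine ⟨?_⟩
      have := (ENNReal.toReal_eq_one_iff (Ft Set.univ)).1 h3
      exact this
    have hFts : Ft (Set.Icc 0 A)ᶜ = 0 := withDensity_absolutelyContinuous _ _ hFs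
    have hxi : Integrable (fun x : ℝ => x) F := by
      apply integrable_bdd_on hFs (by fun_prop) (C := A)
      intro x hx; rw [abs_of_nonneg hx.1]; exact hx.2
    have hgi : Integrable (fun x : ℝ => b * x * Real.log (1 + c * x)) F := by
      obtain ⟨C, hC⟩ := gfun_bound (b := b) hc A
      exact integrable_bdd_on hFs (gfun_meas b c).aestronglyMeasurable hC
    have hfeas : feasible A ε b c Eth Ft := by
      refine ⟨hFtp, hFts, ?_, ?_⟩
      · rw [hIntg _ hxi, h1]; simpa using hFε
      · rw [hIntg _ hgi, h2]; simpa using hFE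
    have hle : mutualInfo K m s sg Ft ≤ mutualInfo K m s sg F := by
      rw [hopt]; unfold capacity
      exact le_iSup₂ (f := fun (F : Measure ℝ) (_ : F ∈ {F : Measure ℝ | feasible A ε b c Eth F}) =>
        mutualInfo K m s sg F) Ft hfeas
    rw [mutualInfo_eq hK hs hsg hA F hFs, mutualInfo_eq hK hs hsg hA Ft hFts,
      ENNReal.ofReal_le_ofReal_iff hIn] at hle
    have hPt : ∀ y, Pd K m s sg Ft y = P y + t * R y := by
      intro y
      exact hIntg _ (pd_int_F _ _ _ _ _ _)
    have hrb : ∀ y, ‖R y / P y‖ ≤ M := by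
      intro y
      rw [norm_div, Real.norm_eq_abs, Real.norm_of_nonneg (hPpos y).le, div_le_iff₀ (hPpos y)]
      exact hRP y
    have hpri : ∀ x, Integrable (fun y => pd K m s sg x y * (R y / P y)) := by
      intro x
      apply (pd_integrable_y hsg x).mul_bdd (c := M) (hRm.div₀ hPc.aestronglyMeasurable)
      filter_upwards with y using hrb y
    have hiit : ∀ x, ii K m s sg F x - t * ∫ y, pd K m s sg x y * (R y / P y)
        ≤ ii K m s sg Ft x := by
      intro x
      unfold ii
      rw [← integral_const_mul, ← integral_sub (ii_integrable hK hs hsg hA F hFs x)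
        ((hpri x).const_mul t)]
      apply integral_mono ((ii_integrable hK hs hsg hA F hFs x).sub
        ((hpri x).const_mul t)) (ii_integrable hK hs hsg hA Ft hFts x)
      intro y
      simp only [Pi.sub_apply]
      have hPty : 0 < P y + t * R y := by rw [← hPt]; exact Pd_pos hK hs hsg Ft hFts y
      have h5 := Real.log_le_sub_one_of_pos (div_pos hPty (hPpos y))
      rw [Real.log_div hPty.ne' (hPpos y).ne'] at h5
      have h6 : (P y + t * R y) / P y - 1 = t * (R y / P y) := by
        have := (hPpos y).ne'
        field_simp
        ring
      rw [h6] at h5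
      rw [hPt]
      have h7 := mul_le_mul_of_nonneg_left h5 (pd_nonneg K m s sg x y)
      have : Pd K m s sg F y = P y := rfl
      rw [this]
      nlinarith
    have hprodt : Integrable (fun p : ℝ × ℝ => pd K m s sg p.1 p.2 * (R p.2 / P p.2))
        (Ft.prod volume) := by
      apply (Pd_prod_integrable hsg Ft).mul_bdd (c := M)
        (hRm.div₀ hPc.aestronglyMeasurable).comp_snd
      filter_upwards with p using hrb p.2
    have hswap : ∫ x, (∫ y, pd K m s sg x y * (R y / P y)) ∂Ft = t * ∫ y, R y * (R y / P y) := by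
      rw [integral_integral_swap (f := fun x y => pd K m s sg x y * (R y / P y)) hprodt]
      simp_rw [integral_mul_const]
      have : ∀ y, (∫ x, pd K m s sg x y ∂Ft) * (R y / P y) = R y + t * (R y * (R y / P y)) := by
        intro y
        have h8 := hPt y
        unfold Pd at h8
        rw [h8]
        have := (hPpos y).ne'
        field_simp
      simp_rw [this]
      rw [integral_add hRi (hR2i.const_mul t), hR0, integral_const_mul, zero_add]
    have h9 : ∫ x, (ii K m s sg F x - t * ∫ y, pd K m s sg x y * (R y / P y)) ∂Ft
        ≤ ∫ x, ii K m s sg Ft x ∂Ft := by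
      apply integral_mono _ (ii_F_integrable hK hs hsg hA Ft hFts Ft hFts) hiit
      exact (ii_F_integrable hK hs hsg hA F hFs Ft hFts).sub
        (hprodt.integral_prod_left.const_mul t)
    rw [integral_sub (ii_F_integrable hK hs hsg hA F hFs Ft hFts)
      (hprodt.integral_prod_left.const_mul t), integral_const_mul, hswap, hIntg _ hiiF] at h9
    have : t ^ 2 * ∫ y, R y * (R y / P y) ≤ t ^ 2 * M ^ 2 :=
      mul_le_mul_of_nonneg_left hR2 (sq_nonneg t)
    nlinarith
  have hle : ∀ t : ℝ, 0 < t → t * M ≤ 1 / 2 → |J| ≤ t * M ^ 2 := by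
    intro t ht htM
    have k1 := key t (by rwa [abs_of_pos ht])
    have k2 := key (-t) (by rwa [abs_neg, abs_of_pos ht])
    rw [abs_le]
    constructor
    · have : t * (-J) ≤ t * (t * M ^ 2) := by nlinarith
      have := le_of_mul_le_mul_left this ht
      linarith
    · have : t * J ≤ t * (t * M ^ 2) := by nlinarith
      exact le_of_mul_le_mul_left this ht
  have : |J| ≤ 0 := by
    apply _root_.le_of_forall_pos_le_add
    intro e he
    have ht : 0 < min (1 / (2 * M)) (e / M ^ 2) := by positivity
    have := hle _ ht (by
      calc _ ≤ 1 / (2 * M) * M := by gcongr; exact min_le_left _ _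
        _ ≤ 1 / 2 := by apply le_of_eq; field_simp)
    refine this.trans ?_
    rw [zero_add]
    calc _ ≤ e / M ^ 2 * M ^ 2 := by gcongr; exact min_le_right _ _
      _ = e := by field_simp
  exact abs_nonpos_iff.1 this

open BoundedContinuousFunction in
lemma kkt {K m s sg A ε b c Eth : ℝ}
    (hK : 0 < K) (hs : 0 < s) (hsg : 0 < sg) (hA : 0 < A) (hc : 0 < c)
    (F : Measure ℝ) (hF : feasible A ε b c Eth F)
    (hopt : mutualInfo K m s sg F = capacity K m s sg A ε b c Eth) :
    ∃ α β γ : ℝ, ∀ᵐ x ∂F, ii K m s sg F x = α + β * x + γ * (b * x * Real.log (1 + c * x)) := by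
  have hF' := hF
  obtain ⟨hFp, hFs, hFε, hFE⟩ := hF'
  have hφi : ∀ f : ℝ → ℝ, Integrable f F → ∀ φ : ℝ →ᵇ ℝ, Integrable (fun x => f x * φ x) F := by
    intro f hf φ
    exact hf.mul_bdd (c := ‖φ‖) φ.continuous.aestronglyMeasurable
      (by filter_upwards with x using φ.norm_coe_le_norm x)
  let Lf : ∀ f : ℝ → ℝ, Integrable f F → ((ℝ →ᵇ ℝ) →ₗ[ℝ] ℝ) := fun f hf =>
    { toFun := fun φ => ∫ x, f x * φ x ∂F
      map_add' := by
        intro φ ψ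
        rw [← integral_add (hφi f hf φ) (hφi f hf ψ)]
        congr 1; ext x; simp [mul_add]
      map_smul' := by
        intro r φ
        simp only [RingHom.id_apply, smul_eq_mul]
        rw [← integral_const_mul]
        congr 1; ext x; simp; ring }
  have hxi : Integrable (fun x : ℝ => x) F := by
    apply integrable_bdd_on hFs (by fun_prop) (C := A)
    intro x hx; rw [abs_of_nonneg hx.1]; exact hx.2
  have hgi : Integrable (fun x : ℝ => b * x * Real.log (1 + c * x)) F := by
    obtain ⟨C, hC⟩ := gfun_bound (b := b) hc A
    exact integrable_bdd_on hFs (gfun_meas b c).aestronglyMeasurable hC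
  have h1i : Integrable (fun x : ℝ => (1:ℝ)) F := integrable_const _
  have hii := ii_F_integrable (m := m) hK hs hsg hA F hFs F hFs
  have hspan : Lf _ hii ∈ Submodule.span ℝ (Set.range ![Lf _ h1i, Lf _ hxi, Lf _ hgi]) := by
    apply mem_span_of_iInf_ker_le_ker
    intro φ hφ
    simp only [Submodule.mem_iInf, LinearMap.mem_ker] at hφ ⊢
    have e0 := hφ 0
    have e1 := hφ 1
    have e2 := hφ 2
    simp only [Matrix.cons_val_zero, Matrix.cons_val_one, Matrix.cons_val, Lf, LinearMap.coe_mk,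
      AddHom.coe_mk, one_mul] at e0 e1 e2 ⊢
    exact first_order hK hs hsg hA hc F hF hopt φ φ.continuous.measurable (‖φ‖ + 1)
      (by positivity) (fun x => (φ.norm_coe_le_norm x).trans (by linarith)) e0 e1 e2
  rw [Submodule.mem_span_range_iff_exists_fun] at hspan
  obtain ⟨d, hd⟩ := hspan
  refine ⟨d 0, d 1, d 2, ?_⟩
  have hDi : Integrable (fun x => ii K m s sg F x -
      (d 0 + d 1 * x + d 2 * (b * x * Real.log (1 + c * x)))) F := by
    apply hii.sub
    exact ((integrable_const _).add (hxi.const_mul _)).add (hgi.const_mul _)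
  have hz : ∀ᵐ x ∂F, ii K m s sg F x -
      (d 0 + d 1 * x + d 2 * (b * x * Real.log (1 + c * x))) = 0 := by
    apply ae_eq_zero_of_integral_contDiff_smul_eq_zero hDi.locallyIntegrable
    intro g hg hgc
    let φ : ℝ →ᵇ ℝ := BoundedContinuousFunction.ofNormedAddCommGroup g hg.continuous _
      (hg.continuous.bounded_above_of_compact_support hgc).choose_spec
    have e := congrArg (fun L => L φ) hd
    simp only [Fin.sum_univ_three, LinearMap.add_apply, LinearMap.smul_apply, smul_eq_mul,
      Matrix.cons_val_zero, Matrix.cons_val_one, Matrix.cons_val, Lf, LinearMap.coe_mk,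
      AddHom.coe_mk, one_mul] at e
    have i0 := (hφi _ h1i φ).const_mul (d 0)
    have i1 := (hφi _ hxi φ).const_mul (d 1)
    have i2 := (hφi _ hgi φ).const_mul (d 2)
    have i3 := hφi _ hii φ
    have i01 : Integrable (fun x => d 0 * (1 * φ x) + d 1 * (x * φ x)) F := i0.add i1
    have i012 : Integrable (fun x => d 0 * (1 * φ x) + d 1 * (x * φ x) +
        d 2 * ((b * x * Real.log (1 + c * x)) * φ x)) F := i01.add i2
    have : ∀ x, g x • (ii K m s sg F x -
      (d 0 + d 1 * x + d 2 * (b * x * Real.log (1 + c * x)))) =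
      ii K m s sg F x * φ x - (d 0 * (1 * φ x) + d 1 * (x * φ x) +
        d 2 * ((b * x * Real.log (1 + c * x)) * φ x)) := by
      intro x
      have : φ x = g x := rfl
      rw [this, smul_eq_mul]; ring
    simp_rw [this]
    rw [integral_sub i3 i012, integral_add i01 i2, integral_add i0 i1,
      integral_const_mul (d 0), integral_const_mul (d 1), integral_const_mul (d 2)]
    simp only [one_mul]
    linarith
  filter_upwards [hz] with x hx
  linarith


/-! ### Part D : two sided estimates and the ratio bound -/

/-- integrand over the log-amplitude -/
def kg (K s sg c y w : ℝ) : ℝ :=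
  ph sg (y - K * Real.exp (2 * w)) * Real.exp (-(w - c) ^ 2 / (2 * s ^ 2))

/-- unnormalised output density -/
def EE (K s sg c y : ℝ) : ℝ := ∫ w, kg K s sg c y w

/-- normalising constant -/
def kap (s : ℝ) : ℝ := (√(2 * π * s ^ 2))⁻¹

lemma kap_pos {s : ℝ} (hs : 0 < s) : 0 < kap s := by
  unfold kap; have := Real.pi_pos; positivity

lemma integral_gam {m s : ℝ} (hs : 0 < s) (f : ℝ → ℝ) :
    ∫ g, f g ∂(gam m s) = kap s * ∫ g, f g * Real.exp (-(g - m) ^ 2 / (2 * s ^ 2)) := by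
  unfold gam
  rw [integral_gaussianReal_eq_integral_smul (var_ne hs), ← integral_const_mul]
  congr 1
  ext g
  simp only [gaussianPDFReal, kap, smul_eq_mul, Real.coe_toNNReal _ (sq_nonneg s)]
  ring

lemma pd_eq_EE {K m s sg : ℝ} (hs : 0 < s) (t y : ℝ) :
    pd K m s sg (Real.exp (2 * t)) y = kap s * EE K s sg (m + t) y := by
  unfold pd EE kg
  rw [integral_gam hs]
  congr 1
  rw [← integral_add_right_eq_self (fun w => ph sg (y - K * Real.exp (2 * w)) *
    Real.exp (-(w - (m + t)) ^ 2 / (2 * s ^ 2))) t]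
  congr 1
  ext g
  have h1 : K * Real.exp (2 * t) * Real.exp (2 * g) = K * Real.exp (2 * (g + t)) := by
    rw [mul_assoc, ← Real.exp_add]; congr 2; ring
  have h2 : g + t - (m + t) = g - m := by ring
  rw [h1, h2]

lemma gexp_int {s : ℝ} (hs : 0 < s) (c : ℝ) :
    Integrable (fun w : ℝ => Real.exp (-(w - c) ^ 2 / (2 * s ^ 2))) := by
  have := integrable_exp_neg_mul_sq (b := 1 / (2 * s ^ 2)) (by positivity)
  have := this.comp_sub_right c
  convert this using 2
  congr 1; ring

lemma kg_cont (K s sg c y : ℝ) : Continuous (kg K s sg c y) := by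
  unfold kg
  exact ((ph_cont sg).comp (by fun_prop)).mul (by fun_prop)

lemma kg_nonneg (K s sg c y w : ℝ) : 0 ≤ kg K s sg c y w :=
  mul_nonneg (ph_nonneg _ _) (Real.exp_pos _).le

lemma kg_int (K : ℝ) {s : ℝ} (hs : 0 < s) (sg c y : ℝ) : Integrable (kg K s sg c y) := by
  apply Integrable.mono' ((gexp_int hs c).const_mul (ph sg 0)) (kg_cont _ _ _ _ _).aestronglyMeasurable
  filter_upwards with w
  rw [Real.norm_of_nonneg (kg_nonneg _ _ _ _ _ _)]
  exact mul_le_mul_of_nonneg_right (ph_le _ _) (Real.exp_pos _).le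

lemma ph_mul_ph (sg a b : ℝ) :
    ph sg a * ph sg b = kap sg ^ 2 * Real.exp (-(a ^ 2 + b ^ 2) / (2 * sg ^ 2)) := by
  unfold ph kap
  rw [mul_mul_mul_comm, ← Real.exp_add, ← sq]
  congr 2
  ring

/-- Log-concavity in the shift for nonpositive `y`. -/
lemma ratio_neg {K s sg : ℝ} (hK : 0 < K) (hs : 0 < s) (hsg : 0 < sg) (c η y : ℝ) (hη : 0 ≤ η)
    (hy : y ≤ 0) :
    EE K s sg (c + η) y * EE K s sg (c - η) y ≤ EE K s sg c y ^ 2 := by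
  set k : ℝ → ℝ := fun w => ph sg (y - K * Real.exp (2 * w)) with hk
  set G : ℝ → ℝ := fun w => Real.exp (-(w - c) ^ 2 / (2 * s ^ 2)) with hG
  have hGp : ∀ w, G w = Real.exp (-(w - c) ^ 2 / (2 * s ^ 2)) := fun w => rfl
  -- the four kinds of one dimensional functions
  have f1 : Integrable (fun w => k w * G w) := kg_int K hs sg c y
  have f2 : Integrable (fun w => k w * G (w - η)) := by
    have := kg_int K hs sg (c + η) y
    convert this using 2 with w
    unfold kg; simp only [hk, hG]; congr 3; ring
  have f3 : Integrable (fun w => k w * G (w + η)) := by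
    have := kg_int K hs sg (c - η) y
    convert this using 2 with w
    unfold kg; simp only [hk, hG]; congr 3; ring
  have e1 : ∫ w, k w * G w = EE K s sg c y := rfl
  have e2 : ∫ w, k w * G (w - η) = EE K s sg (c + η) y := by
    unfold EE kg; congr 1; ext w; simp only [hk, hG]; congr 3; ring
  have e3 : ∫ w, k w * G (w + η) = EE K s sg (c - η) y := by
    unfold EE kg; congr 1; ext w; simp only [hk, hG]; congr 3; ring
  have f4 : Integrable (fun w => k (w - η) * G (w - η)) := f1.comp_sub_right η
  have f5 : Integrable (fun w => k (w + η) * G (w + η)) := f1.comp_add_right η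
  have f6 : Integrable (fun w => k (w - η) * G w) := by
    have := f3.comp_sub_right η
    simpa using this
  have f7 : Integrable (fun w => k (w + η) * G w) := by
    have := f2.comp_add_right η
    simpa using this
  have e4 : ∫ w, k (w - η) * G (w - η) = EE K s sg c y := by
    rw [integral_sub_right_eq_self (fun w => k w * G w) η]; exact e1
  have e5 : ∫ w, k (w + η) * G (w + η) = EE K s sg c y := by
    rw [integral_add_right_eq_self (fun w => k w * G w) η]; exact e1
  have e6 : ∫ w, k (w - η) * G w = EE K s sg (c - η) y := by
    have := integral_sub_right_eq_self (fun w => k w * G (w + η)) η (μ := volume)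
    simp only [sub_add_cancel] at this
    rw [this, e3]
  have e7 : ∫ w, k (w + η) * G w = EE K s sg (c + η) y := by
    have := integral_add_right_eq_self (fun w => k w * G (w - η)) η (μ := volume)
    simp only [add_sub_cancel_right] at this
    rw [this, e2]
  -- pointwise rearrangement
  have hpt : ∀ z : ℝ × ℝ,
      (k z.1 * G (z.1 - η)) * (k z.2 * G (z.2 + η)) + (k (z.1 - η) * G z.1) * (k (z.2 + η) * G z.2) ≤
      (k z.1 * G z.1) * (k z.2 * G z.2) + (k (z.1 - η) * G (z.1 - η)) * (k (z.2 + η) * G (z.2 + η)) := by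
    rintro ⟨w1, w2⟩
    simp only
    have hGG : G w1 * G w2 = Real.exp (-((w1 - c) ^ 2 + (w2 - c) ^ 2) / (2 * s ^ 2)) := by
      simp only [hG]; rw [← Real.exp_add]; congr 1; ring
    have hGG' : G (w1 - η) * G (w2 + η) =
        Real.exp (-((w1 - η - c) ^ 2 + (w2 + η - c) ^ 2) / (2 * s ^ 2)) := by
      simp only [hG]; rw [← Real.exp_add]; congr 1; ring
    have hkk : k w1 * k w2 = kap sg ^ 2 *
        Real.exp (-((y - K * Real.exp (2 * w1)) ^ 2 + (y - K * Real.exp (2 * w2)) ^ 2) / (2 * sg ^ 2)) :=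
      ph_mul_ph _ _ _
    have hkk' : k (w1 - η) * k (w2 + η) = kap sg ^ 2 *
        Real.exp (-((y - K * Real.exp (2 * (w1 - η))) ^ 2 + (y - K * Real.exp (2 * (w2 + η))) ^ 2) /
          (2 * sg ^ 2)) :=
      ph_mul_ph _ _ _
    set u := Real.exp (2 * (w1 - η)) with hu
    set v := Real.exp (2 * w2) with hv
    set r := Real.exp (2 * η) with hr
    have hup : 0 < u := Real.exp_pos _
    have hvp : 0 < v := Real.exp_pos _
    have hr1 : 1 ≤ r := Real.one_le_exp (by linarith)
    have hur : Real.exp (2 * w1) = u * r := by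
      rw [hu, hr, ← Real.exp_add]; congr 1; ring
    have hvr : Real.exp (2 * (w2 + η)) = v * r := by
      rw [hv, hr, ← Real.exp_add]; congr 1; ring
    rw [hur] at hkk
    rw [hvr] at hkk'
    have hdiff : (y - K * u) ^ 2 + (y - K * (v * r)) ^ 2 -
        ((y - K * (u * r)) ^ 2 + (y - K * v) ^ 2) =
        (v - u) * ((r - 1) * (K * (2 * (-y) + K * (v + u) * (r + 1)))) := by ring
    have hfac : 0 ≤ (r - 1) * (K * (2 * (-y) + K * (v + u) * (r + 1))) := by
      have : 0 ≤ -y := by linarith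
      have : 0 ≤ r - 1 := by linarith
      positivity
    have hs2 : 0 < 2 * s ^ 2 := by positivity
    have hsg2 : 0 < 2 * sg ^ 2 := by positivity
    have hmain : 0 ≤ (k w1 * k w2 - k (w1 - η) * k (w2 + η)) *
        (G w1 * G w2 - G (w1 - η) * G (w2 + η)) := by
      rw [hGG, hGG', hkk, hkk']
      rcases le_total (w1 - η) w2 with h | h
      · have huv : u ≤ v := Real.exp_le_exp.2 (by linarith)
        apply mul_nonneg
        · rw [sub_nonneg]
          apply mul_le_mul_of_nonneg_left _ (sq_nonneg _)
          apply Real.exp_le_exp.2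
          apply div_le_div_of_nonneg_right _ hsg2.le
          have := mul_nonneg (sub_nonneg.2 huv) hfac
          linarith
        · rw [sub_nonneg]
          apply Real.exp_le_exp.2
          apply div_le_div_of_nonneg_right _ hs2.le
          linarith [mul_nonneg hη (sub_nonneg.2 h)]
      · have huv : v ≤ u := Real.exp_le_exp.2 (by linarith)
        apply mul_nonneg_of_nonpos_of_nonpos
        · rw [sub_nonpos]
          apply mul_le_mul_of_nonneg_left _ (sq_nonneg _)
          apply Real.exp_le_exp.2
          apply div_le_div_of_nonneg_right _ hsg2.le
          have := mul_nonneg (sub_nonneg.2 huv) hfac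
          linarith
        · rw [sub_nonpos]
          apply Real.exp_le_exp.2
          apply div_le_div_of_nonneg_right _ hs2.le
          linarith [mul_nonneg hη (sub_nonneg.2 h)]
    linarith [hmain]
  clear_value k G
  have hIntg : ∫ z : ℝ × ℝ, ((k z.1 * G (z.1 - η)) * (k z.2 * G (z.2 + η)) +
        (k (z.1 - η) * G z.1) * (k (z.2 + η) * G z.2)) ∂(volume.prod volume) ≤
      ∫ z : ℝ × ℝ, ((k z.1 * G z.1) * (k z.2 * G z.2) +
        (k (z.1 - η) * G (z.1 - η)) * (k (z.2 + η) * G (z.2 + η))) ∂(volume.prod volume) :=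
    integral_mono ((f2.mul_prod f3).add (f6.mul_prod f7))
      ((f1.mul_prod f1).add (f4.mul_prod f5)) hpt
  rw [integral_add (f2.mul_prod f3) (f6.mul_prod f7),
    integral_add (f1.mul_prod f1) (f4.mul_prod f5),
    integral_prod_mul (fun w => k w * G (w - η)) (fun w => k w * G (w + η)),
    integral_prod_mul (fun w => k (w - η) * G w) (fun w => k (w + η) * G w),
    integral_prod_mul (fun w => k w * G w) (fun w => k w * G w),
    integral_prod_mul (fun w => k (w - η) * G (w - η)) (fun w => k (w + η) * G (w + η)),
    e1, e2, e3, e4, e5, e6, e7] at hIntg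
  nlinarith


/-- centre of the posterior for large `y` -/
def ell (K y : ℝ) : ℝ := Real.log ((1 + y) / K) / 2

lemma exp_ell {K y : ℝ} (hK : 0 < K) (hy : 0 ≤ y) : K * Real.exp (2 * ell K y) = 1 + y := by
  unfold ell
  rw [mul_div_cancel₀ _ (by norm_num : (2:ℝ) ≠ 0), Real.exp_log (by positivity)]
  field_simp

lemma log_one_add_le {y : ℝ} (hy : 0 ≤ y) : Real.log (1 + y) ≤ y := by
  have := Real.log_le_sub_one_of_pos (by linarith : 0 < 1 + y); linarith

lemma log_sq_le {y : ℝ} (hy : 0 ≤ y) : Real.log (1 + y) ^ 2 ≤ 4 * (1 + y) := by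
  have h0 : 0 ≤ Real.log (1 + y) := Real.log_nonneg (by linarith)
  have h1 : Real.log (1 + y) ≤ 2 * √(1 + y) := by
    have h2 : Real.log (√(1 + y)) ≤ √(1 + y) := by
      have := Real.log_le_sub_one_of_pos (Real.sqrt_pos.2 (by linarith : 0 < 1 + y)); linarith
    rw [Real.log_sqrt (by linarith)] at h2
    linarith
  have h3 : √(1 + y) ^ 2 = 1 + y := Real.sq_sqrt (by linarith)
  nlinarith [Real.sqrt_nonneg (1 + y)]

lemma ell_bounds {K y : ℝ} (hK : 0 < K) (hy : 0 ≤ y) :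
    -(|Real.log K| / 2) ≤ ell K y ∧ ell K y ≤ |Real.log K| / 2 + Real.log (1 + y) / 2 := by
  unfold ell
  rw [Real.log_div (by linarith) hK.ne']
  have h0 : 0 ≤ Real.log (1 + y) := Real.log_nonneg (by linarith)
  constructor
  · linarith [le_abs_self (Real.log K)]
  · linarith [neg_abs_le (Real.log K)]

lemma EE_lower {K s sg : ℝ} (hK : 0 < K) (hs : 0 < s) (hsg : 0 < sg) (B : ℝ) :
    ∃ C, 0 < C ∧ ∀ c y, |c| ≤ B → 0 ≤ y →
      C * (Real.exp (-(ell K y - c) ^ 2 / (2 * s ^ 2)) / (1 + y)) ≤ EE K s sg c y := by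
  set D := 2 * (|Real.log K| / 2 + 1 / 2 + B) + 1 with hD
  refine ⟨ph sg 8 * Real.exp (-D / (2 * s ^ 2)), mul_pos (ph_pos hsg _) (Real.exp_pos _), ?_⟩
  intro c y hc hy
  have hB : 0 ≤ B := (abs_nonneg c).trans hc
  set l := ell K y with hl
  have h1y : 0 < 1 + y := by linarith
  have hδ1 : 1 / (1 + y) ≤ 1 := by rw [div_le_one h1y]; linarith
  have hpt : ∀ w ∈ Set.Icc l (l + 1 / (1 + y)),
      ph sg 8 * Real.exp (-D / (2 * s ^ 2)) * Real.exp (-(l - c) ^ 2 / (2 * s ^ 2)) ≤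
        kg K s sg c y w := by
    intro w hw
    set δ := w - l with hδ
    have hδ0 : 0 ≤ δ := by linarith [hw.1]
    have hδu : δ ≤ 1 / (1 + y) := by linarith [hw.2]
    have hδy : δ * (1 + y) ≤ 1 := by rwa [le_div_iff₀ h1y] at hδu
    have hh : K * Real.exp (2 * w) = (1 + y) * Real.exp (2 * δ) := by
      rw [← exp_ell hK hy, mul_assoc, ← Real.exp_add]; congr 2; rw [hδ]; ring
    have he : Real.exp (2 * δ) - 1 ≤ 7 * δ := by
      have hc : Real.exp ((1 - δ) • 0 + δ • 2) ≤ (1 - δ) • Real.exp 0 + δ • Real.exp 2 :=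
        convexOn_exp.2 (Set.mem_univ 0) (Set.mem_univ 2) (by linarith) hδ0 (by ring)
      simp only [smul_eq_mul, mul_zero, zero_add, Real.exp_zero, mul_one] at hc
      have h8 : Real.exp 2 ≤ 8 := by
        have : Real.exp 2 = Real.exp 1 * Real.exp 1 := by rw [← Real.exp_add]; norm_num
        rw [this]
        have := Real.exp_one_lt_d9
        nlinarith [Real.exp_pos 1]
      rw [mul_comm δ 2] at hc
      nlinarith
    have he0 : 1 ≤ Real.exp (2 * δ) := Real.one_le_exp (by linarith)
    unfold kg
    rw [mul_assoc, ← Real.exp_add]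
    apply mul_le_mul _ _ (Real.exp_pos _).le (ph_nonneg _ _)
    · apply ph_anti
      rw [hh, abs_le]
      have h88 : |(8:ℝ)| = 8 := by norm_num
      rw [h88]
      constructor <;> nlinarith
    · apply Real.exp_le_exp.2
      rw [← add_div]
      apply div_le_div_of_nonneg_right _ (by positivity)
      have hw' : w - c = (l - c) + δ := by rw [hδ]; ring
      rw [hw']
      obtain ⟨hb1, hb2⟩ := ell_bounds hK hy
      have hlog := log_one_add_le hy
      have hδl : δ * l ≤ |Real.log K| / 2 + 1 / 2 := by
        have : δ * l ≤ δ * (|Real.log K| / 2 + y / 2) :=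
          mul_le_mul_of_nonneg_left (by linarith) hδ0
        nlinarith [abs_nonneg (Real.log K)]
      have hδc : -(δ * c) ≤ B := by
        have := neg_abs_le c
        nlinarith
      have : δ ^ 2 ≤ 1 := by nlinarith
      nlinarith
  have hset : ∫ w in Set.Icc l (l + 1 / (1 + y)),
      ph sg 8 * Real.exp (-D / (2 * s ^ 2)) * Real.exp (-(l - c) ^ 2 / (2 * s ^ 2)) ≤
      ∫ w in Set.Icc l (l + 1 / (1 + y)), kg K s sg c y w := by
    apply setIntegral_mono_on _ (kg_int K hs sg c y).integrableOn measurableSet_Icc hpt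
    exact integrableOn_const (by simp)
  have hle : ∫ w in Set.Icc l (l + 1 / (1 + y)), kg K s sg c y w ≤ EE K s sg c y :=
    setIntegral_le_integral (kg_int K hs sg c y)
      (by filter_upwards with w using kg_nonneg _ _ _ _ _ _)
  refine le_trans (le_of_eq ?_) (hset.trans hle)
  rw [setIntegral_const]
  have hvol : volume.real (Set.Icc l (l + 1 / (1 + y))) = 1 / (1 + y) := by
    rw [Measure.real, Real.volume_Icc, ENNReal.toReal_ofReal] <;> simp [h1y.le]
  rw [hvol, smul_eq_mul]
  field_simp

set_option maxHeartbeats 800000 in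
lemma exponent_bound {K s sg : ℝ} (hK : 0 < K) (hs : 0 < s) (hsg : 0 < sg) (c : ℝ) :
    ∃ C : ℝ, ∀ y δ : ℝ, 0 ≤ y →
      -(δ ^ 2) / (2 * s ^ 2) - δ * (ell K y - c) / s ^ 2 - 2 * δ ≤
        C + (y - (1 + y) * Real.exp (2 * δ)) ^ 2 / (4 * sg ^ 2) := by
  set B0 := |Real.log K| / 2 + |c| with hB0
  have hB0n : 0 ≤ B0 := by positivity
  set B1 := B0 + 2 * s ^ 2 with hB1
  have hB1n : 0 ≤ B1 := by positivity
  have hs2 : 0 < s ^ 2 := by positivity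
  have hsg2 : 0 < sg ^ 2 := by positivity
  have sub : ∀ B v Z : ℝ, 0 ≤ B → v - 1 ≤ Z → B * v ≤ B + B ^ 2 * sg ^ 2 + Z ^ 2 / (4 * sg ^ 2) := by
    intro B v Z hB hZ
    have h1 : B * (v - 1) ≤ B * Z := mul_le_mul_of_nonneg_left hZ hB
    have h2 : B * Z ≤ B ^ 2 * sg ^ 2 + Z ^ 2 / (4 * sg ^ 2) := by
      have : B ^ 2 * sg ^ 2 + Z ^ 2 / (4 * sg ^ 2) - B * Z = (B * sg - Z / (2 * sg)) ^ 2 := by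
        field_simp; ring
      nlinarith [sq_nonneg (B * sg - Z / (2 * sg))]
    linarith
  set Ca := (B1 + 1) / s ^ 2 with hCa
  set Cb := 2 / s ^ 2 with hCb
  have hCan : 0 ≤ Ca := by positivity
  have hCbn : 0 ≤ Cb := by positivity
  refine ⟨B0 ^ 2 / (2 * s ^ 2) + (Ca + Ca ^ 2 * sg ^ 2) + (B1 ^ 2 / s ^ 2 + Cb + Cb ^ 2 * sg ^ 2), ?_⟩
  intro y δ hy
  obtain ⟨hb1, hb2⟩ := ell_bounds hK hy
  set l := ell K y with hl
  have hcl := neg_abs_le c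
  have hcu := le_abs_self c
  have hl0 : 0 ≤ Real.log (1 + y) := Real.log_nonneg (by linarith)
  have hlogy := log_one_add_le hy
  have t1 : 0 ≤ B0 ^ 2 / (2 * s ^ 2) := by positivity
  have t2 : 0 ≤ Ca + Ca ^ 2 * sg ^ 2 := by positivity
  have t3 : 0 ≤ B1 ^ 2 / s ^ 2 + Cb + Cb ^ 2 * sg ^ 2 := by positivity
  have t4 : 0 ≤ (y - (1 + y) * Real.exp (2 * δ)) ^ 2 / (4 * sg ^ 2) := by positivity
  have hform : -(δ ^ 2) / (2 * s ^ 2) - δ * (l - c) / s ^ 2 - 2 * δ =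
      (-(δ ^ 2) - 2 * δ * (l - c + 2 * s ^ 2)) / (2 * s ^ 2) := by field_simp; ring
  rcases le_total 0 δ with hδ | hδ
  · have : -(δ ^ 2) / (2 * s ^ 2) - δ * (l - c) / s ^ 2 - 2 * δ ≤ B0 ^ 2 / (2 * s ^ 2) := by
      rw [hform]
      apply div_le_div_of_nonneg_right _ (by positivity)
      have : -B0 ≤ l - c := by rw [hB0]; linarith
      nlinarith [sq_nonneg (δ - B0), mul_le_mul_of_nonneg_left this hδ,
        mul_nonneg hδ hs2.le]
    linarith
  · set d := -δ with hd
    have hd0 : 0 ≤ d := by linarith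
    have hδd : δ = -d := by rw [hd]; ring
    set lam := l - c + 2 * s ^ 2 with hlam
    have hlamu : lam ≤ B1 + Real.log (1 + y) / 2 := by rw [hlam, hB1, hB0]; linarith
    have hlaml : -(B1 + Real.log (1 + y) / 2) ≤ lam := by rw [hlam, hB1, hB0]; linarith
    rcases le_total d (1 / 2) with hd2 | hd2
    · have hZ : (1 + y) * d - 1 ≤ y - (1 + y) * Real.exp (2 * δ) := by
        have he : Real.exp (2 * δ) ≤ 1 - d := by
          have h1 : 1 + 2 * d ≤ Real.exp (2 * d) := by
            have := Real.add_one_le_exp (2 * d); linarith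
          have h2 : Real.exp (2 * δ) * Real.exp (2 * d) = 1 := by
            rw [← Real.exp_add, hδd]; simp
          have h3 : 0 < Real.exp (2 * δ) := Real.exp_pos _
          have h4 : Real.exp (2 * δ) * (1 + 2 * d) ≤ 1 :=
            (mul_le_mul_of_nonneg_left h1 h3.le).trans h2.le
          by_contra hcon
          push Not at hcon
          have : (1 - d) * (1 + 2 * d) < Real.exp (2 * δ) * (1 + 2 * d) :=
            mul_lt_mul_of_pos_right hcon (by linarith)
          have h10 : 0 ≤ d * (1 - 2 * d) := mul_nonneg hd0 (by linarith)
          linarith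
        have := mul_le_mul_of_nonneg_left he (by linarith : 0 ≤ 1 + y)
        linarith
      have h5 := sub Ca ((1 + y) * d) _ hCan hZ
      have h6 : -(δ ^ 2) / (2 * s ^ 2) - δ * (l - c) / s ^ 2 - 2 * δ ≤ Ca * ((1 + y) * d) := by
        rw [hform, hCa, div_mul_eq_mul_div, div_le_div_iff₀ (by positivity) hs2, hδd]
        have h7 : d * lam ≤ (B1 + 1) * ((1 + y) * d) := by
          have : d * lam ≤ d * (B1 + y) := mul_le_mul_of_nonneg_left (by linarith) hd0
          have h8 : 0 ≤ d * (B1 * y) := by positivity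
          linarith
        have h9 : -((-d) ^ 2) - 2 * -d * lam ≤ 2 * ((B1 + 1) * ((1 + y) * d)) := by
          linarith [sq_nonneg d]
        linarith [mul_le_mul_of_nonneg_right h9 hs2.le]
      linarith
    · have hZ : (1 + y) / 2 - 1 ≤ y - (1 + y) * Real.exp (2 * δ) := by
        have he : Real.exp (2 * δ) ≤ 1 / 2 := by
          have h1 : Real.exp (2 * δ) ≤ Real.exp (-1) := Real.exp_le_exp.2 (by linarith)
          have h2 : Real.exp (-1) < 0.3678794412 := Real.exp_neg_one_lt_d9
          linarith
        have := mul_le_mul_of_nonneg_left he (by linarith : 0 ≤ 1 + y)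
        linarith
      have h5 := sub Cb ((1 + y) / 2) _ hCbn hZ
      have h6 : -(δ ^ 2) / (2 * s ^ 2) - δ * (l - c) / s ^ 2 - 2 * δ ≤
          B1 ^ 2 / s ^ 2 + Cb * ((1 + y) / 2) := by
        have h7 : B1 ^ 2 / s ^ 2 + Cb * ((1 + y) / 2) = (2 * B1 ^ 2 + 2 * (1 + y)) / (2 * s ^ 2) := by
          rw [hCb]; field_simp
        rw [hform, h7]
        apply div_le_div_of_nonneg_right _ (by positivity)
        have h8 := log_sq_le hy
        have h9 : lam ^ 2 ≤ (B1 + Real.log (1 + y) / 2) ^ 2 := sq_le_sq' hlaml hlamu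
        linarith [sq_nonneg (δ + lam), sq_nonneg (B1 - Real.log (1 + y) / 2)]
      linarith

lemma int_subst {K sg : ℝ} (hK : 0 < K) (hsg : 0 < sg) : ∃ C : ℝ, 0 < C ∧ ∀ y : ℝ,
    Integrable (fun w => Real.exp (-(y - K * Real.exp (2 * w)) ^ 2 / (4 * sg ^ 2)) *
      (K * Real.exp (2 * w))) ∧
    ∫ w, Real.exp (-(y - K * Real.exp (2 * w)) ^ 2 / (4 * sg ^ 2)) * (K * Real.exp (2 * w)) ≤ C := by
  set G : ℝ → ℝ := fun h => Real.exp (-(1 / (4 * sg ^ 2)) * h ^ 2) with hG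
  have hGi : Integrable G := integrable_exp_neg_mul_sq (by positivity)
  have hGp : ∀ h, 0 < G h := fun h => Real.exp_pos _
  have hG0 : 0 ≤ ∫ h, G h := integral_nonneg fun h => (hGp h).le
  refine ⟨(∫ h, G h) + 1, by linarith, fun y => ?_⟩
  have hderiv : ∀ w ∈ Set.univ, HasDerivWithinAt (fun w : ℝ => K * Real.exp (2 * w))
      (2 * (K * Real.exp (2 * w))) Set.univ w := by
    intro w _
    apply HasDerivAt.hasDerivWithinAt
    have h1 : HasDerivAt (fun w : ℝ => 2 * w) 2 w := by
      simpa using (hasDerivAt_id w).const_mul 2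
    have h2 := (h1.exp).const_mul K
    have h3 : K * (Real.exp (2 * w) * 2) = 2 * (K * Real.exp (2 * w)) := by ring
    rw [h3] at h2
    exact h2
  have hinj : Set.InjOn (fun w : ℝ => K * Real.exp (2 * w)) Set.univ := by
    intro a _ b _ hab
    simp only at hab
    have := mul_left_cancel₀ hK.ne' hab
    have := Real.exp_injective this
    linarith
  have hGy : Integrable (fun h => G (y - h)) := hGi.comp_sub_left y
  have i1 := (integrableOn_image_iff_integrableOn_abs_deriv_smul MeasurableSet.univ hderiv hinj
    (fun h => G (y - h))).1 hGy.integrableOn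
  have e1 := integral_image_eq_integral_abs_deriv_smul MeasurableSet.univ hderiv hinj
    (fun h => G (y - h))
  rw [integrableOn_univ] at i1
  rw [setIntegral_univ] at e1
  have hcong : (fun w => |2 * (K * Real.exp (2 * w))| • G (y - K * Real.exp (2 * w))) =
      fun w => 2 * (Real.exp (-(y - K * Real.exp (2 * w)) ^ 2 / (4 * sg ^ 2)) *
        (K * Real.exp (2 * w))) := by
    ext w
    rw [abs_of_pos (by positivity), smul_eq_mul]
    have : G (y - K * Real.exp (2 * w)) =
      Real.exp (-(y - K * Real.exp (2 * w)) ^ 2 / (4 * sg ^ 2)) := by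
      simp only [hG]; congr 1; ring
    rw [this]; ring
  rw [hcong] at i1 e1
  have i2 : Integrable (fun w => Real.exp (-(y - K * Real.exp (2 * w)) ^ 2 / (4 * sg ^ 2)) *
      (K * Real.exp (2 * w))) := by
    have := i1.const_mul (1 / 2)
    convert this using 2 with w
    ring
  refine ⟨i2, ?_⟩
  rw [integral_const_mul] at e1
  have hle : ∫ h in (fun w : ℝ => K * Real.exp (2 * w)) '' Set.univ, G (y - h) ≤ ∫ h, G (y - h) :=
    setIntegral_le_integral hGy (by filter_upwards with h using (hGp _).le)
  have heq : ∫ h, G (y - h) = ∫ h, G h := integral_sub_left_eq_self G volume y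
  linarith

lemma EE_upper {K s sg : ℝ} (hK : 0 < K) (hs : 0 < s) (hsg : 0 < sg) (c : ℝ) :
    ∃ C, 0 < C ∧ ∀ y, 0 ≤ y →
      EE K s sg c y ≤ C * (Real.exp (-(ell K y - c) ^ 2 / (2 * s ^ 2)) / (1 + y)) := by
  obtain ⟨C, hC⟩ := exponent_bound hK hs hsg c
  obtain ⟨C', hC'0, hC'⟩ := int_subst hK hsg
  refine ⟨ph sg 0 * Real.exp C * C', mul_pos (mul_pos (ph_pos hsg _) (Real.exp_pos _)) hC'0, ?_⟩
  intro y hy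
  set l := ell K y with hl
  have h1y : 0 < 1 + y := by linarith
  have hpt : ∀ w, kg K s sg c y w ≤ ph sg 0 * Real.exp C *
      (Real.exp (-(l - c) ^ 2 / (2 * s ^ 2)) / (1 + y)) *
      (Real.exp (-(y - K * Real.exp (2 * w)) ^ 2 / (4 * sg ^ 2)) * (K * Real.exp (2 * w))) := by
    intro w
    set δ := w - l with hδ
    have hh : K * Real.exp (2 * w) = (1 + y) * Real.exp (2 * δ) := by
      rw [← exp_ell hK hy, mul_assoc, ← Real.exp_add]; congr 2; rw [hδ]; ring
    have hE := hC y δ hy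
    have hw : w = l + δ := by rw [hδ]; ring
    have hph : ph sg (y - K * Real.exp (2 * w)) =
        ph sg 0 * Real.exp (-(y - K * Real.exp (2 * w)) ^ 2 / (2 * sg ^ 2)) := by
      simp [ph]
    unfold kg
    rw [hph]
    have hr : ph sg 0 * Real.exp C *
      (Real.exp (-(l - c) ^ 2 / (2 * s ^ 2)) / (1 + y)) *
      (Real.exp (-(y - K * Real.exp (2 * w)) ^ 2 / (4 * sg ^ 2)) * (K * Real.exp (2 * w))) =
      ph sg 0 * Real.exp (C + -(l - c) ^ 2 / (2 * s ^ 2) +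
        -(y - K * Real.exp (2 * w)) ^ 2 / (4 * sg ^ 2) + 2 * δ) := by
      rw [Real.exp_add, Real.exp_add, Real.exp_add]
      rw [hh]
      field_simp
    rw [hr, mul_assoc, ← Real.exp_add]
    apply mul_le_mul_of_nonneg_left _ (ph_nonneg _ _)
    apply Real.exp_le_exp.2
    rw [hh]
    have e1 : -(w - c) ^ 2 / (2 * s ^ 2) = -(l - c) ^ 2 / (2 * s ^ 2) +
        (-(δ ^ 2) / (2 * s ^ 2) - δ * (l - c) / s ^ 2) := by
      rw [hw]; field_simp; ring
    have e2 : -(y - (1 + y) * Real.exp (2 * δ)) ^ 2 / (2 * sg ^ 2) =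
      -(y - (1 + y) * Real.exp (2 * δ)) ^ 2 / (4 * sg ^ 2) -
       (y - (1 + y) * Real.exp (2 * δ)) ^ 2 / (4 * sg ^ 2) := by
      field_simp; ring
    rw [e1, e2]
    linarith
  calc EE K s sg c y ≤ ∫ w, ph sg 0 * Real.exp C *
      (Real.exp (-(l - c) ^ 2 / (2 * s ^ 2)) / (1 + y)) *
      (Real.exp (-(y - K * Real.exp (2 * w)) ^ 2 / (4 * sg ^ 2)) * (K * Real.exp (2 * w))) :=
        integral_mono (kg_int K hs sg c y) ((hC' y).1.const_mul _) hpt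
    _ ≤ ph sg 0 * Real.exp C * (Real.exp (-(l - c) ^ 2 / (2 * s ^ 2)) / (1 + y)) * C' := by
        rw [integral_const_mul]
        apply mul_le_mul_of_nonneg_left (hC' y).2
        have := ph_nonneg sg 0
        positivity
    _ = _ := by ring

lemma ratio_bound {K s sg : ℝ} (hK : 0 < K) (hs : 0 < s) (hsg : 0 < sg) (c η : ℝ) (hη : 0 ≤ η) :
    ∃ M, 0 < M ∧ ∀ y, EE K s sg (c + η) y * EE K s sg (c - η) y ≤ M * EE K s sg c y ^ 2 := by
  obtain ⟨Cp, hCp, hp⟩ := EE_upper hK hs hsg (c + η)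
  obtain ⟨Cm, hCm, hm⟩ := EE_upper hK hs hsg (c - η)
  obtain ⟨Cl, hCl, hl⟩ := EE_lower hK hs hsg |c|
  have hEn : ∀ c y, 0 ≤ EE K s sg c y := fun c y => integral_nonneg fun w => kg_nonneg _ _ _ _ _ _
  refine ⟨1 + Cp * Cm / Cl ^ 2, by positivity, fun y => ?_⟩
  rcases le_total y 0 with hy | hy
  · have h1 := ratio_neg hK hs hsg c η y hη hy
    have h2 : 0 ≤ Cp * Cm / Cl ^ 2 * EE K s sg c y ^ 2 := by positivity
    linarith
  · have h1y : 0 < 1 + y := by linarith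
    set l := ell K y with hll
    set g := Real.exp (-(l - c) ^ 2 / (2 * s ^ 2)) / (1 + y) with hg
    have hgp : 0 < g := by positivity
    have a1 := hp y hy
    have a2 := hm y hy
    have a3 := hl c y le_rfl hy
    have hgg : (Real.exp (-(l - (c + η)) ^ 2 / (2 * s ^ 2)) / (1 + y)) *
        (Real.exp (-(l - (c - η)) ^ 2 / (2 * s ^ 2)) / (1 + y)) ≤ g ^ 2 := by
      rw [hg, div_mul_div_comm, ← Real.exp_add, div_pow, ← sq, sq (Real.exp _), ← Real.exp_add]
      apply div_le_div_of_nonneg_right _ (by positivity)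
      apply Real.exp_le_exp.2
      rw [← add_div, ← add_div]
      apply div_le_div_of_nonneg_right _ (by positivity)
      nlinarith [sq_nonneg η]
    have hb : EE K s sg (c + η) y * EE K s sg (c - η) y ≤ Cp * Cm * g ^ 2 := by
      calc _ ≤ _ := mul_le_mul a1 a2 (hEn _ _) ((hEn _ _).trans a1)
        _ = Cp * Cm * ((Real.exp (-(l - (c + η)) ^ 2 / (2 * s ^ 2)) / (1 + y)) *
          (Real.exp (-(l - (c - η)) ^ 2 / (2 * s ^ 2)) / (1 + y))) := by ring
        _ ≤ _ := mul_le_mul_of_nonneg_left hgg (by positivity)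
    have hc2 : Cl ^ 2 * g ^ 2 ≤ EE K s sg c y ^ 2 := by
      rw [← mul_pow]; exact pow_le_pow_left₀ (by positivity) a3 2
    have : Cp * Cm * g ^ 2 ≤ Cp * Cm / Cl ^ 2 * EE K s sg c y ^ 2 := by
      rw [div_mul_eq_mul_div, le_div_iff₀ (by positivity)]
      nlinarith [mul_le_mul_of_nonneg_left hc2 (by positivity : 0 ≤ Cp * Cm)]
    nlinarith [sq_nonneg (EE K s sg c y)]


/-! ### Part D3 : analyticity of the information density -/

open Filter Topology in
lemma holo_integral {α : Type*} [MeasurableSpace α] {μ : Measure α} {U : Set ℂ} (hU : IsOpen U)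
    {f : ℂ → α → ℂ} {g : α → ℝ} (hg : Integrable g μ)
    (hm : ∀ z ∈ U, AEStronglyMeasurable (f z) μ)
    (hd : ∀ a, DifferentiableOn ℂ (fun z => f z a) U)
    (hb : ∀ z ∈ U, ∀ a, ‖f z a‖ ≤ g a) :
    DifferentiableOn ℂ (fun z => ∫ a, f z a ∂μ) U := by
  intro z hz
  obtain ⟨R, hR, hRU⟩ := Metric.isOpen_iff.1 hU z hz
  set r := R / 3 with hr
  have hrp : 0 < r := by positivity
  have hsub : ∀ w ∈ Metric.ball z r, Metric.closedBall w r ⊆ U := by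
    intro w hw v hv
    apply hRU
    rw [Metric.mem_ball] at hw ⊢
    rw [Metric.mem_closedBall] at hv
    have := dist_triangle v w z
    linarith
  have hzU : ∀ w ∈ Metric.ball z r, w ∈ U := fun w hw =>
    hsub w hw (Metric.mem_closedBall_self hrp.le)
  have hdat : ∀ a, ∀ w ∈ U, HasDerivAt (fun z => f z a) (deriv (fun z => f z a) w) w :=
    fun a w hw => ((hd a).differentiableAt (hU.mem_nhds hw)).hasDerivAt
  have hmeas' : AEStronglyMeasurable (fun a => deriv (fun z => f z a) z) μ := by
    -- limit of difference quotients
    let h : ℕ → ℂ := fun n => ((r / (n + 2) : ℝ) : ℂ)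
    have hh0 : ∀ n, h n ≠ 0 := by
      intro n; simp only [h]
      have : (0:ℝ) < r / (n + 2) := by positivity
      exact_mod_cast this.ne'
    have hhU : ∀ n, z + h n ∈ U := by
      intro n
      apply hzU
      rw [Metric.mem_ball, dist_self_add_left]
      simp only [h]
      have : (0:ℝ) < r / (n + 2) := by positivity
      rw [Complex.norm_real, Real.norm_of_nonneg this.le, div_lt_iff₀ (by positivity)]
      have : (0:ℝ) ≤ n := Nat.cast_nonneg n
      nlinarith
    have hht : Tendsto h atTop (𝓝[≠] 0) := by
      rw [tendsto_nhdsWithin_iff]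
      refine ⟨?_, Eventually.of_forall fun n => hh0 n⟩
      have h1 : Tendsto (fun n : ℕ => (r / ((n:ℝ) + 2))) atTop (𝓝 0) := by
        apply Tendsto.div_atTop tendsto_const_nhds
        exact tendsto_atTop_add_const_right _ _ tendsto_natCast_atTop_atTop
      have h2 := (Complex.continuous_ofReal.tendsto (0:ℝ)).comp h1
      simpa [h, Function.comp_def] using h2
    apply aestronglyMeasurable_of_tendsto_ae atTop
      (f := fun n a => (h n)⁻¹ • (f (z + h n) a - f z a))
    · intro n
      exact ((hm _ (hhU n)).sub (hm z hz)).const_smul ((h n)⁻¹)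
    · filter_upwards with a
      have := (hdat a z hz).tendsto_slope_zero
      exact this.comp hht
  have := hasDerivAt_integral_of_dominated_loc_of_deriv_le (μ := μ) (F := f) (x₀ := z)
    (s := Metric.ball z r) (bound := fun a => g a / r)
    (F' := fun w a => deriv (fun z => f z a) w)
    (Metric.ball_mem_nhds z hrp)
    (by filter_upwards [Metric.ball_mem_nhds z hrp] with w hw using hm w (hzU w hw))
    (Integrable.mono' hg (hm z hz) (by filter_upwards with a using hb z hz a))
    hmeas'
    (by
      filter_upwards with a
      intro w hw
      apply Complex.norm_deriv_le_of_forall_mem_sphere_norm_le hrp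
      · apply DifferentiableOn.diffContOnCl
        rw [closure_ball _ hrp.ne']
        exact (hd a).mono (hsub w hw)
      · intro v hv
        exact hb v (hsub w hw (Metric.sphere_subset_closedBall hv)) a)
    (hg.div_const r)
    (by
      filter_upwards with a
      intro w hw
      exact hdat a w (hzU w hw))
  exact this.2.differentiableAt.differentiableWithinAt

lemma EE_eq_pd {K s sg : ℝ} (hs : 0 < s) (c y : ℝ) :
    EE K s sg c y = pd K c s sg 1 y / kap s := by
  have := pd_eq_EE (K := K) (m := c) (sg := sg) hs 0 y
  simp only [mul_zero, Real.exp_zero, add_zero] at this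
  rw [this]
  have := (kap_pos hs).ne'
  field_simp

lemma EE_pos {K s sg : ℝ} (hK : 0 < K) (hs : 0 < s) (hsg : 0 < sg) (c y : ℝ) :
    0 < EE K s sg c y := by
  rw [EE_eq_pd hs]; exact div_pos (pd_pos hK hs hsg _ _) (kap_pos hs)

lemma EE_cont {K s sg : ℝ} (hs : 0 < s) (c : ℝ) : Continuous (EE K s sg c) := by
  have : EE K s sg c = fun y => pd K c s sg 1 y / kap s := funext (EE_eq_pd hs c)
  rw [this]; exact (pd_cont_y _ _ _ _ _).div_const _

lemma EE_log {K s sg : ℝ} (hK : 0 < K) (hs : 0 < s) (hsg : 0 < sg) (c : ℝ) :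
    ∃ C, 0 < C ∧ ∀ y, |Real.log (EE K s sg c y)| ≤ C * (1 + y ^ 2) := by
  obtain ⟨C, hC, h⟩ := log_pd_bound (m := c) hK hs hsg 1 (by norm_num)
  refine ⟨C + |Real.log (kap s)|, by positivity, fun y => ?_⟩
  rw [EE_eq_pd hs, Real.log_div (pd_pos hK hs hsg _ _).ne' (kap_pos hs).ne']
  have h1 := h 1 y (by norm_num)
  have h2 := abs_sub (Real.log (pd K c s sg 1 y)) (Real.log (kap s))
  nlinarith [abs_nonneg (Real.log (kap s)), sq_nonneg y,
    mul_nonneg (abs_nonneg (Real.log (kap s))) (sq_nonneg y)]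

lemma kg_shift {K s sg : ℝ} (hs : 0 < s) (c y u w : ℝ) :
    kg K s sg c y w * Real.exp (u * ((w - c) / s ^ 2)) =
      Real.exp (u ^ 2 / (2 * s ^ 2)) * kg K s sg (c + u) y w := by
  unfold kg
  have : Real.exp (-(w - c) ^ 2 / (2 * s ^ 2)) * Real.exp (u * ((w - c) / s ^ 2)) =
      Real.exp (u ^ 2 / (2 * s ^ 2)) * Real.exp (-(w - (c + u)) ^ 2 / (2 * s ^ 2)) := by
    rw [← Real.exp_add, ← Real.exp_add]; congr 1; field_simp; ring
  rw [mul_assoc, this]; ring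

/-- existence of the posterior centre -/
lemma exists_center {K s sg : ℝ} (hK : 0 < K) (hs : 0 < s) (hsg : 0 < sg) (c : ℝ) :
    ∃ (a : ℝ → ℝ) (M C : ℝ), Measurable a ∧ 0 < M ∧ 0 < C ∧ (∀ y, |a y| ≤ C * (1 + y ^ 2)) ∧
      ∀ y, Integrable (fun w => kg K s sg c y w * Real.exp |(w - c) / s ^ 2 - a y|) ∧
        ∫ w, kg K s sg c y w * Real.exp |(w - c) / s ^ 2 - a y| ≤ M * EE K s sg c y := by
  obtain ⟨M, hM, hMb⟩ := ratio_bound hK hs hsg c 1 (by norm_num)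
  obtain ⟨C1, hC1, h1⟩ := EE_log hK hs hsg (c + 1)
  obtain ⟨C0, hC0, h0⟩ := EE_log hK hs hsg c
  set e := Real.exp (1 / (2 * s ^ 2)) with he
  have hep : 0 < e := Real.exp_pos _
  set a : ℝ → ℝ := fun y => Real.log (EE K s sg (c + 1) y) - Real.log (EE K s sg c y) with ha
  refine ⟨a, (1 + M) * e, C1 + C0, ?_, by positivity, by positivity, ?_, ?_⟩
  · exact (Real.measurable_log.comp (EE_cont hs _).measurable).sub
      (Real.measurable_log.comp (EE_cont hs _).measurable)
  · intro y
    have := abs_sub (Real.log (EE K s sg (c + 1) y)) (Real.log (EE K s sg c y))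
    have := h1 y; have := h0 y
    simp only [ha]; linarith
  · intro y
    have p1 := EE_pos hK hs hsg (c + 1) y
    have p0 := EE_pos hK hs hsg c y
    have hea : Real.exp (a y) = EE K s sg (c + 1) y / EE K s sg c y := by
      simp only [ha]; rw [Real.exp_sub, Real.exp_log p1, Real.exp_log p0]
    have hplus : ∀ w, kg K s sg c y w * Real.exp ((w - c) / s ^ 2 - a y) =
        (e * (EE K s sg c y / EE K s sg (c + 1) y)) * kg K s sg (c + 1) y w := by
      intro w
      have := kg_shift (K := K) (sg := sg) hs c y 1 w
      rw [one_mul, one_pow] at this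
      rw [Real.exp_sub, hea, ← mul_div_assoc, this]
      field_simp
      rw [he, mul_comm]
    have hminus : ∀ w, kg K s sg c y w * Real.exp (-((w - c) / s ^ 2 - a y)) =
        (e * (EE K s sg (c + 1) y / EE K s sg c y)) * kg K s sg (c - 1) y w := by
      intro w
      have := kg_shift (K := K) (sg := sg) hs c y (-1) w
      have h2 : (-1:ℝ) ^ 2 = 1 := by norm_num
      rw [h2, ← sub_eq_add_neg] at this
      have h3 : Real.exp (-((w - c) / s ^ 2 - a y)) =
          Real.exp (-1 * ((w - c) / s ^ 2)) * Real.exp (a y) := by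
        rw [← Real.exp_add]; congr 1; ring
      rw [h3, ← mul_assoc, this, hea, ← he]
      ring
    have ip : Integrable (fun w => kg K s sg c y w * Real.exp ((w - c) / s ^ 2 - a y)) := by
      simp_rw [hplus]; exact (kg_int K hs sg _ _).const_mul _
    have im : Integrable (fun w => kg K s sg c y w * Real.exp (-((w - c) / s ^ 2 - a y))) := by
      simp_rw [hminus]; exact (kg_int K hs sg _ _).const_mul _
    have hptw : ∀ w, kg K s sg c y w * Real.exp |(w - c) / s ^ 2 - a y| ≤
        kg K s sg c y w * Real.exp ((w - c) / s ^ 2 - a y) +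
        kg K s sg c y w * Real.exp (-((w - c) / s ^ 2 - a y)) := by
      intro w
      rw [← mul_add]
      apply mul_le_mul_of_nonneg_left _ (kg_nonneg _ _ _ _ _ _)
      rcases abs_cases ((w - c) / s ^ 2 - a y) with h | h
      · rw [h.1]; linarith [Real.exp_pos (-((w - c) / s ^ 2 - a y))]
      · rw [h.1]; linarith [Real.exp_pos ((w - c) / s ^ 2 - a y)]
    have hIntg : Integrable (fun w => kg K s sg c y w * Real.exp |(w - c) / s ^ 2 - a y|) := by
      apply Integrable.mono' (ip.add im)
      · exact ((kg_cont _ _ _ _ _).mul (by fun_prop)).aestronglyMeasurable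
      · filter_upwards with w
        rw [Real.norm_of_nonneg (mul_nonneg (kg_nonneg _ _ _ _ _ _) (Real.exp_pos _).le)]
        exact hptw w
    refine ⟨hIntg, (integral_mono hIntg (ip.add im) hptw).trans ?_⟩
    rw [integral_add' ip im]
    simp_rw [hplus, hminus]
    rw [integral_const_mul, integral_const_mul]
    have q1 : ∫ w, kg K s sg (c + 1) y w = EE K s sg (c + 1) y := rfl
    have q2 : ∫ w, kg K s sg (c - 1) y w = EE K s sg (c - 1) y := rfl
    rw [q1, q2]
    have hb := hMb y
    have r1 : e * (EE K s sg c y / EE K s sg (c + 1) y) * EE K s sg (c + 1) y =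
        e * EE K s sg c y := by field_simp
    have r2 : e * (EE K s sg (c + 1) y / EE K s sg c y) * EE K s sg (c - 1) y ≤
        e * (M * EE K s sg c y) := by
      rw [mul_assoc]
      apply mul_le_mul_of_nonneg_left _ hep.le
      rw [div_mul_eq_mul_div, div_le_iff₀ p0]
      linarith
    rw [r1]
    linarith


/-! ### Part D4 : holomorphic extension -/

/-- normalised complex moment generating function of the posterior -/
def QQ (K s sg c : ℝ) (a : ℝ → ℝ) (z : ℂ) (y : ℝ) : ℂ :=
  (∫ w : ℝ, (kg K s sg c y w : ℂ) * Complex.exp (z * (((w - c) / s ^ 2 - a y : ℝ) : ℂ))) /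
    (EE K s sg c y : ℂ)

lemma QQ_meas {K s sg : ℝ} (hs : 0 < s) (c : ℝ) {a : ℝ → ℝ} (ha : Measurable a) (z : ℂ) :
    Measurable (QQ K s sg c a z) := by
  unfold QQ
  apply Measurable.div
  · apply StronglyMeasurable.measurable
    apply StronglyMeasurable.integral_prod_right'
      (f := fun p : ℝ × ℝ => (kg K s sg c p.1 p.2 : ℂ) *
        Complex.exp (z * (((p.2 - c) / s ^ 2 - a p.1 : ℝ) : ℂ)))
    apply Measurable.stronglyMeasurable
    apply Measurable.mul
    · apply Complex.measurable_ofReal.comp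
      apply Continuous.measurable
      unfold kg
      exact ((ph_cont sg).comp (by fun_prop)).mul (by fun_prop)
    · apply Complex.measurable_exp.comp
      apply Measurable.const_mul
      apply Complex.measurable_ofReal.comp
      exact (by fun_prop : Measurable (fun p : ℝ × ℝ => (p.2 - c) / s ^ 2)).sub
        (ha.comp measurable_fst)
  · exact Complex.measurable_ofReal.comp (EE_cont hs c).measurable

lemma cexp_norm_le (z : ℂ) (r : ℝ) (hz : ‖z‖ ≤ 1) : ‖Complex.exp (z * (r : ℂ))‖ ≤ Real.exp |r| := by
  apply (Complex.norm_exp_le_exp_norm _).trans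
  rw [norm_mul, Complex.norm_real, Real.norm_eq_abs]
  apply Real.exp_le_exp.2
  nlinarith [abs_nonneg r]

lemma cexp_sub_one_le (z : ℂ) (r : ℝ) (hz : ‖z‖ ≤ 1 / 2) :
    ‖Complex.exp (z * (r : ℂ)) - 1‖ ≤ 2 * ‖z‖ * Real.exp |r| := by
  have h := Complex.norm_exp_sub_sum_le_norm_mul_exp (z * (r:ℂ)) 1
  simp only [Finset.range_one, Finset.sum_singleton, pow_zero, Nat.factorial_zero, Nat.cast_one,
    div_one, pow_one] at h
  apply h.trans
  rw [norm_mul, Complex.norm_real, Real.norm_eq_abs]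
  have h1 : Real.exp (‖z‖ * |r|) ≤ Real.exp (|r| / 2) := by
    apply Real.exp_le_exp.2; nlinarith [abs_nonneg r]
  have h2 : |r| / 2 ≤ Real.exp (|r| / 2) := by linarith [Real.add_one_le_exp (|r| / 2)]
  have h3 : Real.exp |r| = Real.exp (|r| / 2) * Real.exp (|r| / 2) := by
    rw [← Real.exp_add]; congr 1; ring
  have h4 := Real.exp_pos (|r| / 2)
  rw [h3]
  calc ‖z‖ * |r| * Real.exp (‖z‖ * |r|) ≤ ‖z‖ * |r| * Real.exp (|r| / 2) := by
        gcongr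
    _ = 2 * ‖z‖ * (|r| / 2 * Real.exp (|r| / 2)) := by ring
    _ ≤ _ := by gcongr

lemma QQ_props {K s sg : ℝ} (hK : 0 < K) (hs : 0 < s) (hsg : 0 < sg) (c : ℝ) {a : ℝ → ℝ} {M : ℝ}
    (y : ℝ) (hi : Integrable (fun w => kg K s sg c y w * Real.exp |(w - c) / s ^ 2 - a y|))
    (hM : ∫ w, kg K s sg c y w * Real.exp |(w - c) / s ^ 2 - a y| ≤ M * EE K s sg c y) :
    DifferentiableOn ℂ (fun z => QQ K s sg c a z y) (Metric.ball 0 1) ∧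
    (∀ z : ℂ, ‖z‖ ≤ 1 / 2 → ‖QQ K s sg c a z y - 1‖ ≤ 2 * M * ‖z‖) ∧
    (∀ u : ℝ, QQ K s sg c a u y =
      ((EE K s sg (c + u) y * Real.exp (u ^ 2 / (2 * s ^ 2) - u * a y) / EE K s sg c y : ℝ) : ℂ)) := by
  have p0 := EE_pos hK hs hsg c y
  have hm : ∀ z : ℂ, AEStronglyMeasurable (fun w : ℝ => (kg K s sg c y w : ℂ) *
      Complex.exp (z * (((w - c) / s ^ 2 - a y : ℝ) : ℂ))) := by
    intro z
    apply Continuous.aestronglyMeasurable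
    exact (Complex.continuous_ofReal.comp (kg_cont _ _ _ _ _)).mul (by fun_prop)
  have hb : ∀ z : ℂ, ‖z‖ ≤ 1 → ∀ w : ℝ, ‖(kg K s sg c y w : ℂ) *
      Complex.exp (z * (((w - c) / s ^ 2 - a y : ℝ) : ℂ))‖ ≤
        kg K s sg c y w * Real.exp |(w - c) / s ^ 2 - a y| := by
    intro z hz w
    rw [norm_mul, Complex.norm_real, Real.norm_of_nonneg (kg_nonneg _ _ _ _ _ _)]
    exact mul_le_mul_of_nonneg_left (cexp_norm_le _ _ hz) (kg_nonneg _ _ _ _ _ _)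
  refine ⟨?_, ?_, ?_⟩
  · unfold QQ
    apply DifferentiableOn.div_const
    apply holo_integral Metric.isOpen_ball hi (fun z _ => hm z)
    · intro w
      fun_prop
    · intro z hz w
      exact hb z (by simpa using (mem_ball_zero_iff.1 hz).le) w
  · intro z hz
    have hz1 : ‖z‖ ≤ 1 := by linarith
    have hko : Integrable (fun w : ℝ => ((kg K s sg c y w : ℝ) : ℂ)) := (kg_int K hs sg c y).ofReal
    have e1 : QQ K s sg c a z y - 1 = (∫ w : ℝ, (kg K s sg c y w : ℂ) *
        (Complex.exp (z * (((w - c) / s ^ 2 - a y : ℝ) : ℂ)) - 1)) / (EE K s sg c y : ℂ) := by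
      simp_rw [mul_sub, mul_one]
      rw [integral_sub (Integrable.mono' hi (hm z) (by filter_upwards with w using hb z hz1 w))
        hko, _root_.sub_div]
      unfold QQ
      congr 1
      have : ∫ w, ((kg K s sg c y w : ℝ) : ℂ) = ((EE K s sg c y : ℝ) : ℂ) := integral_complex_ofReal
      rw [this, div_self]
      exact_mod_cast p0.ne'
    rw [e1, norm_div, Complex.norm_real, Real.norm_of_nonneg p0.le, div_le_iff₀ p0]
    calc _ ≤ ∫ w, 2 * ‖z‖ * (kg K s sg c y w * Real.exp |(w - c) / s ^ 2 - a y|) := by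
          apply norm_integral_le_of_norm_le (hi.const_mul _)
          filter_upwards with w
          rw [norm_mul, Complex.norm_real, Real.norm_of_nonneg (kg_nonneg _ _ _ _ _ _)]
          have := mul_le_mul_of_nonneg_left (cexp_sub_one_le z ((w - c) / s ^ 2 - a y) hz)
            (kg_nonneg K s sg c y w)
          linarith
      _ = 2 * ‖z‖ * ∫ w, kg K s sg c y w * Real.exp |(w - c) / s ^ 2 - a y| :=
          integral_const_mul _ _
      _ ≤ 2 * ‖z‖ * (M * EE K s sg c y) := by gcongr
      _ = _ := by ring
  · intro u
    unfold QQ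
    have h1 : ∀ w : ℝ, (kg K s sg c y w : ℂ) *
        Complex.exp ((u:ℂ) * (((w - c) / s ^ 2 - a y : ℝ) : ℂ)) =
        ((Real.exp (u ^ 2 / (2 * s ^ 2) - u * a y) * kg K s sg (c + u) y w : ℝ) : ℂ) := by
      intro w
      rw [← Complex.ofReal_mul, ← Complex.ofReal_exp, ← Complex.ofReal_mul]
      congr 1
      rw [mul_sub, Real.exp_sub, Real.exp_sub, ← mul_div_assoc, kg_shift hs]
      ring
    simp_rw [h1]
    rw [integral_complex_ofReal, integral_const_mul]
    have q1 : ∫ w, kg K s sg (c + u) y w = EE K s sg (c + u) y := rfl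
    rw [q1]
    push_cast
    ring

lemma EE_mom {K s sg : ℝ} (hs : 0 < s) (hsg : 0 < sg) (c : ℝ) :
    Integrable (fun y => EE K s sg c y * (1 + y ^ 2)) := by
  have h := (mom2_integrable (K := K) (m := c) (s := s) hsg 1).div_const (kap s)
  refine h.congr (Filter.Eventually.of_forall fun y => ?_)
  simp only [EE_eq_pd hs]; ring

open Filter Topology in
lemma ii_holo {K m s sg : ℝ} (hK : 0 < K) (hs : 0 < s) (hsg : 0 < sg) {A : ℝ} (hA : 0 < A)
    (F : Measure ℝ) [IsProbabilityMeasure F] (hF : F (Set.Icc 0 A)ᶜ = 0) (t : ℝ) :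
    ∃ δ : ℝ, 0 < δ ∧ ∃ Φ : ℂ → ℂ, DifferentiableOn ℂ Φ (Metric.ball 0 δ) ∧
      ∀ u : ℝ, |u| < δ → Φ u = ((ii K m s sg F (Real.exp (2 * (t + u))) : ℝ) : ℂ) := by
  set c := m + t with hc
  obtain ⟨a, M, C, ham, hM, hC, hab, hcen⟩ := exists_center (c := c) hK hs hsg
  obtain ⟨C1, hC1, hP⟩ := log_Pd_bound (m := m) hK hs hsg hA F hF
  obtain ⟨C2, hC2, hE⟩ := EE_log (c := c) hK hs hsg
  have hkap := kap_pos hs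
  set L : ℝ → ℝ := fun y => Real.log (kap s) + Real.log (EE K s sg c y) -
    Real.log (Pd K m s sg F y) with hL
  have hLm : Measurable L := (((Real.measurable_log.comp (EE_cont hs _).measurable)).const_add _).sub
      (Real.measurable_log.comp (Pd_cont K m s sg F).measurable)
  set C3 := |Real.log (kap s)| + C2 + C1 with hC3
  have hLb : ∀ y, |L y| ≤ C3 * (1 + y ^ 2) := by
    intro y
    have h1 := abs_sub (Real.log (kap s) + Real.log (EE K s sg c y)) (Real.log (Pd K m s sg F y))
    have h2 := abs_add_le (Real.log (kap s)) (Real.log (EE K s sg c y))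
    have h3 := hP y
    have h4 := hE y
    have h5 := mul_nonneg (abs_nonneg (Real.log (kap s))) (sq_nonneg y)
    simp only [hL, hC3]
    linarith
  set δ := min (1 / 2) (1 / (4 * M)) with hδ
  have hδ0 : 0 < δ := by simp only [hδ]; positivity
  have hδ1 : δ ≤ 1 / 2 := min_le_left _ _
  have hδ2 : 2 * M * δ ≤ 1 / 2 := by
    have : δ ≤ 1 / (4 * M) := min_le_right _ _
    calc 2 * M * δ ≤ 2 * M * (1 / (4 * M)) := by gcongr
      _ = 1 / 2 := by field_simp; norm_num
  have hQ1 : ∀ z : ℂ, ‖z‖ ≤ δ → ∀ y, ‖QQ K s sg c a z y - 1‖ ≤ 1 / 2 := by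
    intro z hz y
    have h := (QQ_props (a := a) hK hs hsg c y (hcen y).1 (hcen y).2).2.1 z (hz.trans hδ1)
    have : 2 * M * ‖z‖ ≤ 2 * M * δ := by gcongr
    linarith
  have hQr := fun y => (QQ_props (a := a) hK hs hsg c y (hcen y).1 (hcen y).2).2.2
  -- tilting bound
  set e := Real.exp (δ ^ 2 / (2 * s ^ 2)) with he
  have hep : 0 < e := Real.exp_pos _
  have tilt : ∀ u : ℝ, |u| = δ → ∀ y, EE K s sg c y * Real.exp (u * a y) ≤
      2 * e * EE K s sg (c + u) y := by
    intro u hu y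
    have p0 := EE_pos hK hs hsg c y
    have h1 := hQ1 (u : ℂ) (by rw [Complex.norm_real, Real.norm_eq_abs, hu]) y
    rw [hQr y u, ← Complex.ofReal_one, ← Complex.ofReal_sub, Complex.norm_real, Real.norm_eq_abs,
      abs_le] at h1
    have h2 := h1.1
    have h3 : 1 / 2 ≤ EE K s sg (c + u) y * Real.exp (u ^ 2 / (2 * s ^ 2) - u * a y) /
      EE K s sg c y := by linarith
    rw [le_div_iff₀ p0, Real.exp_sub, ← sq_abs, hu, ← mul_div_assoc, le_div_iff₀ (Real.exp_pos _)] at h3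
    linarith
  set f : ℂ → ℝ → ℂ := fun z y => ((kap s * EE K s sg c y : ℝ) : ℂ) *
    Complex.exp (-z ^ 2 / (2 * s ^ 2) + a y * z) * QQ K s sg c a z y *
    (-z ^ 2 / (2 * s ^ 2) + a y * z + Complex.log (QQ K s sg c a z y) + L y) with hf
  set C4 := δ ^ 2 / (2 * s ^ 2) + C + 1 + C3 with hC4
  have hC30 : 0 ≤ C3 := by positivity
  have hC40 : 0 ≤ C4 := by positivity
  set g : ℝ → ℝ := fun y => (kap s * (2 * e * e) * (3 / 2) * C4) *
    (EE K s sg (c + δ) y * (1 + y ^ 2) + EE K s sg (c + -δ) y * (1 + y ^ 2)) with hg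
  have hgi : Integrable g := ((EE_mom hs hsg _).add (EE_mom hs hsg _)).const_mul _
  have hQslit : ∀ z : ℂ, ‖z‖ ≤ δ → ∀ y, QQ K s sg c a z y ∈ Complex.slitPlane := by
    intro z hz y
    have := Complex.mem_slitPlane_of_norm_lt_one (z := QQ K s sg c a z y - 1) (by linarith [hQ1 z hz y])
    rwa [add_sub_cancel] at this
  have hq2 : ∀ z : ℂ, ‖z‖ ≤ δ → ‖-z ^ 2 / (2 * (s:ℂ) ^ 2)‖ ≤ δ ^ 2 / (2 * s ^ 2) := by
    intro z hz
    rw [norm_div, norm_neg, norm_pow, norm_mul, norm_pow, Complex.norm_real, Real.norm_of_nonneg hs.le,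
      Complex.norm_ofNat]
    gcongr
  have hbound : ∀ z ∈ Metric.ball (0:ℂ) δ, ∀ y, ‖f z y‖ ≤ g y := by
    intro z hz y
    have hz' : ‖z‖ ≤ δ := (mem_ball_zero_iff.1 hz).le
    have p0 := EE_pos hK hs hsg c y
    have n1 := hq2 z hz'
    have n2 : ‖(a y : ℂ) * z‖ ≤ δ * |a y| := by
      rw [norm_mul, Complex.norm_real, Real.norm_eq_abs, mul_comm]
      gcongr
    have n3 : ‖Complex.exp (-z ^ 2 / (2 * s ^ 2) + a y * z)‖ ≤
        e * (Real.exp (δ * a y) + Real.exp (-δ * a y)) := by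
      rw [Complex.exp_add, norm_mul]
      apply mul_le_mul _ _ (norm_nonneg _) hep.le
      · exact (Complex.norm_exp_le_exp_norm _).trans (Real.exp_le_exp.2 n1)
      · apply (Complex.norm_exp_le_exp_norm _).trans
        apply (Real.exp_le_exp.2 n2).trans
        rcases abs_cases (a y) with h | h
        · rw [h.1]; linarith [Real.exp_pos (-δ * a y)]
        · rw [h.1, mul_neg, ← neg_mul]; linarith [Real.exp_pos (δ * a y)]
    have n4 : ‖QQ K s sg c a z y‖ ≤ 3 / 2 := by
      have := norm_add_le (QQ K s sg c a z y - 1) 1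
      rw [sub_add_cancel, norm_one] at this
      linarith [hQ1 z hz' y]
    have n5 : ‖Complex.log (QQ K s sg c a z y)‖ ≤ 1 := by
      have := Complex.norm_log_one_add_half_le_self (hQ1 z hz' y)
      rw [add_sub_cancel] at this
      linarith [hQ1 z hz' y]
    have n6 : ‖-z ^ 2 / (2 * (s:ℂ) ^ 2) + a y * z + Complex.log (QQ K s sg c a z y) + L y‖ ≤
        C4 * (1 + y ^ 2) := by
      have k1 := norm_add_le (-z ^ 2 / (2 * (s:ℂ) ^ 2) + a y * z + Complex.log (QQ K s sg c a z y))
        (L y : ℂ)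
      have k2 := norm_add_le (-z ^ 2 / (2 * (s:ℂ) ^ 2) + a y * z) (Complex.log (QQ K s sg c a z y))
      have k3 := norm_add_le (-z ^ 2 / (2 * (s:ℂ) ^ 2)) ((a y : ℂ) * z)
      rw [Complex.norm_real, Real.norm_eq_abs] at k1
      have k4 := hLb y
      have k5 := hab y
      have k6 : δ * |a y| ≤ 1 * |a y| := by gcongr; linarith
      have k7 : 0 ≤ δ ^ 2 / (2 * s ^ 2) * y ^ 2 := by positivity
      have k8 := sq_nonneg y
      simp only [hC4]
      linarith
    simp only [hf]
    rw [norm_mul, norm_mul, norm_mul, Complex.norm_real, Real.norm_of_nonneg (by positivity)]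
    have t1 := tilt δ (abs_of_pos hδ0) y
    have t2 := tilt (-δ) (by rw [abs_neg, abs_of_pos hδ0]) y
    have q1 := EE_pos hK hs hsg (c + δ) y
    have q2 := EE_pos hK hs hsg (c + -δ) y
    calc _ ≤ kap s * EE K s sg c y * (e * (Real.exp (δ * a y) + Real.exp (-δ * a y))) * (3 / 2) *
          (C4 * (1 + y ^ 2)) := by gcongr
      _ = kap s * e * (3 / 2) * C4 * (1 + y ^ 2) *
          (EE K s sg c y * Real.exp (δ * a y) + EE K s sg c y * Real.exp (-δ * a y)) := by ring
      _ ≤ kap s * e * (3 / 2) * C4 * (1 + y ^ 2) *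
          (2 * e * EE K s sg (c + δ) y + 2 * e * EE K s sg (c + -δ) y) := by gcongr
      _ = g y := by simp only [hg]; ring
  refine ⟨δ, hδ0, fun z => ∫ y, f z y, ?_, ?_⟩
  · apply holo_integral Metric.isOpen_ball hgi
    · intro z hz
      apply Measurable.aestronglyMeasurable
      have hQm := QQ_meas (K := K) (sg := sg) hs c ham z
      have h1 : Measurable fun y => -z ^ 2 / (2 * (s:ℂ) ^ 2) + a y * z :=
        ((Complex.measurable_ofReal.comp ham).mul_const z).const_add _
      exact (((Complex.measurable_ofReal.comp ((EE_cont hs c).measurable.const_mul _)).mul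
        (Complex.measurable_exp.comp h1)).mul hQm).mul
        ((h1.add (Complex.measurable_log.comp hQm)).add (Complex.measurable_ofReal.comp hLm))
    · intro y
      have hd := (QQ_props (a := a) hK hs hsg c y (hcen y).1 (hcen y).2).1.mono
        (Metric.ball_subset_ball (by linarith : δ ≤ 1))
      have h1 : DifferentiableOn ℂ (fun z : ℂ => -z ^ 2 / (2 * (s:ℂ) ^ 2) + a y * z)
        (Metric.ball 0 δ) := by fun_prop
      have h2 : DifferentiableOn ℂ (fun z : ℂ => Complex.log (QQ K s sg c a z y))
        (Metric.ball 0 δ) := hd.clog fun z hz => hQslit z (mem_ball_zero_iff.1 hz).le y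
      exact (((differentiableOn_const _).mul h1.cexp).mul hd).mul
        ((h1.add h2).add (differentiableOn_const _))
    · exact hbound
  · intro u hu
    unfold ii
    rw [← integral_complex_ofReal]
    apply integral_congr_ae
    filter_upwards with y
    have p0 := EE_pos hK hs hsg c y
    have p1 := EE_pos hK hs hsg (c + u) y
    have hpd : pd K m s sg (Real.exp (2 * (t + u))) y = kap s * EE K s sg (c + u) y := by
      rw [pd_eq_EE hs, hc]; congr 2; ring
    simp only [hf]
    rw [hQr y u, hpd]
    have hr : 0 < EE K s sg (c + u) y * Real.exp (u ^ 2 / (2 * s ^ 2) - u * a y) / EE K s sg c y := by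
      positivity
    rw [← Complex.ofReal_log hr.le, Real.log_div (by positivity) p0.ne',
      Real.log_mul p1.ne' (by positivity), Real.log_exp, Real.log_mul hkap.ne' p1.ne']
    have h1 : -(u:ℂ) ^ 2 / (2 * (s:ℂ) ^ 2) + a y * u =
      ((-(u ^ 2 / (2 * s ^ 2) - u * a y) : ℝ) : ℂ) := by push_cast; ring
    rw [h1, ← Complex.ofReal_exp, ← Complex.ofReal_mul, ← Complex.ofReal_mul, ← Complex.ofReal_add,
      ← Complex.ofReal_add, ← Complex.ofReal_mul]
    congr 1
    rw [Real.exp_neg]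
    simp only [hL]
    have := (Real.exp_pos (u ^ 2 / (2 * s ^ 2) - u * a y)).ne'
    generalize Real.exp (u ^ 2 / (2 * s ^ 2) - u * a y) = E at *
    field_simp
    ring

open Filter Topology in
lemma ii_analytic {K m s sg : ℝ} (hK : 0 < K) (hs : 0 < s) (hsg : 0 < sg) {A : ℝ} (hA : 0 < A)
    (F : Measure ℝ) [IsProbabilityMeasure F] (hF : F (Set.Icc 0 A)ᶜ = 0) (t : ℝ) :
    AnalyticAt ℝ (fun t => ii K m s sg F (Real.exp (2 * t))) t := by
  obtain ⟨δ, hδ, Φ, hΦ, hu⟩ := ii_holo (m := m) hK hs hsg hA F hF t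
  have h0 : AnalyticAt ℂ Φ ((0:ℝ):ℂ) :=
    hΦ.analyticAt (by simpa using Metric.ball_mem_nhds 0 hδ)
  have h1 : AnalyticAt ℝ (fun x : ℝ => (Φ x).re) 0 := h0.re_ofReal
  have h2 : AnalyticAt ℝ (fun x : ℝ => (Φ ((x - t : ℝ) : ℂ)).re) t := by
    have : AnalyticAt ℝ (fun x : ℝ => x - t) t := analyticAt_id.sub analyticAt_const
    exact AnalyticAt.comp_of_eq (g := fun x : ℝ => (Φ x).re) (f := fun x : ℝ => x - t) h1 this (by simp)
  refine h2.congr ?_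
  filter_upwards [Metric.ball_mem_nhds t hδ] with x hx
  rw [hu (x - t) (by simpa [Real.dist_eq] using hx), Complex.ofReal_re]
  congr 2; ring


/-! ### Part D5 : zeros near the origin -/

open Filter Topology in
lemma zeros_near_zero {K m s sg : ℝ} (hK : 0 < K) (hs : 0 < s) (hsg : 0 < sg) {A c : ℝ} (hA : 0 < A)
    (hc : 0 < c) (F : Measure ℝ) [IsProbabilityMeasure F] (hF : F (Set.Icc 0 A)ᶜ = 0)
    (α β γ b : ℝ)
    (hkkt : ∀ᵐ x ∂F, ii K m s sg F x = α + β * x + γ * (b * x * Real.log (1 + c * x)))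
    (hS : ¬ ∃ S : Finset ℝ, (S : Set ℝ) ⊆ Set.Icc (0:ℝ) A ∧ F S = 1) :
    ∃ᶠ x in 𝓝[>] (0:ℝ), ii K m s sg F x = α + β * x + γ * (b * x * Real.log (1 + c * x)) := by
  set Z : Set ℝ := {x | x ∈ Set.Icc 0 A ∧
    ii K m s sg F x = α + β * x + γ * (b * x * Real.log (1 + c * x))} with hZ
  have hZae : ∀ᵐ x ∂F, x ∈ Z := by
    have h1 : ∀ᵐ x ∂F, x ∈ Set.Icc 0 A := hF
    filter_upwards [h1, hkkt] with x h1 h2 using ⟨h1, h2⟩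
  have hinf : Z.Infinite := by
    intro hfin
    apply hS
    refine ⟨hfin.toFinset, ?_, ?_⟩
    · intro x hx
      have : x ∈ Z := by simpa using hx
      exact this.1
    · rw [Set.Finite.coe_toFinset]
      exact (prob_compl_eq_zero_iff hfin.measurableSet).1 hZae
  obtain ⟨x, hx, hacc⟩ := hinf.exists_accPt_of_subset_isCompact isCompact_Icc (fun z hz => hz.1)
  rw [accPt_iff_frequently] at hacc
  rcases hx.1.eq_or_lt with h0 | h0
  · rw [← h0] at hacc
    rw [frequently_nhdsWithin_iff]
    refine hacc.mono ?_
    rintro y ⟨hy, hyZ⟩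
    exact ⟨hyZ.2, lt_of_le_of_ne hyZ.1.1 (Ne.symm hy)⟩
  · set h : ℝ → ℝ := fun t => ii K m s sg F (Real.exp (2 * t)) - (α + β * Real.exp (2 * t) +
      γ * (b * Real.exp (2 * t) * Real.log (1 + c * Real.exp (2 * t)))) with hh
    have hexp : ∀ t : ℝ, AnalyticAt ℝ (fun t : ℝ => Real.exp (2 * t)) t := by
      intro t; exact (analyticAt_const.mul analyticAt_id).rexp'
    have han : AnalyticOnNhd ℝ h Set.univ := by
      intro t _
      apply (ii_analytic hK hs hsg hA F hF t).sub
      have hl : AnalyticAt ℝ (fun t : ℝ => Real.log (1 + c * Real.exp (2 * t))) t := by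
        apply AnalyticAt.log (analyticAt_const.add (analyticAt_const.mul (hexp t)))
        have : 0 < c * Real.exp (2 * t) := mul_pos hc (Real.exp_pos (2 * t))
        show 0 < 1 + c * Real.exp (2 * t)
        linarith
      exact ((analyticAt_const.add (analyticAt_const.mul (hexp t)))).add
        (analyticAt_const.mul ((analyticAt_const.mul (hexp t)).mul hl))
    have hfreq : ∃ᶠ t in 𝓝[≠] (Real.log x / 2), h t = 0 := by
      have htend : Tendsto (fun y => Real.log y / 2) (𝓝[≠] x) (𝓝[≠] (Real.log x / 2)) := by
        rw [tendsto_nhdsWithin_iff]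
        constructor
        · apply Tendsto.mono_left _ nhdsWithin_le_nhds
          exact ((Real.continuousAt_log h0.ne').div_const 2)
        · have : ∀ᶠ y in 𝓝[≠] x, 0 < y := nhdsWithin_le_nhds (lt_mem_nhds h0)
          filter_upwards [this, self_mem_nhdsWithin] with y hy hyx
          intro heq
          apply hyx
          have heq' : Real.log y / 2 = Real.log x / 2 := heq
          exact Real.log_injOn_pos hy h0 (by linarith)
      have h2 : ∃ᶠ y in 𝓝[≠] x, 0 < y ∧ y ∈ Z := by
        rw [frequently_nhdsWithin_iff]
        have := hacc.and_eventually (lt_mem_nhds h0)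
        exact this.mono fun y hy => ⟨⟨hy.2, hy.1.2⟩, hy.1.1⟩
      apply htend.frequently
      refine h2.mono ?_
      rintro y ⟨hy, hyZ⟩
      simp only [hh]
      rw [mul_div_cancel₀ _ (two_ne_zero), Real.exp_log hy, hyZ.2, sub_self]
    have hz := han.eqOn_zero_of_preconnected_of_frequently_eq_zero isPreconnected_univ
      (Set.mem_univ _) hfreq
    apply Eventually.frequently
    filter_upwards [self_mem_nhdsWithin] with y hy
    have := hz (Set.mem_univ (Real.log y / 2))
    simp only [hh, Pi.zero_apply] at this
    rw [mul_div_cancel₀ _ (two_ne_zero), Real.exp_log hy] at this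
    linarith


/-! ### Part E1 : polynomial lemma and the entire part -/

open Filter Topology in
lemma poly_coeff_zero (N : ℕ) : ∀ (p : Polynomial ℝ) (C : ℝ),
    (∃ᶠ x in 𝓝[>] (0:ℝ), |p.eval x| ≤ C * x ^ N) → ∀ k < N, p.coeff k = 0 := by
  induction N with
  | zero => intro p C h k hk; omega
  | succ N ih =>
    intro p C h
    have h0 : p.coeff 0 = 0 := by
      rw [Polynomial.coeff_zero_eq_eval_zero]
      by_contra hne
      have hpos : 0 < |p.eval 0| := abs_pos.2 hne
      have t1 : Tendsto (fun x : ℝ => |p.eval x| - C * x ^ (N + 1)) (𝓝[>] 0) (𝓝 (|p.eval 0|)) := by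
        have hc : Continuous (fun x : ℝ => |p.eval x| - C * x ^ (N + 1)) := by
          have := p.continuous; fun_prop
        have := hc.tendsto 0
        simp only [ne_eq, Nat.add_eq_zero_iff, one_ne_zero, and_false, not_false_eq_true, zero_pow,
          mul_zero, sub_zero] at this
        exact this.mono_left nhdsWithin_le_nhds
      have t2 := t1.eventually (lt_mem_nhds hpos)
      obtain ⟨x, hx1, hx2⟩ := (h.and_eventually t2).exists
      linarith
    obtain ⟨q, hq⟩ := Polynomial.X_dvd_iff.2 h0
    have h2 : ∃ᶠ x in 𝓝[>] (0:ℝ), |q.eval x| ≤ C * x ^ N := by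
      refine (h.and_eventually self_mem_nhdsWithin).mono ?_
      rintro x ⟨hx, hx0⟩
      have hx0' : 0 < x := hx0
      rw [hq, Polynomial.eval_mul, Polynomial.eval_X, abs_mul, abs_of_pos hx0'] at hx
      have : x * |q.eval x| ≤ x * (C * x ^ N) := by rw [pow_succ] at hx; linarith
      exact le_of_mul_le_mul_left this hx0'
    intro k hk
    rcases k with _ | k
    · exact h0
    · rw [hq, Polynomial.coeff_X_mul]
      exact ih q C h2 k (by omega)

lemma ph_shift {sg : ℝ} (hsg : 0 < sg) (y X : ℝ) :
    ph sg (y - X) = ph sg y * Real.exp (X * y / sg ^ 2 - X ^ 2 / (2 * sg ^ 2)) := by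
  unfold ph
  rw [mul_assoc (√(2 * π * sg ^ 2))⁻¹, ← Real.exp_add]
  congr 2
  field_simp
  ring

lemma one_add_sq_le (y : ℝ) : 1 + y ^ 2 ≤ 2 * Real.exp |y| := by
  have := Real.quadratic_le_exp_of_nonneg (abs_nonneg y)
  rw [sq_abs] at this
  linarith [abs_nonneg y]

lemma ph_exp_int {sg : ℝ} (hsg : 0 < sg) (a : ℝ) :
    Integrable (fun y => ph sg y * Real.exp (a * |y|)) := by
  have key : ∀ X : ℝ, Integrable (fun y => ph sg y * Real.exp (X * y)) := by
    intro X
    have h1 : Integrable (fun y => ph sg (y - X * sg ^ 2)) := ph_int.comp_sub_right _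
    refine (h1.mul_const (Real.exp ((X * sg ^ 2) ^ 2 / (2 * sg ^ 2)))).congr
      (Filter.Eventually.of_forall fun y => ?_)
    simp only
    rw [ph_shift hsg, mul_assoc, ← Real.exp_add]
    congr 2
    field_simp
    ring
  apply Integrable.mono' ((key a).add (key (-a)))
  · exact ((ph_cont sg).mul (by fun_prop)).aestronglyMeasurable
  · filter_upwards with y
    rw [Real.norm_of_nonneg (mul_nonneg (ph_nonneg _ _) (Real.exp_pos _).le)]
    simp only [Pi.add_apply]
    rw [← mul_add]
    apply mul_le_mul_of_nonneg_left _ (ph_nonneg _ _)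
    rcases abs_cases y with h | h
    · rw [h.1]; linarith [Real.exp_pos (-a * y)]
    · rw [h.1, mul_neg, ← neg_mul]; linarith [Real.exp_pos (a * y)]

lemma ph_exp_int' {sg : ℝ} (hsg : 0 < sg) (a : ℝ) :
    Integrable (fun y => ph sg y * ((1 + y ^ 2) * Real.exp (a * |y|))) := by
  apply Integrable.mono' ((ph_exp_int hsg (1 + a)).const_mul 2)
  · exact ((ph_cont sg).mul (by fun_prop)).aestronglyMeasurable
  · filter_upwards with y
    rw [Real.norm_of_nonneg (mul_nonneg (ph_nonneg _ _) (by positivity))]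
    have h1 := mul_le_mul_of_nonneg_right (one_add_sq_le y) (Real.exp_pos (a * |y|)).le
    have h2 := mul_le_mul_of_nonneg_left h1 (ph_nonneg sg y)
    rw [add_mul 1 a, one_mul, Real.exp_add]
    linarith

/-- Gaussian smoothing -/
def Th (sg : ℝ) (Λ : ℝ → ℝ) (X : ℝ) : ℝ := ∫ y, ph sg (y - X) * Λ y

lemma Th_int {sg : ℝ} (hsg : 0 < sg) {Λ : ℝ → ℝ} (hΛ : Continuous Λ) {C : ℝ}
    (hC : ∀ y, |Λ y| ≤ C * (1 + y ^ 2)) (X : ℝ) : Integrable (fun y => ph sg (y - X) * Λ y) := by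
  have hIntg : Integrable (fun y => ph sg (y - X) * (C * (1 + y ^ 2))) := by
    apply Integrable.mono' ((ph_exp_int' hsg (|X| / sg ^ 2)).const_mul |C|)
    · exact (((ph_cont sg).comp (by fun_prop)).mul (by fun_prop)).aestronglyMeasurable
    · filter_upwards with y
      rw [ph_shift hsg, norm_mul, norm_mul, Real.norm_of_nonneg (ph_nonneg _ _), norm_mul,
        Real.norm_of_nonneg (Real.exp_pos _).le, Real.norm_eq_abs,
        Real.norm_of_nonneg (by positivity)]
      have h1 : Real.exp (X * y / sg ^ 2 - X ^ 2 / (2 * sg ^ 2)) ≤ Real.exp (|X| / sg ^ 2 * |y|) := by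
        apply Real.exp_le_exp.2
        have : X * y / sg ^ 2 ≤ |X| / sg ^ 2 * |y| := by
          rw [div_mul_eq_mul_div, ← abs_mul]
          gcongr
          exact le_abs_self _
        have : 0 ≤ X ^ 2 / (2 * sg ^ 2) := by positivity
        linarith
      have h2 := mul_le_mul_of_nonneg_left h1 (ph_nonneg sg y)
      calc _ ≤ ph sg y * Real.exp (|X| / sg ^ 2 * |y|) * (|C| * (1 + y ^ 2)) := by
            gcongr
        _ = _ := by ring
  apply Integrable.mono' hIntg
  · exact (((ph_cont sg).comp (by fun_prop)).mul hΛ).aestronglyMeasurable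
  · filter_upwards with y
    rw [norm_mul, Real.norm_of_nonneg (ph_nonneg _ _), Real.norm_eq_abs]
    exact mul_le_mul_of_nonneg_left (hC y) (ph_nonneg _ _)

lemma ph_total {sg : ℝ} (hsg : 0 < sg) : ∫ y, ph sg y = 1 := by
  have : ph sg = gaussianPDFReal 0 (Real.toNNReal (sg ^ 2)) := funext (ph_eq sg)
  rw [this]; exact integral_gaussianPDFReal_eq_one _ (var_ne hsg)

lemma ph_sq_int {sg : ℝ} (hsg : 0 < sg) : Integrable (fun y => ph sg y * y ^ 2) := by
  apply Integrable.mono' (ph_exp_int' hsg 0)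
  · exact ((ph_cont sg).mul (by fun_prop)).aestronglyMeasurable
  · filter_upwards with y
    rw [Real.norm_of_nonneg (mul_nonneg (ph_nonneg _ _) (by positivity))]
    apply mul_le_mul_of_nonneg_left _ (ph_nonneg _ _)
    simp

lemma Th_bound {sg : ℝ} (hsg : 0 < sg) {Λ : ℝ → ℝ} (hΛ : Continuous Λ) {C : ℝ} (hC0 : 0 < C)
    (hC : ∀ y, |Λ y| ≤ C * (1 + y ^ 2)) : ∃ C', 0 < C' ∧ ∀ X, |Th sg Λ X| ≤ C' * (1 + X ^ 2) := by
  set M := ∫ y, ph sg y * y ^ 2 with hM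
  have hM0 : 0 ≤ M := integral_nonneg fun y => mul_nonneg (ph_nonneg _ _) (sq_nonneg _)
  refine ⟨C * (2 + 2 * M), by positivity, fun X => ?_⟩
  have i1 : Integrable (fun y => C * (1 + 2 * X ^ 2) * ph sg y + 2 * C * (ph sg y * y ^ 2)) :=
    (ph_int.const_mul _).add ((ph_sq_int hsg).const_mul _)
  unfold Th
  have h1 : ∫ y, ph sg (y - X) * Λ y = ∫ y, ph sg y * Λ (y + X) := by
    rw [← integral_add_right_eq_self _ X]
    simp
  rw [h1]
  have h2 : ‖∫ y, ph sg y * Λ (y + X)‖ ≤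
      ∫ y, (C * (1 + 2 * X ^ 2) * ph sg y + 2 * C * (ph sg y * y ^ 2)) := by
    apply norm_integral_le_of_norm_le i1
    filter_upwards with y
    rw [norm_mul, Real.norm_of_nonneg (ph_nonneg _ _), Real.norm_eq_abs]
    have := hC (y + X)
    have h3 : C * (1 + (y + X) ^ 2) ≤ C * (1 + 2 * X ^ 2 + 2 * y ^ 2) := by
      apply mul_le_mul_of_nonneg_left _ hC0.le; nlinarith [sq_nonneg (y - X)]
    have := mul_le_mul_of_nonneg_left (this.trans h3) (ph_nonneg sg y)
    linarith
  rw [Real.norm_eq_abs, integral_add (ph_int.const_mul _) ((ph_sq_int hsg).const_mul _),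
    integral_const_mul, integral_const_mul, ph_total hsg, ← hM] at h2
  have : 0 ≤ C * M * X ^ 2 := by positivity
  have : 0 ≤ C * X ^ 2 := by positivity
  linarith

/-- Taylor expansion of the smoothed function -/
lemma Th_series {sg : ℝ} (hsg : 0 < sg) {Λ : ℝ → ℝ} (hΛ : Continuous Λ) {C : ℝ} (hC0 : 0 < C)
    (hC : ∀ y, |Λ y| ≤ C * (1 + y ^ 2)) :
    ∃ θ : ℕ → ℝ, ∀ X : ℝ, HasSum (fun k => θ k * X ^ k) (Th sg Λ X) := by
  set f : ℂ → ℂ := fun z => ∫ y : ℝ, ((ph sg y * Λ y : ℝ) : ℂ) * Complex.exp (z * ((y / sg ^ 2 : ℝ) : ℂ))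
    with hf
  have hfd : Differentiable ℂ f := by
    intro z
    have : DifferentiableOn ℂ f (Metric.ball 0 (‖z‖ + 1)) := by
      apply holo_integral Metric.isOpen_ball
        ((ph_exp_int' hsg ((‖z‖ + 1) / sg ^ 2)).const_mul C)
      · intro z _
        apply Continuous.aestronglyMeasurable
        have := ph_cont sg
        fun_prop
      · intro y; fun_prop
      · intro w hw y
        have hw' : ‖w‖ ≤ ‖z‖ + 1 := (mem_ball_zero_iff.1 hw).le
        rw [norm_mul, Complex.norm_real, norm_mul, Real.norm_of_nonneg (ph_nonneg _ _),
          Real.norm_eq_abs]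
        have h1 : ‖Complex.exp (w * ((y / sg ^ 2 : ℝ) : ℂ))‖ ≤ Real.exp ((‖z‖ + 1) / sg ^ 2 * |y|) := by
          apply (Complex.norm_exp_le_exp_norm _).trans
          apply Real.exp_le_exp.2
          rw [norm_mul, Complex.norm_real, Real.norm_eq_abs, abs_div, abs_of_pos (by positivity : 0 < sg ^ 2)]
          calc ‖w‖ * (|y| / sg ^ 2) ≤ (‖z‖ + 1) * (|y| / sg ^ 2) := by gcongr
            _ = _ := by ring
        have hp := ph_nonneg sg y
        calc _ ≤ ph sg y * (C * (1 + y ^ 2)) * Real.exp ((‖z‖ + 1) / sg ^ 2 * |y|) := by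
              gcongr; exact hC y
          _ = _ := by ring
    exact this.differentiableAt (Metric.isOpen_ball.mem_nhds (by simp))
  set T : ℂ → ℂ := fun z => Complex.exp (-z ^ 2 / (2 * (sg:ℂ) ^ 2)) * f z with hT
  have hTd : Differentiable ℂ T := by
    apply Differentiable.mul _ hfd
    fun_prop
  have hTr : ∀ X : ℝ, T X = ((Th sg Λ X : ℝ) : ℂ) := by
    intro X
    simp only [hT, hf]
    rw [← integral_const_mul]
    unfold Th
    rw [← integral_complex_ofReal]
    congr 1
    ext y
    rw [ph_shift hsg, Real.exp_sub, Real.exp_eq_exp_ℝ]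
    simp only [← Real.exp_eq_exp_ℝ]
    push_cast
    rw [show -(X:ℂ) ^ 2 / (2 * (sg:ℂ) ^ 2) = - ((X:ℂ) ^ 2 / (2 * (sg:ℂ) ^ 2)) by ring, Complex.exp_neg]
    rw [show (X:ℂ) * ((y:ℂ) / (sg:ℂ) ^ 2) = (X:ℂ) * (y:ℂ) / (sg:ℂ) ^ 2 by ring]
    ring
  refine ⟨fun k => ((k.factorial : ℂ)⁻¹ * iteratedDeriv k T 0).re, fun X => ?_⟩
  have h := Complex.hasSum_taylorSeries_of_entire hTd 0 (X : ℂ)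
  rw [hTr X] at h
  have h2 := Complex.hasSum_re h
  rw [Complex.ofReal_re] at h2
  convert h2 using 2 with k
  simp only [sub_zero, smul_eq_mul]
  rw [show (k.factorial : ℂ)⁻¹ * ((X:ℂ) ^ k * iteratedDeriv k T 0) =
    ((X ^ k : ℝ) : ℂ) * ((k.factorial : ℂ)⁻¹ * iteratedDeriv k T 0) by push_cast; ring,
    Complex.re_ofReal_mul, mul_comm]

lemma Th_taylor {sg : ℝ} (hsg : 0 < sg) {Λ : ℝ → ℝ} (hΛ : Continuous Λ) {C : ℝ} (hC0 : 0 < C)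
    (hC : ∀ y, |Λ y| ≤ C * (1 + y ^ 2)) {θ : ℕ → ℝ}
    (hθ : ∀ X : ℝ, HasSum (fun k => θ k * X ^ k) (Th sg Λ X)) (N : ℕ) :
    ∃ B, 0 < B ∧ ∀ X, |Th sg Λ X - ∑ k ∈ Finset.range N, θ k * X ^ k| ≤ B * (|X| ^ N + |X| ^ (N + 2)) := by
  obtain ⟨C', hC', hb⟩ := Th_bound hsg hΛ hC0 hC
  have hs1 : Summable (fun k => |θ k|) := by
    have := (hθ 1).summable.abs
    simpa using this
  set S := ∑' k, |θ k| with hS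
  have hS0 : 0 ≤ S := tsum_nonneg fun k => abs_nonneg _
  refine ⟨S + 2 * C', by positivity, fun X => ?_⟩
  have hpN : 0 ≤ |X| ^ N := by positivity
  have hpN2 : 0 ≤ |X| ^ (N + 2) := by positivity
  rcases le_total |X| 1 with hX | hX
  · have h1 := (hasSum_nat_add_iff' N).2 (hθ X)
    have h2 : |Th sg Λ X - ∑ k ∈ Finset.range N, θ k * X ^ k| ≤ S * |X| ^ N := by
      have hb2 : ∀ k, ‖θ (k + N) * X ^ (k + N)‖ ≤ |θ (k + N)| * |X| ^ N := by
        intro k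
        rw [Real.norm_eq_abs, abs_mul, abs_pow]
        gcongr 1
        exact pow_le_pow_of_le_one (abs_nonneg _) hX (by omega)
      have hs2 : Summable (fun k => |θ (k + N)| * |X| ^ N) :=
        ((_root_.summable_nat_add_iff N).2 hs1).mul_right _
      have h3 := tsum_of_norm_bounded hs2.hasSum hb2
      rw [h1.tsum_eq, Real.norm_eq_abs, _root_.tsum_mul_right] at h3
      apply h3.trans
      gcongr
      have h4 := hs1.sum_add_tsum_nat_add N
      have : 0 ≤ ∑ i ∈ Finset.range N, |θ i| := Finset.sum_nonneg fun i _ => abs_nonneg _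
      linarith
    nlinarith
  · have h1 : |∑ k ∈ Finset.range N, θ k * X ^ k| ≤ S * |X| ^ N := by
      apply (Finset.abs_sum_le_sum_abs _ _).trans
      calc ∑ k ∈ Finset.range N, |θ k * X ^ k| ≤ ∑ k ∈ Finset.range N, |θ k| * |X| ^ N := by
            apply Finset.sum_le_sum
            intro k hk
            rw [abs_mul, abs_pow]
            gcongr 1
            exact pow_le_pow_right₀ hX (Finset.mem_range.1 hk).le
        _ = (∑ k ∈ Finset.range N, |θ k|) * |X| ^ N := by rw [Finset.sum_mul]
        _ ≤ _ := by
            gcongr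
            exact hs1.sum_le_tsum _ (fun i _ => abs_nonneg _)
    have h2 : 1 + X ^ 2 ≤ 2 * |X| ^ (N + 2) := by
      have a1 : |X| ^ 2 ≤ |X| ^ (N + 2) := pow_le_pow_right₀ hX (by omega)
      have a2 : 1 ≤ |X| ^ 2 := one_le_pow₀ hX
      rw [sq_abs] at a1 a2
      linarith
    have h3 := (hb X).trans (mul_le_mul_of_nonneg_left h2 hC'.le)
    have h4 := abs_sub (Th sg Λ X) (∑ k ∈ Finset.range N, θ k * X ^ k)
    nlinarith


/-! ### Part E2 : expansion of the linear part -/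

/-- moments of the fading -/
def mom (m s : ℝ) (k : ℕ) : ℝ := ∫ g, Real.exp (2 * g) ^ k ∂(gam m s)

lemma mom_int (m s : ℝ) (k : ℕ) : Integrable (fun g => Real.exp (2 * g) ^ k) (gam m s) := by
  refine (exp_gam_integrable m s (2 * k)).congr (Filter.Eventually.of_forall fun g => ?_)
  simp only
  rw [← Real.exp_nat_mul]; congr 1; ring

lemma mom_pos (m s : ℝ) (k : ℕ) : 0 < mom m s k := by
  unfold mom
  have h : ∀ g : ℝ, Real.exp (2 * g) ^ k = Real.exp (k * (2 * g)) := fun g => (Real.exp_nat_mul _ _).symm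
  have hi := mom_int m s k
  simp_rw [h] at hi ⊢
  exact integral_exp_pos hi

lemma V_eq {K m s sg : ℝ} (hsg : 0 < sg) {Λ : ℝ → ℝ} (hΛ : Continuous Λ) {C : ℝ} (hC0 : 0 < C)
    (hC : ∀ y, |Λ y| ≤ C * (1 + y ^ 2)) (x : ℝ) :
    ∫ y, pd K m s sg x y * Λ y = ∫ g, Th sg Λ (K * x * Real.exp (2 * g)) ∂(gam m s) := by
  have hcont : Continuous (fun p : ℝ × ℝ => ph sg (p.2 - K * x * Real.exp (2 * p.1)) * Λ p.2) :=
    ((ph_cont sg).comp (by fun_prop)).mul (hΛ.comp continuous_snd)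
  have hIntg : Integrable (fun p : ℝ × ℝ => ph sg (p.2 - K * x * Real.exp (2 * p.1)) * Λ p.2)
      ((gam m s).prod volume) := by
    rw [integrable_prod_iff hcont.aestronglyMeasurable]
    constructor
    · filter_upwards with g
      exact Th_int hsg hΛ hC _
    · obtain ⟨C', hC', hb⟩ := Th_bound (Λ := fun y => |Λ y|) hsg hΛ.abs hC0
        (fun y => by rw [abs_abs]; exact hC y)
      have hi : Integrable (fun g => C' * (1 + (K * x) ^ 2 * Real.exp (2 * g) ^ 2)) (gam m s) :=
        ((integrable_const _).add ((mom_int m s 2).const_mul _)).const_mul _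
      apply Integrable.mono' hi
      · exact hcont.aestronglyMeasurable.norm.integral_prod_right'
      · filter_upwards with g
        have := hb (K * x * Real.exp (2 * g))
        unfold Th at this
        rw [mul_pow] at this
        refine le_trans (le_of_eq ?_) this
        rw [Real.norm_eq_abs]
        congr 1
        congr 1
        ext y
        rw [norm_mul, Real.norm_of_nonneg (ph_nonneg _ _), Real.norm_eq_abs]
  have := integral_integral_swap (f := fun g y => ph sg (y - K * x * Real.exp (2 * g)) * Λ y) hIntg
  unfold Th
  rw [this]
  congr 1
  ext y
  rw [integral_mul_const]
  rfl

lemma V_exp {K m s sg : ℝ} (hK : 0 < K) (hsg : 0 < sg) {Λ : ℝ → ℝ} (hΛ : Continuous Λ) {C : ℝ}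
    (hC0 : 0 < C) (hC : ∀ y, |Λ y| ≤ C * (1 + y ^ 2)) {θ : ℕ → ℝ}
    (hθ : ∀ X : ℝ, HasSum (fun k => θ k * X ^ k) (Th sg Λ X)) (N : ℕ) :
    ∃ B, 0 < B ∧ ∀ x, 0 ≤ x → x ≤ 1 → |(∫ y, pd K m s sg x y * Λ y) -
      ∑ k ∈ Finset.range N, (θ k * K ^ k * mom m s k) * x ^ k| ≤ B * x ^ N := by
  obtain ⟨B, hB, hb⟩ := Th_taylor hsg hΛ hC0 hC hθ N
  obtain ⟨C', hC', hTb⟩ := Th_bound hsg hΛ hC0 hC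
  have hm1 := mom_pos m s N
  have hm2 := mom_pos m s (N + 2)
  refine ⟨B * (K ^ N * mom m s N + K ^ (N + 2) * mom m s (N + 2)), by positivity, ?_⟩
  intro x hx0 hx1
  rw [V_eq hsg hΛ hC0 hC]
  have hThm : AEStronglyMeasurable (fun g => Th sg Λ (K * x * Real.exp (2 * g))) (gam m s) := by
    have h1 : StronglyMeasurable (fun X => Th sg Λ X) := by
      unfold Th
      apply StronglyMeasurable.integral_prod_right' (f := fun p : ℝ × ℝ => ph sg (p.2 - p.1) * Λ p.2)
      exact (((ph_cont sg).comp (by fun_prop)).mul (hΛ.comp continuous_snd)).stronglyMeasurable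
    exact (h1.comp_measurable (by fun_prop)).aestronglyMeasurable
  have hThi : Integrable (fun g => Th sg Λ (K * x * Real.exp (2 * g))) (gam m s) := by
    have hi : Integrable (fun g => C' * (1 + (K * x) ^ 2 * Real.exp (2 * g) ^ 2)) (gam m s) :=
      ((integrable_const _).add ((mom_int m s 2).const_mul _)).const_mul _
    apply Integrable.mono' hi hThm
    filter_upwards with g
    have := hTb (K * x * Real.exp (2 * g))
    rwa [mul_pow] at this
  have hki : ∀ k, Integrable (fun g => θ k * (K * x * Real.exp (2 * g)) ^ k) (gam m s) := by
    intro k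
    simp_rw [mul_pow]
    exact ((mom_int m s k).const_mul _).const_mul _
  have hsum : ∑ k ∈ Finset.range N, (θ k * K ^ k * mom m s k) * x ^ k =
      ∫ g, ∑ k ∈ Finset.range N, θ k * (K * x * Real.exp (2 * g)) ^ k ∂(gam m s) := by
    rw [integral_finsetSum _ (fun k _ => hki k)]
    apply Finset.sum_congr rfl
    intro k _
    simp_rw [mul_pow]
    rw [integral_const_mul, integral_const_mul]
    unfold mom
    ring
  rw [hsum, ← integral_sub hThi (integrable_finsetSum _ fun k _ => hki k)]
  have hRi : Integrable (fun g => B * (K ^ N * x ^ N * Real.exp (2 * g) ^ N +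
      K ^ (N + 2) * x ^ N * Real.exp (2 * g) ^ (N + 2))) (gam m s) :=
    (((mom_int m s N).const_mul _).add ((mom_int m s (N + 2)).const_mul _)).const_mul _
  have h := norm_integral_le_of_norm_le (f := fun g => Th sg Λ (K * x * Real.exp (2 * g)) -
    ∑ k ∈ Finset.range N, θ k * (K * x * Real.exp (2 * g)) ^ k) hRi (by
      filter_upwards with g
      rw [Real.norm_eq_abs]
      apply (hb _).trans
      apply mul_le_mul_of_nonneg_left _ hB.le
      have he := Real.exp_pos (2 * g)
      rw [abs_of_nonneg (by positivity), mul_pow, mul_pow, mul_pow, mul_pow]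
      have : x ^ (N + 2) ≤ x ^ N := pow_le_pow_of_le_one hx0 hx1 (by omega)
      gcongr)
  rw [Real.norm_eq_abs] at h
  apply h.trans
  rw [integral_const_mul, integral_add ((mom_int m s N).const_mul _) ((mom_int m s (N + 2)).const_mul _),
    integral_const_mul, integral_const_mul]
  unfold mom
  apply le_of_eq
  ring


/-! ### Part E3 : scalar and polynomial estimates -/

lemma xlogx_diff {r1 r : ℝ} (h1 : 0 ≤ r1) (h : r1 ≤ r) :
    |(r * Real.log r - r + 1) - (r1 * Real.log r1 - r1 + 1)| ≤ (r - r1) * (|Real.log r| + 1) := by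
  rcases h1.eq_or_lt with h0 | h0
  · subst h0
    have e : (r * Real.log r - r + 1) - (0 * Real.log 0 - 0 + 1) = r * (Real.log r - 1) := by ring
    rw [e, abs_mul, abs_of_nonneg h, sub_zero]
    apply mul_le_mul_of_nonneg_left _ h
    have := abs_sub (Real.log r) 1
    rwa [abs_one] at this
  · have hr : 0 < r := lt_of_lt_of_le h0 h
    have l1 : Real.log r1 ≤ Real.log r := Real.log_le_log h0 h
    have l2 : r1 * (Real.log r - Real.log r1) ≤ r - r1 := by
      rw [← Real.log_div hr.ne' h0.ne']
      have := Real.log_le_sub_one_of_pos (div_pos hr h0)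
      calc r1 * Real.log (r / r1) ≤ r1 * (r / r1 - 1) := by gcongr
        _ = r - r1 := by field_simp
    have l3 : 0 ≤ r1 * (Real.log r - Real.log r1) := mul_nonneg h1 (by linarith)
    have e : (r * Real.log r - r + 1) - (r1 * Real.log r1 - r1 + 1) =
      (r - r1) * Real.log r + (r1 * (Real.log r - Real.log r1) - (r - r1)) := by ring
    rw [e]
    have a1 : |r1 * (Real.log r - Real.log r1) - (r - r1)| ≤ r - r1 := by
      rw [abs_le]; constructor <;> linarith
    have a2 : |(r - r1) * Real.log r| = (r - r1) * |Real.log r| := by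
      rw [abs_mul, abs_of_nonneg (by linarith)]
    have := abs_add_le ((r - r1) * Real.log r) (r1 * (Real.log r - Real.log r1) - (r - r1))
    linarith

lemma poly_lip (p : Polynomial ℝ) : ∃ (C : ℝ) (D : ℕ), 0 ≤ C ∧ ∀ u v : ℝ,
    |p.eval u - p.eval v| ≤ C * |u - v| * (1 + |u| + |v|) ^ D := by
  induction p using Polynomial.induction_on' with
  | add p q hp hq =>
    obtain ⟨C1, D1, h1, hp⟩ := hp
    obtain ⟨C2, D2, h2, hq⟩ := hq
    refine ⟨C1 + C2, D1 + D2, by positivity, fun u v => ?_⟩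
    rw [Polynomial.eval_add, Polynomial.eval_add]
    have e : p.eval u + q.eval u - (p.eval v + q.eval v) =
      (p.eval u - p.eval v) + (q.eval u - q.eval v) := by ring
    rw [e]
    apply (abs_add_le _ _).trans
    have hb : 1 ≤ 1 + |u| + |v| := by linarith [abs_nonneg u, abs_nonneg v]
    have b1 : (1 + |u| + |v|) ^ D1 ≤ (1 + |u| + |v|) ^ (D1 + D2) := pow_le_pow_right₀ hb (by omega)
    have b2 : (1 + |u| + |v|) ^ D2 ≤ (1 + |u| + |v|) ^ (D1 + D2) := pow_le_pow_right₀ hb (by omega)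
    calc _ ≤ C1 * |u - v| * (1 + |u| + |v|) ^ D1 + C2 * |u - v| * (1 + |u| + |v|) ^ D2 :=
          add_le_add (hp u v) (hq u v)
      _ ≤ C1 * |u - v| * (1 + |u| + |v|) ^ (D1 + D2) + C2 * |u - v| * (1 + |u| + |v|) ^ (D1 + D2) := by
          gcongr
      _ = _ := by ring
  | monomial n a =>
    refine ⟨|a| * n, n - 1, by positivity, fun u v => ?_⟩
    rw [Polynomial.eval_monomial, Polynomial.eval_monomial, ← mul_sub, abs_mul]
    have h1 := abs_pow_sub_pow_le u v n
    have h2 : max |u| |v| ≤ 1 + |u| + |v| :=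
      max_le (by linarith [abs_nonneg v]) (by linarith [abs_nonneg u])
    calc _ ≤ |a| * (|u - v| * n * max |u| |v| ^ (n - 1)) := by gcongr
      _ ≤ |a| * (|u - v| * n * (1 + |u| + |v|) ^ (n - 1)) := by gcongr
      _ = _ := by ring

lemma poly_growth (p : Polynomial ℝ) : ∃ (C : ℝ) (D : ℕ), 0 ≤ C ∧ ∀ u : ℝ,
    |p.eval u| ≤ C * (1 + |u|) ^ D := by
  obtain ⟨C, D, hC, h⟩ := poly_lip p
  refine ⟨C + |p.eval 0|, D + 1, by positivity, fun u => ?_⟩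
  have h1 := h u 0
  rw [sub_zero, abs_zero, add_zero] at h1
  have h2 := abs_sub_abs_le_abs_sub (p.eval u) (p.eval 0)
  have hb : 1 ≤ 1 + |u| := by linarith [abs_nonneg u]
  have b1 : 1 ≤ (1 + |u|) ^ (D + 1) := one_le_pow₀ hb
  have b2 : |u| * (1 + |u|) ^ D ≤ (1 + |u|) ^ (D + 1) := by
    rw [pow_succ, mul_comm]; gcongr; linarith
  have b3 := mul_le_mul_of_nonneg_left b2 hC
  have b4 := mul_le_mul_of_nonneg_left b1 (abs_nonneg (p.eval 0))
  linarith

lemma f_approx (n : ℕ) : ∃ (S : Polynomial ℝ) (C : ℝ) (D : ℕ), 0 ≤ C ∧ ∀ u : ℝ, -1 ≤ u →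
    |(1 + u) * Real.log (1 + u) - u - S.eval u| ≤ C * |u| ^ n * (1 + |u|) ^ D := by
  set L : Polynomial ℝ := - ∑ i ∈ Finset.range n, Polynomial.C (((i:ℝ) + 1)⁻¹) * (-Polynomial.X) ^ (i + 1)
    with hL
  set S : Polynomial ℝ := (1 + Polynomial.X) * L - Polynomial.X with hS
  have hLe : ∀ u : ℝ, L.eval u = - ∑ i ∈ Finset.range n, (-u) ^ (i + 1) / ((i:ℝ) + 1) := by
    intro u
    simp only [hL, Polynomial.eval_neg, Polynomial.eval_finsetSum, Polynomial.eval_mul,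
      Polynomial.eval_C, Polynomial.eval_pow, Polynomial.eval_X]
    congr 1
    apply Finset.sum_congr rfl
    intro i _
    rw [div_eq_inv_mul]
  have hSe : ∀ u : ℝ, S.eval u = (1 + u) * L.eval u - u := by intro u; simp [hS]
  obtain ⟨C, D, hC, hg⟩ := poly_growth S
  refine ⟨S, 3 + 2 ^ n * (1 + C), D + 2, by positivity, fun u hu => ?_⟩
  have hb : 1 ≤ 1 + |u| := by linarith [abs_nonneg u]
  rcases le_or_gt |u| (1 / 2) with h | h
  · have h1 := Real.abs_log_sub_add_sum_range_le (x := -u) (by rw [abs_neg]; linarith) n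
    rw [sub_neg_eq_add, abs_neg] at h1
    have h2 : |Real.log (1 + u) - L.eval u| ≤ 2 * |u| ^ n := by
      rw [hLe]
      have e : Real.log (1 + u) - -∑ i ∈ Finset.range n, (-u) ^ (i + 1) / ((i:ℝ) + 1) =
        (∑ i ∈ Finset.range n, (-u) ^ (i + 1) / ((i:ℝ) + 1)) + Real.log (1 + u) := by ring
      rw [e]
      apply h1.trans
      rw [div_le_iff₀ (by linarith), pow_succ]
      have : 0 ≤ |u| ^ n := by positivity
      have h3 := mul_le_mul_of_nonneg_left h this
      have h4 := mul_le_mul_of_nonneg_left (by linarith : (1:ℝ) ≤ 2 * (1 - |u|)) this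
      linarith
    have e : (1 + u) * Real.log (1 + u) - u - S.eval u = (1 + u) * (Real.log (1 + u) - L.eval u) := by
      rw [hSe]; ring
    rw [e, abs_mul, abs_of_nonneg (by linarith)]
    have hu2 : 1 + u ≤ 3 / 2 := by linarith [le_abs_self u]
    have b1 : 1 ≤ (1 + |u|) ^ (D + 2) := one_le_pow₀ hb
    calc (1 + u) * |Real.log (1 + u) - L.eval u| ≤ 3 / 2 * (2 * |u| ^ n) := by
          gcongr
      _ = 3 * |u| ^ n * 1 := by ring
      _ ≤ (3 + 2 ^ n * (1 + C)) * |u| ^ n * (1 + |u|) ^ (D + 2) := by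
          gcongr
          have : 0 ≤ 2 ^ n * (1 + C) := by positivity
          linarith
  · have h0 : |(1 + u) * Real.log (1 + u) - u| ≤ u ^ 2 := by
      rcases hu.eq_or_lt with h' | h'
      · rw [← h']; norm_num
      · have hp : 0 < 1 + u := by linarith
        have l1 := Real.log_le_sub_one_of_pos hp
        have l2 := Real.one_sub_inv_le_log_of_pos hp
        have l3 : (1 + u) * Real.log (1 + u) ≤ (1 + u) * (1 + u - 1) := by gcongr
        have l4 : (1 + u) * (1 - (1 + u)⁻¹) ≤ (1 + u) * Real.log (1 + u) := by gcongr
        have l5 : (1 + u) * (1 - (1 + u)⁻¹) = u := by field_simp; ring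
        rw [abs_le]
        constructor
        · nlinarith
        · nlinarith
    have h1 : 1 ≤ 2 ^ n * |u| ^ n := by
      rw [← mul_pow]; exact one_le_pow₀ (by linarith)
    have h2 : u ^ 2 ≤ (1 + |u|) ^ (D + 2) := by
      calc u ^ 2 = |u| ^ 2 := (sq_abs u).symm
        _ ≤ (1 + |u|) ^ 2 := by gcongr; linarith
        _ ≤ _ := pow_le_pow_right₀ hb (by omega)
    have h3 : (1 + |u|) ^ D ≤ (1 + |u|) ^ (D + 2) := pow_le_pow_right₀ hb (by omega)
    have h4 := abs_sub ((1 + u) * Real.log (1 + u) - u) (S.eval u)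
    have hP : 0 ≤ (1 + |u|) ^ (D + 2) := by positivity
    calc _ ≤ u ^ 2 + C * (1 + |u|) ^ D := by linarith [hg u]
      _ ≤ 1 * ((1 + C) * (1 + |u|) ^ (D + 2)) := by
          have := mul_le_mul_of_nonneg_left h3 hC
          linarith
      _ ≤ (2 ^ n * |u| ^ n) * ((1 + C) * (1 + |u|) ^ (D + 2)) := by gcongr
      _ = (2 ^ n * (1 + C)) * |u| ^ n * (1 + |u|) ^ (D + 2) := by ring
      _ ≤ _ := by gcongr; linarith


/-! ### Part E4 : bivariate polynomial functions -/

/-- bivariate polynomial functions -/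
inductive BP : (ℝ → ℝ → ℝ) → Prop
  | mono (a : ℝ) (i j : ℕ) : BP (fun x y => a * x ^ i * y ^ j)
  | add {f g : ℝ → ℝ → ℝ} (hf : BP f) (hg : BP g) : BP (fun x y => f x y + g x y)

lemma BP.of_eq {f g : ℝ → ℝ → ℝ} (hf : BP f) (h : ∀ x y, f x y = g x y) : BP g := by
  have : f = g := by funext x y; exact h x y
  rwa [← this]

lemma BP.mul {f g : ℝ → ℝ → ℝ} (hf : BP f) (hg : BP g) : BP (fun x y => f x y * g x y) := by
  induction hf with
  | mono a i j =>
    induction hg with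
    | mono a' i' j' => exact (BP.mono (a * a') (i + i') (j + j')).of_eq fun x y => by ring
    | add h1 h2 ih1 ih2 => exact (BP.add ih1 ih2).of_eq fun x y => by ring
  | add h1 h2 ih1 ih2 => exact (BP.add ih1 ih2).of_eq fun x y => by ring

lemma BP.const (a : ℝ) : BP (fun _ _ => a) := (BP.mono a 0 0).of_eq fun x y => by simp

lemma BP.pow {f : ℝ → ℝ → ℝ} (hf : BP f) (n : ℕ) : BP (fun x y => f x y ^ n) := by
  induction n with
  | zero => exact (BP.const 1).of_eq fun x y => by simp
  | succ n ih => exact (ih.mul hf).of_eq fun x y => by rw [pow_succ]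

lemma BP.poly {f : ℝ → ℝ → ℝ} (hf : BP f) (p : Polynomial ℝ) : BP (fun x y => p.eval (f x y)) := by
  induction p using Polynomial.induction_on' with
  | add p q hp hq => exact (hp.add hq).of_eq fun x y => by simp
  | monomial n a => exact ((BP.const a).mul (hf.pow n)).of_eq fun x y => by simp

lemma BP.gam {f : ℝ → ℝ → ℝ} (hf : BP f) (m s : ℝ) : ∃ f', BP f' ∧ ∀ x y,
    Integrable (fun g => f (x * Real.exp (2 * g)) y) (gam m s) ∧
      ∫ g, f (x * Real.exp (2 * g)) y ∂(gam m s) = f' x y := by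
  induction hf with
  | mono a i j =>
    refine ⟨_, BP.mono (a * mom m s i) i j, fun x y => ?_⟩
    have e : (fun g => a * (x * Real.exp (2 * g)) ^ i * y ^ j) =
        fun g => (a * x ^ i * y ^ j) * Real.exp (2 * g) ^ i := by funext g; rw [mul_pow]; ring
    rw [e]
    refine ⟨(mom_int m s i).const_mul _, ?_⟩
    rw [integral_const_mul]; unfold mom; ring
  | add h1 h2 ih1 ih2 =>
    obtain ⟨f1, hf1, h1⟩ := ih1
    obtain ⟨f2, hf2, h2⟩ := ih2
    refine ⟨_, hf1.add hf2, fun x y => ⟨(h1 x y).1.add (h2 x y).1, ?_⟩⟩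
    rw [integral_add (h1 x y).1 (h2 x y).1, (h1 x y).2, (h2 x y).2]

lemma ph_pow_int {sg : ℝ} (hsg : 0 < sg) (j : ℕ) : Integrable (fun y => ph sg y * y ^ j) := by
  apply Integrable.mono' (ph_exp_int hsg j)
  · exact ((ph_cont sg).mul (by fun_prop)).aestronglyMeasurable
  · filter_upwards with y
    rw [norm_mul, Real.norm_of_nonneg (ph_nonneg _ _)]
    apply mul_le_mul_of_nonneg_left _ (ph_nonneg _ _)
    rw [norm_pow, Real.norm_eq_abs, Real.exp_nat_mul]
    have := Real.add_one_le_exp |y|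
    gcongr; linarith

lemma BP.ph {f : ℝ → ℝ → ℝ} (hf : BP f) {sg : ℝ} (hsg : 0 < sg) : ∃ p : Polynomial ℝ, ∀ x,
    Integrable (fun y => ph sg y * f x y) ∧ ∫ y, ph sg y * f x y = p.eval x := by
  induction hf with
  | mono a i j =>
    refine ⟨Polynomial.monomial i (a * ∫ y, _root_.ph sg y * y ^ j), fun x => ?_⟩
    have e : (fun y => _root_.ph sg y * (a * x ^ i * y ^ j)) =
        fun y => (a * x ^ i) * (_root_.ph sg y * y ^ j) := by funext g; ring
    rw [e]
    refine ⟨(ph_pow_int hsg j).const_mul _, ?_⟩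
    rw [integral_const_mul, Polynomial.eval_monomial]; ring
  | add h1 h2 ih1 ih2 =>
    obtain ⟨f1, h1⟩ := ih1
    obtain ⟨f2, h2⟩ := ih2
    simp only [mul_add]
    refine ⟨f1 + f2, fun x => ⟨(h1 x).1.add (h2 x).1, ?_⟩⟩
    rw [integral_add (h1 x).1 (h2 x).1, (h1 x).2, (h2 x).2, Polynomial.eval_add]

/-- exponent of the likelihood ratio -/
def tw (K sg z y : ℝ) : ℝ := K * z * y / sg ^ 2 - (K * z) ^ 2 / (2 * sg ^ 2)

/-- truncated exponential -/
def Tp (M : ℕ) : Polynomial ℝ := ∑ j ∈ Finset.range M, Polynomial.monomial j ((j.factorial : ℝ)⁻¹)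

lemma Tp_eval (M : ℕ) (t : ℝ) : (Tp M).eval t = ∑ j ∈ Finset.range M, t ^ j / j.factorial := by
  unfold Tp
  rw [Polynomial.eval_finsetSum]
  apply Finset.sum_congr rfl
  intro j _
  rw [Polynomial.eval_monomial]; ring

lemma Tp_exp (M : ℕ) (t : ℝ) : |Real.exp t - (Tp M).eval t| ≤ |t| ^ M * Real.exp |t| := by
  have := Complex.norm_exp_sub_sum_le_norm_mul_exp (t : ℂ) M
  rw [Tp_eval, ← Real.norm_eq_abs, ← Complex.norm_real]
  push_cast
  simpa using this

lemma Tp_le (M : ℕ) (t : ℝ) : |(Tp M).eval t| ≤ M * (1 + |t|) ^ M := by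
  rw [Tp_eval]
  refine (Finset.abs_sum_le_sum_abs _ _).trans ?_
  have : ∀ j ∈ Finset.range M, |t ^ j / (j.factorial : ℝ)| ≤ (1 + |t|) ^ M := by
    intro j hj
    have hj' := Finset.mem_range.1 hj
    rw [abs_div, abs_pow, Nat.abs_cast]
    have h1 : |t| ^ j / (j.factorial : ℝ) ≤ |t| ^ j := by
      apply div_le_self (by positivity)
      exact_mod_cast Nat.one_le_iff_ne_zero.2 (Nat.factorial_ne_zero j)
    have h2 : |t| ^ j ≤ (1 + |t|) ^ j := by gcongr; linarith
    have h3 : (1 + |t|) ^ j ≤ (1 + |t|) ^ M :=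
      pow_le_pow_right₀ (by linarith [abs_nonneg t]) hj'.le
    linarith
  refine (Finset.sum_le_sum this).trans ?_
  simp

lemma tw_BP (K sg : ℝ) : BP (tw K sg) := by
  have h1 := BP.mono (K / sg ^ 2) 1 1
  have h2 := BP.mono (-(K ^ 2 / (2 * sg ^ 2))) 2 0
  refine (h1.add h2).of_eq fun x y => ?_
  unfold tw; ring

lemma tw_bound {K sg : ℝ} (hK : 0 < K) (hsg : 0 < sg) {z q : ℝ} (y : ℝ) (hz : 0 ≤ z) (hzq : z ≤ q)
    (hzq2 : z ^ 2 ≤ q) : |tw K sg z y| ≤ q * ((K + K ^ 2) / sg ^ 2) * (1 + |y|) := by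
  unfold tw
  have hq : 0 ≤ q := hz.trans hzq
  have h1 : |K * z * y / sg ^ 2| ≤ q * (K / sg ^ 2) * |y| := by
    rw [abs_div, abs_mul, abs_of_nonneg (by positivity : 0 ≤ K * z), abs_of_pos (by positivity : 0 < sg ^ 2)]
    have : K * z * |y| / sg ^ 2 = z * (K / sg ^ 2) * |y| := by ring
    rw [this]; gcongr
  have h2 : |(K * z) ^ 2 / (2 * sg ^ 2)| ≤ q * (K ^ 2 / sg ^ 2) := by
    rw [abs_of_nonneg (by positivity)]
    have : (K * z) ^ 2 / (2 * sg ^ 2) = z ^ 2 * (K ^ 2 / sg ^ 2) / 2 := by field_simp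
    rw [this]
    have : z ^ 2 * (K ^ 2 / sg ^ 2) ≤ q * (K ^ 2 / sg ^ 2) := by gcongr
    have : 0 ≤ z ^ 2 * (K ^ 2 / sg ^ 2) := by positivity
    linarith
  have h3 := abs_sub (K * z * y / sg ^ 2) ((K * z) ^ 2 / (2 * sg ^ 2))
  have e : q * ((K + K ^ 2) / sg ^ 2) * (1 + |y|) = q * (K / sg ^ 2) * |y| + q * (K ^ 2 / sg ^ 2)
      + (q * (K / sg ^ 2) + q * (K ^ 2 / sg ^ 2) * |y|) := by ring
  have : 0 ≤ q * (K / sg ^ 2) + q * (K ^ 2 / sg ^ 2) * |y| := by positivity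
  linarith


/-! ### Part E5 : truncated likelihood ratio -/

/-- likelihood ratio restricted to moderate fading -/
def rho1 (K m s sg x y : ℝ) : ℝ :=
  ∫ g, Set.indicator {g : ℝ | √x * Real.exp (2 * g) ≤ 1}
    (fun g => Real.exp (tw K sg (x * Real.exp (2 * g)) y)) g ∂(gam m s)

lemma J_meas (x : ℝ) : MeasurableSet {g : ℝ | √x * Real.exp (2 * g) ≤ 1} :=
  (isClosed_le (by fun_prop) continuous_const).measurableSet

lemma tw_J {K sg : ℝ} (hK : 0 < K) (hsg : 0 < sg) {x H : ℝ} (hx : 0 < x) (hx1 : x ≤ 1) (hH : 0 < H)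
    (hJ : √x * H ≤ 1) (y : ℝ) : |tw K sg (x * H) y| ≤ √x * ((K + K ^ 2) / sg ^ 2) * (1 + |y|) := by
  have hr : 0 < √x := Real.sqrt_pos.2 hx
  have hr1 : √x ≤ 1 := Real.sqrt_le_one.2 hx1
  have hz : x * H ≤ √x := by
    have : x * H = √x * (√x * H) := by rw [← mul_assoc, Real.mul_self_sqrt hx.le]
    rw [this]; exact mul_le_of_le_one_right hr.le hJ
  have hz0 : 0 ≤ x * H := by positivity
  refine tw_bound hK hsg y hz0 hz ?_
  have : (x * H) ^ 2 ≤ √x ^ 2 := by gcongr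
  have : √x ^ 2 ≤ √x := by nlinarith
  linarith

lemma tw_cont (K sg x y : ℝ) : Continuous (fun g : ℝ => tw K sg (x * Real.exp (2 * g)) y) := by
  unfold tw; fun_prop

lemma rho1_int {K m s sg : ℝ} (hK : 0 < K) (hsg : 0 < sg) {x : ℝ} (hx : 0 < x) (hx1 : x ≤ 1) (y : ℝ) :
    Integrable (Set.indicator {g : ℝ | √x * Real.exp (2 * g) ≤ 1}
    (fun g => Real.exp (tw K sg (x * Real.exp (2 * g)) y))) (gam m s) := by
  have hr : 0 < √x := Real.sqrt_pos.2 hx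
  have hr1 : √x ≤ 1 := Real.sqrt_le_one.2 hx1
  apply Integrable.mono' (integrable_const (Real.exp ((K + K ^ 2) / sg ^ 2 * (1 + |y|))))
  · exact ((Real.continuous_exp.comp (tw_cont K sg x y)).measurable.indicator
      (J_meas x)).aestronglyMeasurable
  · filter_upwards with g
    by_cases hg : g ∈ {g : ℝ | √x * Real.exp (2 * g) ≤ 1}
    · rw [Set.indicator_of_mem hg, Real.norm_of_nonneg (Real.exp_pos _).le]
      apply Real.exp_le_exp.2
      have h1 := tw_J hK hsg hx hx1 (Real.exp_pos _) hg y
      have h2 : √x * ((K + K ^ 2) / sg ^ 2) * (1 + |y|) ≤ 1 * ((K + K ^ 2) / sg ^ 2) * (1 + |y|) := by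
        gcongr
      linarith [le_abs_self (tw K sg (x * Real.exp (2 * g)) y)]
    · rw [Set.indicator_of_notMem hg, norm_zero]; positivity

lemma trunc {K m s sg : ℝ} (hK : 0 < K) (hsg : 0 < sg) (M : ℕ) : ∃ C L : ℝ, 0 ≤ C ∧ 0 ≤ L ∧
    ∀ x, 0 < x → x ≤ 1 → ∀ y, |rho1 K m s sg x y -
      ∫ g, (Tp M).eval (tw K sg (x * Real.exp (2 * g)) y) ∂(gam m s)|
      ≤ C * √x ^ M * Real.exp (L * |y|) := by
  set κ := (K + K ^ 2) / sg ^ 2 with hκ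
  have hκ0 : 0 < κ := by positivity
  have hB : BP (fun x _ => (x * (1 + x) ^ 2) ^ M) := by
    have h0 : BP (fun x _ => x) := (BP.mono 1 1 0).of_eq fun x y => by ring
    exact (h0.mul (((BP.const 1).add h0).pow 2)).pow M
  obtain ⟨_, _, hBi⟩ := hB.gam m s
  have hmi := (hBi 1 0).1
  simp only [one_mul] at hmi
  set I := ∫ g, (Real.exp (2 * g) * (1 + Real.exp (2 * g)) ^ 2) ^ M ∂(gam m s) with hI
  have hI0 : 0 ≤ I := integral_nonneg fun g => by positivity
  obtain ⟨_, _, hTi⟩ := ((tw_BP K sg).poly (Tp M)).gam m s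
  refine ⟨κ ^ M * Real.exp κ + M * (1 + κ) ^ M * I, κ + M, by positivity, by positivity, ?_⟩
  intro x hx hx1 y
  have hr : 0 < √x := Real.sqrt_pos.2 hx
  have hr1 : √x ≤ 1 := Real.sqrt_le_one.2 hx1
  have ha : 0 ≤ |y| := abs_nonneg y
  have hpt : ∀ g, ‖Set.indicator {g : ℝ | √x * Real.exp (2 * g) ≤ 1}
      (fun g => Real.exp (tw K sg (x * Real.exp (2 * g)) y)) g -
      (Tp M).eval (tw K sg (x * Real.exp (2 * g)) y)‖ ≤
      √x ^ M * ((κ * (1 + |y|)) ^ M * Real.exp (κ * (1 + |y|))) +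
      (√x ^ M * (M * ((1 + κ) * (1 + |y|)) ^ M)) *
        (Real.exp (2 * g) * (1 + Real.exp (2 * g)) ^ 2) ^ M := by
    intro g
    rw [Real.norm_eq_abs]
    set H := Real.exp (2 * g) with hH
    have hH0 : 0 < H := Real.exp_pos _
    by_cases hg : g ∈ {g : ℝ | √x * Real.exp (2 * g) ≤ 1}
    · rw [Set.indicator_of_mem hg]
      have h1 := tw_J hK hsg hx hx1 hH0 hg y
      rw [← hκ] at h1
      refine (Tp_exp M _).trans ?_
      have h2 : |tw K sg (x * H) y| ^ M ≤ √x ^ M * (κ * (1 + |y|)) ^ M := by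
        rw [← mul_pow]
        apply pow_le_pow_left₀ (abs_nonneg _)
        linarith
      have h3 : Real.exp |tw K sg (x * H) y| ≤ Real.exp (κ * (1 + |y|)) := by
        apply Real.exp_le_exp.2
        have h2 : √x * κ * (1 + |y|) ≤ 1 * κ * (1 + |y|) := by gcongr
        linarith
      have h4 : |tw K sg (x * H) y| ^ M * Real.exp |tw K sg (x * H) y| ≤
          (√x ^ M * (κ * (1 + |y|)) ^ M) * Real.exp (κ * (1 + |y|)) := by gcongr
      have h5 : 0 ≤ (√x ^ M * (M * ((1 + κ) * (1 + |y|)) ^ M)) * (H * (1 + H) ^ 2) ^ M := by positivity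
      linarith
    · rw [Set.indicator_of_notMem hg, zero_sub, abs_neg]
      have hg' : 1 < √x * H := by simpa using hg
      have h1 := tw_bound (z := x * H) (q := (1 + H) ^ 2) hK hsg y (by positivity)
        (by nlinarith) (by
          have : x * H ≤ 1 * H := by gcongr
          have : (x * H) ^ 2 ≤ (1 + H) ^ 2 := by gcongr; linarith
          linarith)
      rw [← hκ] at h1
      refine (Tp_le M _).trans ?_
      have h2 : 1 + |tw K sg (x * H) y| ≤ (1 + κ) * (1 + |y|) * (1 + H) ^ 2 := by
        have : 1 * 1 ≤ (1 + |y|) * (1 + H) ^ 2 := by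
          apply mul_le_mul (by linarith) _ (by norm_num) (by linarith)
          nlinarith
        nlinarith
      have h3 : (1 + |tw K sg (x * H) y|) ^ M ≤ ((1 + κ) * (1 + |y|) * (1 + H) ^ 2) ^ M := by gcongr
      have h4 : 1 ≤ (√x * H) ^ M := one_le_pow₀ hg'.le
      have h5 : (M:ℝ) * (1 + |tw K sg (x * H) y|) ^ M ≤
          (M * ((1 + κ) * (1 + |y|) * (1 + H) ^ 2) ^ M) * (√x * H) ^ M := by
        calc (M:ℝ) * (1 + |tw K sg (x * H) y|) ^ M ≤
            (M * ((1 + κ) * (1 + |y|) * (1 + H) ^ 2) ^ M) * 1 := by rw [mul_one]; gcongr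
          _ ≤ _ := by gcongr
      have h6 : 0 ≤ √x ^ M * ((κ * (1 + |y|)) ^ M * Real.exp (κ * (1 + |y|))) := by positivity
      have h7 : (M * ((1 + κ) * (1 + |y|) * (1 + H) ^ 2) ^ M) * (√x * H) ^ M =
        (√x ^ M * (M * ((1 + κ) * (1 + |y|)) ^ M)) * (H * (1 + H) ^ 2) ^ M := by
        simp only [mul_pow]; ring
      linarith
  unfold rho1
  rw [← integral_sub (rho1_int hK hsg hx hx1 y) (hTi x y).1, ← Real.norm_eq_abs]
  refine (norm_integral_le_of_norm_le ((integrable_const _).add (hmi.const_mul _))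
    (Filter.Eventually.of_forall hpt)).trans ?_
  rw [integral_add' (integrable_const _) (hmi.const_mul _), integral_const]
  rw [integral_const_mul, ← hI]
  simp only [probReal_univ, one_smul]
  have e1 : Real.exp (κ * (1 + |y|)) = Real.exp κ * Real.exp (κ * |y|) := by
    rw [← Real.exp_add]; ring_nf
  have e2 : Real.exp ((κ + M) * |y|) = Real.exp (κ * |y|) * Real.exp |y| ^ M := by
    rw [← Real.exp_nat_mul, ← Real.exp_add]; ring_nf
  have e3 : (1 + |y|) ^ M ≤ Real.exp |y| ^ M := by
    have := Real.add_one_le_exp |y|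
    gcongr; linarith
  have e4 : 1 ≤ Real.exp (κ * |y|) := Real.one_le_exp (by positivity)
  rw [e1, e2, mul_pow, mul_pow]
  have h1 : √x ^ M * (κ ^ M * (1 + |y|) ^ M * (Real.exp κ * Real.exp (κ * |y|))) ≤
     √x ^ M * (κ ^ M * Real.exp |y| ^ M * (Real.exp κ * Real.exp (κ * |y|))) := by gcongr
  have h2 : √x ^ M * (M * ((1 + κ) ^ M * (1 + |y|) ^ M)) * I * 1 ≤
     √x ^ M * (M * ((1 + κ) ^ M * Real.exp |y| ^ M)) * I * Real.exp (κ * |y|) := by gcongr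
  linarith

lemma pd_rho {K m s sg : ℝ} (hsg : 0 < sg) (x y : ℝ) : pd K m s sg x y =
    ph sg y * ∫ g, Real.exp (tw K sg (x * Real.exp (2 * g)) y) ∂(gam m s) := by
  unfold pd
  rw [← integral_const_mul]
  congr 1; funext g
  rw [ph_shift hsg]; unfold tw; rw [mul_assoc K]

lemma rho_int {K m s sg : ℝ} (hsg : 0 < sg) (x y : ℝ) :
    Integrable (fun g => Real.exp (tw K sg (x * Real.exp (2 * g)) y)) (gam m s) := by
  refine ((pd_integrable K m s sg x y).const_mul (ph sg y)⁻¹).congr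
    (Filter.Eventually.of_forall fun g => ?_)
  simp only
  have := (ph_pos hsg y).ne'
  rw [ph_shift hsg]; unfold tw; rw [mul_assoc K]; field_simp

/-- Gaussian tilt -/
lemma tilt {K m s sg : ℝ} (hs : 0 < s) (M : ℕ) (x y : ℝ) :
    ∫ g, Real.exp (2 * g) ^ M * ph sg (y - K * x * Real.exp (2 * g)) ∂(gam m s) =
    Real.exp (2 * M * m + 2 * M ^ 2 * s ^ 2) * pd K (m + 2 * M * s ^ 2) s sg x y := by
  unfold pd
  rw [integral_gam hs, integral_gam hs, mul_left_comm]
  congr 1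
  rw [← integral_const_mul]
  congr 1; funext g
  have e : Real.exp (2 * g) ^ M * Real.exp (-(g - m) ^ 2 / (2 * s ^ 2)) =
    Real.exp (2 * M * m + 2 * M ^ 2 * s ^ 2) * Real.exp (-(g - (m + 2 * M * s ^ 2)) ^ 2 / (2 * s ^ 2)) := by
    rw [← Real.exp_nat_mul, ← Real.exp_add, ← Real.exp_add]
    congr 1; field_simp; ring
  calc _ = (Real.exp (2 * g) ^ M * Real.exp (-(g - m) ^ 2 / (2 * s ^ 2))) *
        ph sg (y - K * x * Real.exp (2 * g)) := by ring
    _ = _ := by rw [e]; ring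

lemma tail_bound {K m s sg : ℝ} (hK : 0 < K) (hs : 0 < s) (hsg : 0 < sg) (M : ℕ) {x : ℝ} (hx : 0 < x)
    (hx1 : x ≤ 1) (y : ℝ) :
    rho1 K m s sg x y ≤ (∫ g, Real.exp (tw K sg (x * Real.exp (2 * g)) y) ∂(gam m s)) ∧
    ph sg y * ((∫ g, Real.exp (tw K sg (x * Real.exp (2 * g)) y) ∂(gam m s)) - rho1 K m s sg x y) ≤
    √x ^ M * (Real.exp (2 * M * m + 2 * M ^ 2 * s ^ 2) * pd K (m + 2 * M * s ^ 2) s sg x y) := by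
  have hr : 0 < √x := Real.sqrt_pos.2 hx
  constructor
  · apply integral_mono (rho1_int hK hsg hx hx1 y) (rho_int hsg x y)
    exact Set.indicator_le_self' (fun g _ => (Real.exp_pos _).le)
  · unfold rho1
    rw [← integral_sub (rho_int hsg x y) (rho1_int hK hsg hx hx1 y), ← tilt hs, ← integral_const_mul,
      ← integral_const_mul]
    apply integral_mono_of_nonneg
    · filter_upwards with g
      apply mul_nonneg (ph_nonneg _ _)
      rw [sub_nonneg]
      exact Set.indicator_le_self' (fun g _ => (Real.exp_pos _).le) g
    · apply Integrable.const_mul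
      apply Integrable.mono' ((mom_int m s M).mul_const (ph sg 0))
      · exact ((by fun_prop : Continuous fun g : ℝ => Real.exp (2 * g) ^ M).mul
          ((ph_cont sg).comp (by fun_prop))).aestronglyMeasurable
      · filter_upwards with g
        rw [Real.norm_of_nonneg (mul_nonneg (by positivity) (ph_nonneg _ _))]
        exact mul_le_mul_of_nonneg_left (ph_le _ _) (by positivity)
    · filter_upwards with g
      have e : ph sg (y - K * x * Real.exp (2 * g)) =
          ph sg y * Real.exp (tw K sg (x * Real.exp (2 * g)) y) := by
        rw [ph_shift hsg]; unfold tw; rw [mul_assoc K]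
      by_cases hg : g ∈ {g : ℝ | √x * Real.exp (2 * g) ≤ 1}
      · rw [Set.indicator_of_mem hg, sub_self, mul_zero]
        exact mul_nonneg (by positivity) (mul_nonneg (by positivity) (ph_nonneg _ _))
      · rw [Set.indicator_of_notMem hg, sub_zero, ← e, ← mul_assoc, ← mul_pow]
        have hg' : 1 < √x * Real.exp (2 * g) := by simpa using hg
        exact le_mul_of_one_le_left (ph_nonneg _ _) (one_le_pow₀ hg'.le)


/-! ### Part E6 : expansion of the first part of the information density -/

lemma log_ph_bound {sg : ℝ} (hsg : 0 < sg) :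
    ∃ C : ℝ, 0 < C ∧ ∀ y, |Real.log (ph sg y)| ≤ C * (1 + y ^ 2) := by
  refine ⟨|Real.log (ph sg 0)| + 1 / (2 * sg ^ 2), by positivity, fun y => ?_⟩
  rw [log_ph hsg]
  refine (abs_sub _ _).trans ?_
  rw [abs_of_nonneg (by positivity : 0 ≤ y ^ 2 / (2 * sg ^ 2))]
  have h1 : 0 ≤ |Real.log (ph sg 0)| * y ^ 2 := by positivity
  have h2 : 0 ≤ 1 / (2 * sg ^ 2) := by positivity
  have h3 : y ^ 2 / (2 * sg ^ 2) = 1 / (2 * sg ^ 2) * y ^ 2 := by ring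
  rw [h3]
  linarith

lemma ph_even (sg y : ℝ) : ph sg (-y) = ph sg y := by unfold ph; rw [neg_sq]

lemma W_rw {K m s sg : ℝ} (hK : 0 < K) (hs : 0 < s) (hsg : 0 < sg) (x : ℝ) :
    Integrable (fun y => pd K m s sg x y * (Real.log (pd K m s sg x y) - Real.log (ph sg y))
      - pd K m s sg x y + ph sg y) ∧
    ∫ y, pd K m s sg x y * (Real.log (pd K m s sg x y) - Real.log (ph sg y)) =
    ∫ y, (pd K m s sg x y * (Real.log (pd K m s sg x y) - Real.log (ph sg y))
      - pd K m s sg x y + ph sg y) := by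
  obtain ⟨C1, hC1, h1⟩ := log_ph_bound hsg
  obtain ⟨C2, hC2, h2⟩ := log_pd_bound (m := m) hK hs hsg |x| (abs_nonneg x)
  have i1 : Integrable (fun y => pd K m s sg x y *
      (Real.log (pd K m s sg x y) - Real.log (ph sg y))) := by
    apply pd_mul_integrable hsg x (C := C2 + C1)
    · exact ((Real.measurable_log.comp (pd_cont_y K m s sg x).measurable).sub
        (Real.measurable_log.comp (ph_cont sg).measurable))
    · intro y
      refine (abs_sub _ _).trans ?_
      linarith [h1 y, h2 x y le_rfl]
  have i2 := pd_integrable_y (K := K) (m := m) (s := s) hsg x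
  have i3 : Integrable (ph sg) := ph_int
  have i12 : Integrable (fun y => pd K m s sg x y *
      (Real.log (pd K m s sg x y) - Real.log (ph sg y)) - pd K m s sg x y) := i1.sub i2
  refine ⟨i12.add i3, ?_⟩
  rw [integral_add i12 i3, integral_sub i1 i2, pd_integral_y hsg, ph_total hsg]
  ring

lemma W_exp {K m s sg : ℝ} (hK : 0 < K) (hs : 0 < s) (hsg : 0 < sg) (N : ℕ) :
    ∃ q : Polynomial ℝ, (∀ x, q.eval (-x) = q.eval x) ∧ ∃ B : ℝ, ∀ x, 0 < x → x ≤ 1 →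
      |(∫ y, pd K m s sg x y * (Real.log (pd K m s sg x y) - Real.log (ph sg y))) - q.eval x|
        ≤ B * x ^ N := by
  obtain ⟨C1, L1, hC1, hL1, ht1⟩ := trunc (m := m) (s := s) hK hsg 1
  obtain ⟨C2, L2, hC2, hL2, ht2⟩ := trunc (m := m) (s := s) hK hsg (2 * N)
  obtain ⟨S, C3, D3, hC3, hS⟩ := f_approx (2 * N)
  obtain ⟨C4, D4, hC4, hlip⟩ := poly_lip S
  obtain ⟨C5, hC5, hlpd⟩ := log_pd_bound (m := m) hK hs hsg 1 zero_le_one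
  obtain ⟨C6, hC6, hlph⟩ := log_ph_bound hsg
  obtain ⟨C7, hmom⟩ := mom2_le (K := K) (m := m + 2 * ((2 * N : ℕ) : ℝ) * s ^ 2) (s := s) hsg 1
  obtain ⟨f', hf', hfi⟩ := ((tw_BP K sg).poly (Tp (2 * N))).gam m s
  obtain ⟨q, hq⟩ := ((hf'.add (BP.const (-1))).poly S).ph hsg
  refine ⟨q, ?_, ?_⟩
  · intro x
    rw [← (hq x).2, ← (hq (-x)).2, ← integral_neg_eq_self]
    congr 1; funext y
    have : f' (-x) (-y) = f' x y := by
      rw [← (hfi x y).2, ← (hfi (-x) (-y)).2]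
      congr 1; funext g
      have : tw K sg (-x * Real.exp (2 * g)) (-y) = tw K sg (x * Real.exp (2 * g)) y := by
        unfold tw; ring
      rw [this]
    rw [ph_even, this]
  set C := C1 + C2 with hC
  set L := L1 + L2 with hL
  have hC0 : 0 ≤ C := by positivity
  have hL0 : 0 ≤ L := by positivity
  set E0 := Real.exp (2 * ((2 * N : ℕ) : ℝ) * m + 2 * ((2 * N : ℕ) : ℝ) ^ 2 * s ^ 2) with hE0
  set a2 := C3 * (C ^ (2 * N) * (1 + C) ^ D3) with ha2
  set a3 := C4 * (C * (1 + 3 * C) ^ D4) with ha3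
  set l2 := ((2 * N + D3 : ℕ) : ℝ) * L with hl2
  set l3 := ((1 + D4 : ℕ) : ℝ) * L with hl3
  set J2 := ∫ y, ph sg y * Real.exp (l2 * |y|) with hJ2
  set J3 := ∫ y, ph sg y * Real.exp (l3 * |y|) with hJ3
  refine ⟨E0 * (C5 + C6 + 1) * C7 + a2 * J2 + a3 * J3, ?_⟩
  intro x hx hx1
  have hr : 0 < √x := Real.sqrt_pos.2 hx
  have hr1 : √x ≤ 1 := Real.sqrt_le_one.2 hx1
  have hrN : √x ^ (2 * N) = x ^ N := by rw [pow_mul, Real.sq_sqrt hx.le]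
  have hrN1 : √x ^ (2 * N) ≤ 1 := pow_le_one₀ hr.le hr1
  have hrN0 : 0 ≤ √x ^ (2 * N) := by positivity
  obtain ⟨iW, eW⟩ := W_rw (m := m) hK hs hsg x
  rw [eW, ← (hq x).2, ← integral_sub iW (hq x).1, ← Real.norm_eq_abs]
  have hpt : ∀ y, ‖(pd K m s sg x y * (Real.log (pd K m s sg x y) - Real.log (ph sg y))
      - pd K m s sg x y + ph sg y) - ph sg y * S.eval (f' x y + -1)‖ ≤
      √x ^ (2 * N) * ((E0 * (C5 + C6 + 1)) * (pd K (m + 2 * ((2 * N : ℕ) : ℝ) * s ^ 2) s sg x y * (1 + y ^ 2)) +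
        a2 * (ph sg y * Real.exp (l2 * |y|)) + a3 * (ph sg y * Real.exp (l3 * |y|))) := by
    intro y
    set ρ := ∫ g, Real.exp (tw K sg (x * Real.exp (2 * g)) y) ∂(gam m s) with hρ
    set ρ1 := rho1 K m s sg x y with hρ1
    have hpd : pd K m s sg x y = ph sg y * ρ := pd_rho hsg x y
    have hph := ph_pos hsg y
    have hpdp := pd_pos (m := m) hK hs hsg x y
    have hρ0 : 0 < ρ := by
      rw [hpd] at hpdp; exact pos_of_mul_pos_right hpdp hph.le
    have hlog : Real.log (pd K m s sg x y) - Real.log (ph sg y) = Real.log ρ := by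
      rw [hpd, Real.log_mul hph.ne' hρ0.ne']; ring
    have hlogb : |Real.log ρ| + 1 ≤ (C5 + C6 + 1) * (1 + y ^ 2) := by
      rw [← hlog]
      have h1 := abs_sub (Real.log (pd K m s sg x y)) (Real.log (ph sg y))
      have h2 := hlpd x y (by rw [abs_of_pos hx]; exact hx1)
      have h3 := hlph y
      linarith [sq_nonneg y]
    obtain ⟨hle, htail⟩ := tail_bound (m := m) hK hs hsg (2 * N) hx hx1 y
    rw [← hρ, ← hρ1] at hle htail
    rw [← hE0] at htail
    have hρ10 : 0 ≤ ρ1 := integral_nonneg fun g => Set.indicator_nonneg (fun g _ => (Real.exp_pos _).le) g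
    set E := Real.exp (L * |y|) with hE
    have hE1 : 1 ≤ E := Real.one_le_exp (by positivity)
    have b1 : |ρ1 - 1| ≤ C * √x * E := by
      have h := ht1 x hx hx1 y
      have e : ∫ g, (Tp 1).eval (tw K sg (x * Real.exp (2 * g)) y) ∂(gam m s) = 1 := by
        simp [Tp_eval]
      rw [e, pow_one] at h
      refine h.trans ?_
      have : Real.exp (L1 * |y|) ≤ E := Real.exp_le_exp.2 (by rw [hL]; gcongr; linarith)
      have : C1 ≤ C := by linarith
      gcongr
    have b2 : |ρ1 - 1 - (f' x y + -1)| ≤ C * √x ^ (2 * N) * E := by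
      have h := ht2 x hx hx1 y
      rw [(hfi x y).2] at h
      have e : ρ1 - 1 - (f' x y + -1) = ρ1 - f' x y := by ring
      rw [e]
      refine h.trans ?_
      have : Real.exp (L2 * |y|) ≤ E := Real.exp_le_exp.2 (by rw [hL]; gcongr; linarith)
      have : C2 ≤ C := by linarith
      gcongr
    set u := ρ1 - 1 with hu
    set v := f' x y + -1 with hv
    have hCE : 0 ≤ C * E := by positivity
    have b1' : |u| ≤ C * E := by
      refine b1.trans ?_
      calc C * √x * E ≤ C * 1 * E := by gcongr
        _ = C * E := by ring
    have b2' : |v| ≤ 2 * (C * E) := by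
      have h1 : C * √x ^ (2 * N) * E ≤ C * 1 * E := by gcongr
      have h2 : |v| ≤ |u| + |u - v| := by
        have := abs_sub u (u - v); rwa [_root_.sub_sub_cancel] at this
      linarith
    have t1 := xlogx_diff hρ10 hle
    have t2 := hS u (by rw [hu]; linarith)
    have t3 := hlip u v
    have e1u : 1 + u = ρ1 := by rw [hu]; ring
    rw [e1u] at t2
    have e2u : ρ1 * Real.log ρ1 - u = ρ1 * Real.log ρ1 - ρ1 + 1 := by rw [hu]; ring
    rw [e2u] at t2
    have t2' : C3 * |u| ^ (2 * N) * (1 + |u|) ^ D3 ≤ √x ^ (2 * N) * (a2 * Real.exp (l2 * |y|)) := by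
      have h1 : |u| ^ (2 * N) ≤ (C * √x * E) ^ (2 * N) := by gcongr
      have h2 : (1 + |u|) ^ D3 ≤ ((1 + C) * E) ^ D3 := by
        gcongr; linarith
      have e : Real.exp (l2 * |y|) = E ^ (2 * N) * E ^ D3 := by
        rw [← pow_add, hE, ← Real.exp_nat_mul, hl2]; ring_nf
      calc C3 * |u| ^ (2 * N) * (1 + |u|) ^ D3 ≤ C3 * (C * √x * E) ^ (2 * N) * ((1 + C) * E) ^ D3 := by
            gcongr
        _ = _ := by rw [e, ha2]; simp only [mul_pow]; ring
    have t3' : C4 * |u - v| * (1 + |u| + |v|) ^ D4 ≤ √x ^ (2 * N) * (a3 * Real.exp (l3 * |y|)) := by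
      have h2 : (1 + |u| + |v|) ^ D4 ≤ ((1 + 3 * C) * E) ^ D4 := by
        gcongr; linarith
      have e : Real.exp (l3 * |y|) = E * E ^ D4 := by
        rw [← pow_succ', hE, ← Real.exp_nat_mul, hl3]; push_cast; ring_nf
      calc C4 * |u - v| * (1 + |u| + |v|) ^ D4 ≤
          C4 * (C * √x ^ (2 * N) * E) * ((1 + 3 * C) * E) ^ D4 := by
            gcongr
        _ = _ := by rw [e, ha3]; simp only [mul_pow]; ring
    have emain : (pd K m s sg x y * (Real.log (pd K m s sg x y) - Real.log (ph sg y))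
      - pd K m s sg x y + ph sg y) - ph sg y * S.eval v =
      ph sg y * ((ρ * Real.log ρ - ρ + 1) - S.eval v) := by
      rw [hlog, hpd]; ring
    rw [emain, norm_mul, Real.norm_of_nonneg hph.le, Real.norm_eq_abs]
    have tri : |(ρ * Real.log ρ - ρ + 1) - S.eval v| ≤ (ρ - ρ1) * (|Real.log ρ| + 1) +
        √x ^ (2 * N) * (a2 * Real.exp (l2 * |y|)) + √x ^ (2 * N) * (a3 * Real.exp (l3 * |y|)) := by
      have e : (ρ * Real.log ρ - ρ + 1) - S.eval v =
        ((ρ * Real.log ρ - ρ + 1) - (ρ1 * Real.log ρ1 - ρ1 + 1)) +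
        (ρ1 * Real.log ρ1 - ρ1 + 1 - S.eval u) + (S.eval u - S.eval v) := by ring
      rw [e]
      refine (abs_add_three _ _ _).trans ?_
      linarith
    have f1 : ph sg y * ((ρ - ρ1) * (|Real.log ρ| + 1)) ≤
        √x ^ (2 * N) * (E0 * pd K (m + 2 * ((2 * N : ℕ) : ℝ) * s ^ 2) s sg x y) *
          ((C5 + C6 + 1) * (1 + y ^ 2)) := by
      rw [← mul_assoc]
      apply mul_le_mul htail hlogb (by positivity)
      exact mul_nonneg hrN0 (mul_nonneg (Real.exp_pos _).le (pd_nonneg _ _ _ _ _ _))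
    have f2 := mul_le_mul_of_nonneg_left tri hph.le
    refine f2.trans ?_
    linarith
  have iP := mom2_integrable (K := K) (m := m + 2 * ((2 * N : ℕ) : ℝ) * s ^ 2) (s := s) hsg x
  have i2 := ph_exp_int hsg l2
  have i3 := ph_exp_int hsg l3
  refine (norm_integral_le_of_norm_le
    ((((iP.const_mul (E0 * (C5 + C6 + 1))).add (i2.const_mul a2)).add (i3.const_mul a3)).const_mul
      (√x ^ (2 * N))) (Filter.Eventually.of_forall hpt)).trans ?_
  rw [integral_const_mul, integral_add' ((iP.const_mul (E0 * (C5 + C6 + 1))).add (i2.const_mul a2))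
    (i3.const_mul a3), integral_add' (iP.const_mul (E0 * (C5 + C6 + 1))) (i2.const_mul a2),
    integral_const_mul, integral_const_mul, integral_const_mul, ← hJ2, ← hJ3, hrN, mul_comm]
  have := hmom x (by rw [abs_of_pos hx]; exact hx1)
  have hE00 : 0 < E0 := Real.exp_pos _
  gcongr


/-! ### Part E7 : comparison of Taylor coefficients -/

lemma even_coeff {q : Polynomial ℝ} (h : ∀ x, q.eval (-x) = q.eval x) {k : ℕ} (hk : Odd k) :
    q.coeff k = 0 := by
  have e : q.comp (Polynomial.C (-1) * Polynomial.X) = q := by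
    apply Polynomial.funext
    intro x
    rw [Polynomial.eval_comp]
    simpa using h x
  have h2 := congrArg (fun p => Polynomial.coeff p k) e
  simp only [Polynomial.comp_C_mul_X_coeff, hk.neg_one_pow] at h2
  linarith

/-- Taylor polynomial of the harvesting function -/
def gp (b c : ℝ) (N : ℕ) : Polynomial ℝ :=
  ∑ i ∈ Finset.range N, Polynomial.monomial (i + 2) (-b * (-c) ^ (i + 1) / ((i:ℝ) + 1))

lemma gp_coeff (b c : ℝ) {N k : ℕ} (hk : k < N) (hk2 : 3 ≤ k) (ho : Odd k) :
    (gp b c N).coeff k = -(b * c ^ (k - 1) / ((k:ℝ) - 1)) := by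
  unfold gp
  rw [Polynomial.finsetSum_coeff]
  obtain ⟨i, rfl⟩ : ∃ i, k = i + 2 := ⟨k - 2, by omega⟩
  rw [Finset.sum_eq_single i]
  · rw [Polynomial.coeff_monomial, if_pos rfl]
    have : Even (i + 1) := by
      rcases ho with ⟨j, hj⟩; exact ⟨j, by omega⟩
    rw [this.neg_pow]
    have : i + 2 - 1 = i + 1 := by omega
    rw [this]; push_cast; ring
  · intro j _ hj
    rw [Polynomial.coeff_monomial, if_neg (by omega)]
  · intro h; exact absurd (Finset.mem_range.2 (by omega)) h

lemma gp_bound {b c : ℝ} (hb : 0 < b) (hc : 0 < c) (N : ℕ) : ∃ B, 0 < B ∧ ∀ x, 0 < x → x ≤ 1 →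
    c * x ≤ 1 / 2 → |b * x * Real.log (1 + c * x) - (gp b c N).eval x| ≤ B * x ^ N := by
  refine ⟨b * c ^ (N + 1) * 2, by positivity, fun x hx hx1 hcx => ?_⟩
  have hcx0 : 0 < c * x := by positivity
  have habs : |(-(c * x))| = c * x := by rw [abs_neg, abs_of_pos hcx0]
  have h := Real.abs_log_sub_add_sum_range_le (x := -(c * x)) (by rw [habs]; linarith) N
  rw [habs, sub_neg_eq_add] at h
  have e : b * x * Real.log (1 + c * x) - (gp b c N).eval x =
      b * x * ((∑ i ∈ Finset.range N, (-(c * x)) ^ (i + 1) / ((i:ℝ) + 1)) + Real.log (1 + c * x)) := by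
    unfold gp
    rw [Polynomial.eval_finsetSum, mul_add, Finset.mul_sum, sub_eq_add_neg, ← Finset.sum_neg_distrib,
      add_comm]
    congr 1
    apply Finset.sum_congr rfl
    intro i _
    rw [Polynomial.eval_monomial]
    have : (-(c * x)) ^ (i + 1) = (-c) ^ (i + 1) * x ^ (i + 1) := by rw [← mul_pow]; ring
    rw [this]; ring
  rw [e, abs_mul, abs_of_pos (by positivity : 0 < b * x)]
  have h2 : (c * x) ^ (N + 1) / (1 - c * x) ≤ (c * x) ^ (N + 1) * 2 := by
    rw [div_le_iff₀ (by linarith)]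
    have : 0 < (c * x) ^ (N + 1) := by positivity
    nlinarith
  have h3 : x * x ≤ 1 := by nlinarith
  calc _ ≤ b * x * ((c * x) ^ (N + 1) * 2) := by gcongr; linarith
    _ = b * c ^ (N + 1) * 2 * x ^ N * (x * x) := by rw [mul_pow]; ring
    _ ≤ b * c ^ (N + 1) * 2 * x ^ N * 1 := by gcongr
    _ = _ := by ring

/-- logarithmic ratio of the noise density and the output density -/
def Lam (K m s sg : ℝ) (F : Measure ℝ) (y : ℝ) : ℝ := Real.log (ph sg y) - Real.log (Pd K m s sg F y)

lemma Lam_cont {K m s sg : ℝ} (hK : 0 < K) (hs : 0 < s) (hsg : 0 < sg) {A : ℝ} (F : Measure ℝ)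
    [IsProbabilityMeasure F] (hF : F (Set.Icc 0 A)ᶜ = 0) : Continuous (Lam K m s sg F) := by
  unfold Lam
  exact ((ph_cont sg).log fun y => (ph_pos hsg y).ne').sub
    ((Pd_cont K m s sg F).log fun y => (Pd_pos hK hs hsg F hF y).ne')

lemma Lam_bound {K m s sg : ℝ} (hK : 0 < K) (hs : 0 < s) (hsg : 0 < sg) {A : ℝ} (hA : 0 < A)
    (F : Measure ℝ) [IsProbabilityMeasure F] (hF : F (Set.Icc 0 A)ᶜ = 0) :
    ∃ C, 0 < C ∧ ∀ y, |Lam K m s sg F y| ≤ C * (1 + y ^ 2) := by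
  obtain ⟨C1, hC1, h1⟩ := log_ph_bound hsg
  obtain ⟨C2, hC2, h2⟩ := log_Pd_bound (m := m) hK hs hsg hA F hF
  refine ⟨C1 + C2, by positivity, fun y => ?_⟩
  unfold Lam
  refine (abs_sub _ _).trans ?_
  linarith [h1 y, h2 y]

lemma ii_split {K m s sg : ℝ} (hK : 0 < K) (hs : 0 < s) (hsg : 0 < sg) {A : ℝ} (hA : 0 < A)
    (F : Measure ℝ) [IsProbabilityMeasure F] (hF : F (Set.Icc 0 A)ᶜ = 0) (x : ℝ) :
    ii K m s sg F x = (∫ y, pd K m s sg x y * (Real.log (pd K m s sg x y) - Real.log (ph sg y))) +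
      ∫ y, pd K m s sg x y * Lam K m s sg F y := by
  obtain ⟨C1, hC1, h1⟩ := log_ph_bound hsg
  obtain ⟨C2, hC2, h2⟩ := log_pd_bound (m := m) hK hs hsg |x| (abs_nonneg x)
  obtain ⟨C3, hC3, h3⟩ := Lam_bound (m := m) hK hs hsg hA F hF
  have i1 : Integrable (fun y => pd K m s sg x y *
      (Real.log (pd K m s sg x y) - Real.log (ph sg y))) := by
    apply pd_mul_integrable hsg x (C := C2 + C1)
    · exact ((Real.measurable_log.comp (pd_cont_y K m s sg x).measurable).sub
        (Real.measurable_log.comp (ph_cont sg).measurable))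
    · intro y
      refine (abs_sub _ _).trans ?_
      linarith [h1 y, h2 x y le_rfl]
  have i2 : Integrable (fun y => pd K m s sg x y * Lam K m s sg F y) :=
    pd_mul_integrable hsg x (Lam_cont hK hs hsg F hF).measurable h3
  rw [← integral_add i1 i2]
  unfold ii Lam
  congr 1; funext y; ring

open Filter Topology in
lemma coef_eq {K m s sg : ℝ} (hK : 0 < K) (hs : 0 < s) (hsg : 0 < sg) {A b c : ℝ} (hA : 0 < A)
    (hb : 0 < b) (hc : 0 < c)
    (F : Measure ℝ) [IsProbabilityMeasure F] (hF : F (Set.Icc 0 A)ᶜ = 0) (α β γ : ℝ)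
    (hz : ∃ᶠ x in 𝓝[>] (0:ℝ), ii K m s sg F x = α + β * x + γ * (b * x * Real.log (1 + c * x)))
    {θ : ℕ → ℝ} (hθ : ∀ X : ℝ, HasSum (fun k => θ k * X ^ k) (Th sg (Lam K m s sg F) X))
    (k : ℕ) (hk3 : 3 ≤ k) (ho : Odd k) :
    θ k * K ^ k * mom m s k = -(γ * (b * c ^ (k - 1) / ((k:ℝ) - 1))) := by
  obtain ⟨C3, hC3, h3⟩ := Lam_bound (m := m) hK hs hsg hA F hF
  obtain ⟨q, hqe, B1, hB1⟩ := W_exp (m := m) hK hs hsg (k + 1)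
  obtain ⟨B2, hB20, hB2⟩ := V_exp (m := m) (s := s) hK hsg (Lam_cont (m := m) hK hs hsg F hF) hC3 h3 hθ (k + 1)
  obtain ⟨B3, hB30, hB3⟩ := gp_bound hb hc (k + 1)
  set v : Polynomial ℝ := ∑ j ∈ Finset.range (k + 1), Polynomial.monomial j (θ j * K ^ j * mom m s j) with hv
  have hve : ∀ x, v.eval x = ∑ j ∈ Finset.range (k + 1), (θ j * K ^ j * mom m s j) * x ^ j := by
    intro x
    rw [hv, Polynomial.eval_finsetSum]
    simp only [Polynomial.eval_monomial]
  set p : Polynomial ℝ := q + v - (Polynomial.C α + Polynomial.C β * Polynomial.X +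
    Polynomial.C γ * gp b c (k + 1)) with hp
  have hpz : ∃ᶠ x in 𝓝[>] (0:ℝ), |p.eval x| ≤ (B1 + B2 + |γ| * B3) * x ^ (k + 1) := by
    have ev : ∀ᶠ x in 𝓝[>] (0:ℝ), 0 < x ∧ x ≤ 1 ∧ c * x ≤ 1 / 2 := by
      have h1 : ∀ᶠ x in 𝓝 (0:ℝ), x ≤ 1 := Iic_mem_nhds one_pos
      have h2 : ∀ᶠ x in 𝓝 (0:ℝ), c * x ≤ 1 / 2 := by
        have : Tendsto (fun x : ℝ => c * x) (𝓝 0) (𝓝 0) := by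
          have := (continuous_const_mul c).tendsto 0; simpa using this
        exact this.eventually (Iic_mem_nhds (by norm_num))
      filter_upwards [self_mem_nhdsWithin, nhdsWithin_le_nhds h1, nhdsWithin_le_nhds h2] with x a1 a2 a3
      exact ⟨a1, a2, a3⟩
    refine (hz.and_eventually ev).mono ?_
    rintro x ⟨hzx, hx0, hx1, hx2⟩
    have a1 := hB1 x hx0 hx1
    have a2 := hB2 x hx0.le hx1
    have a3 := hB3 x hx0 hx1 hx2
    rw [ii_split hK hs hsg hA F hF] at hzx
    rw [← hve] at a2
    set W := ∫ y, pd K m s sg x y * (Real.log (pd K m s sg x y) - Real.log (ph sg y)) with hW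
    set V := ∫ y, pd K m s sg x y * Lam K m s sg F y with hV
    have e : p.eval x = -(W - q.eval x) - (V - v.eval x) +
        γ * (b * x * Real.log (1 + c * x) - (gp b c (k + 1)).eval x) := by
      rw [hp]
      simp only [Polynomial.eval_sub, Polynomial.eval_add, Polynomial.eval_mul, Polynomial.eval_C,
        Polynomial.eval_X]
      linarith
    rw [e]
    refine (abs_add_le _ _).trans ?_
    have t1 := abs_sub (-(W - q.eval x)) (V - v.eval x)
    rw [abs_neg] at t1
    rw [abs_mul]
    have t2 := mul_le_mul_of_nonneg_left a3 (abs_nonneg γ)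
    linarith
  have hc0 := poly_coeff_zero (k + 1) p _ hpz k (by omega)
  have hvc : v.coeff k = θ k * K ^ k * mom m s k := by
    rw [hv, Polynomial.finsetSum_coeff, Finset.sum_eq_single k]
    · rw [Polynomial.coeff_monomial, if_pos rfl]
    · intro j _ hj
      rw [Polynomial.coeff_monomial, if_neg hj]
    · intro h; exact absurd (Finset.mem_range.2 (by omega)) h
  have hX : (Polynomial.X : Polynomial ℝ).coeff k = 0 := by
    rw [Polynomial.coeff_X, if_neg (by omega)]
  have hCα : (Polynomial.C α : Polynomial ℝ).coeff k = 0 := by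
    rw [Polynomial.coeff_C, if_neg (by omega)]
  rw [hp] at hc0
  rw [Polynomial.coeff_sub, Polynomial.coeff_add, Polynomial.coeff_add, Polynomial.coeff_add,
    Polynomial.coeff_C_mul, Polynomial.coeff_C_mul, even_coeff hqe ho, hvc, hX, hCα,
    gp_coeff b c (by omega) hk3 ho] at hc0
  linarith


/-! ### Part E8 : growth of the entire part and contradiction -/

lemma exists_mass {A : ℝ} (hA : 0 < A) (F : Measure ℝ) [IsProbabilityMeasure F]
    (hF : F (Set.Icc 0 A)ᶜ = 0)
    (hS : ¬ ∃ S : Finset ℝ, (S : Set ℝ) ⊆ Set.Icc (0:ℝ) A ∧ F S = 1) :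
    ∃ x1, 0 < x1 ∧ 0 < F.real (Set.Icc x1 A) := by
  by_contra hcon
  push Not at hcon
  apply hS
  refine ⟨{0}, by simp [hA.le], ?_⟩
  have h0 : F (⋃ n : ℕ, Set.Icc (1 / ((n:ℝ) + 1)) A) = 0 := by
    rw [measure_iUnion_null_iff]
    intro n
    have h := hcon (1 / ((n:ℝ) + 1)) (by positivity)
    have h2 : F.real (Set.Icc (1 / ((n:ℝ) + 1)) A) = 0 := le_antisymm h measureReal_nonneg
    exact (measureReal_eq_zero_iff).1 h2
  have h1 : F ({0}ᶜ : Set ℝ) = 0 := by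
    apply measure_mono_null _ (measure_union_null hF h0)
    intro x hx
    by_cases hxA : x ∈ Set.Icc 0 A
    · right
      have hx0 : 0 < x := lt_of_le_of_ne hxA.1 (Ne.symm hx)
      obtain ⟨n, hn⟩ := exists_nat_one_div_lt hx0
      exact Set.mem_iUnion.2 ⟨n, hn.le, hxA.2⟩
    · left; exact hxA
  rw [Finset.coe_singleton]
  exact (prob_compl_eq_zero_iff (measurableSet_singleton 0)).1 h1

lemma Pd_log_lower {K m s sg : ℝ} (hK : 0 < K) (hs : 0 < s) (hsg : 0 < sg) {A : ℝ} (hA : 0 < A)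
    (F : Measure ℝ) [IsProbabilityMeasure F] (hF : F (Set.Icc 0 A)ᶜ = 0)
    (hS : ¬ ∃ S : Finset ℝ, (S : Set ℝ) ⊆ Set.Icc (0:ℝ) A ∧ F S = 1) :
    ∃ C, 0 < C ∧ ∀ y, 0 ≤ y → - Real.log (Pd K m s sg F y) ≤ C * (1 + y) := by
  obtain ⟨x1, hx1, hm⟩ := exists_mass hA F hF hS
  set B0 := |m| + (|Real.log x1| + |Real.log A|) / 2 with hB0
  obtain ⟨C1, hC1, hE⟩ := EE_lower hK hs hsg B0
  have hkap := kap_pos hs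
  set p0 := F.real (Set.Icc x1 A) * (kap s * C1) with hp0
  have hp0p : 0 < p0 := by positivity
  set D := ((Real.log K) ^ 2 + 4 + 2 * B0 ^ 2) / (2 * s ^ 2) + 1 with hD
  have hDp : 0 < D := by positivity
  refine ⟨|Real.log p0| + D, by positivity, fun y hy => ?_⟩
  have hpt : ∀ x ∈ Set.Icc x1 A, kap s * C1 * Real.exp (-(D * (1 + y))) ≤ pd K m s sg x y := by
    intro x hx
    have hx0 : 0 < x := hx1.trans_le hx.1
    have hxe : x = Real.exp (2 * (Real.log x / 2)) := by
      rw [mul_div_cancel₀ _ (by norm_num : (2:ℝ) ≠ 0), Real.exp_log hx0]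
    rw [hxe, pd_eq_EE hs, mul_assoc]
    apply mul_le_mul_of_nonneg_left _ hkap.le
    have hl1 : Real.log x1 ≤ Real.log x := Real.log_le_log hx1 hx.1
    have hl2 : Real.log x ≤ Real.log A := Real.log_le_log hx0 hx.2
    have hcb : |m + Real.log x / 2| ≤ B0 := by
      rw [hB0, abs_le]
      constructor <;> linarith [neg_abs_le m, le_abs_self m, neg_abs_le (Real.log x1),
        le_abs_self (Real.log A), abs_nonneg (Real.log x1), abs_nonneg (Real.log A)]
    refine le_trans ?_ (hE _ y hcb hy)
    apply mul_le_mul_of_nonneg_left _ hC1.le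
    set c := m + Real.log x / 2 with hc
    have hell : (ell K y) ^ 2 ≤ (Real.log K) ^ 2 / 2 + 2 * (1 + y) := by
      have h1 := log_sq_le hy
      have : ell K y = (Real.log (1 + y) - Real.log K) / 2 := by
        unfold ell; rw [Real.log_div (by linarith) hK.ne']
      rw [this]
      linarith [sq_nonneg (Real.log (1 + y) + Real.log K)]
    have hc2 : c ^ 2 ≤ B0 ^ 2 := by
      rw [← sq_abs c]; gcongr
    have hsq : (ell K y - c) ^ 2 ≤ ((Real.log K) ^ 2 + 4 + 2 * B0 ^ 2) * (1 + y) := by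
      have h1 : (ell K y - c) ^ 2 ≤ 2 * (ell K y) ^ 2 + 2 * c ^ 2 := by
        linarith [sq_nonneg (ell K y + c)]
      have h2 : 0 ≤ (Real.log K) ^ 2 * y := by positivity
      have h3 : 0 ≤ B0 ^ 2 * y := by positivity
      linarith
    rw [le_div_iff₀ (by linarith : 0 < 1 + y)]
    have h1 : 1 + y ≤ Real.exp (1 + y) := by linarith [Real.add_one_le_exp (1 + y)]
    calc Real.exp (-(D * (1 + y))) * (1 + y) ≤ Real.exp (-(D * (1 + y))) * Real.exp (1 + y) := by gcongr
      _ = Real.exp (-(D * (1 + y)) + (1 + y)) := by rw [← Real.exp_add]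
      _ ≤ _ := by
        apply Real.exp_le_exp.2
        have e : -(D * (1 + y)) + (1 + y) =
          -(((Real.log K) ^ 2 + 4 + 2 * B0 ^ 2) * (1 + y)) / (2 * s ^ 2) := by rw [hD]; ring
        rw [e]
        gcongr
  have hlow : p0 * Real.exp (-(D * (1 + y))) ≤ Pd K m s sg F y := by
    unfold Pd
    have h1 : ∫ x in Set.Icc x1 A, kap s * C1 * Real.exp (-(D * (1 + y))) ∂F ≤
        ∫ x in Set.Icc x1 A, pd K m s sg x y ∂F :=
      setIntegral_mono_on (integrable_const _) (pd_int_F K m s sg y F).integrableOn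
        measurableSet_Icc hpt
    have h2 : ∫ x in Set.Icc x1 A, pd K m s sg x y ∂F ≤ ∫ x, pd K m s sg x y ∂F :=
      setIntegral_le_integral (pd_int_F K m s sg y F)
        (Filter.Eventually.of_forall fun x => pd_nonneg _ _ _ _ _ _)
    rw [setIntegral_const, smul_eq_mul] at h1
    rw [hp0]
    linarith
  have hlog := Real.log_le_log (by positivity) hlow
  rw [Real.log_mul hp0p.ne' (Real.exp_pos _).ne', Real.log_exp] at hlog
  have h3 : 0 ≤ |Real.log p0| * y := by positivity
  linarith [neg_abs_le (Real.log p0)]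

lemma Th_upper {K m s sg : ℝ} (hK : 0 < K) (hs : 0 < s) (hsg : 0 < sg) {A : ℝ} (hA : 0 < A)
    (F : Measure ℝ) [IsProbabilityMeasure F] (hF : F (Set.Icc 0 A)ᶜ = 0)
    (hS : ¬ ∃ S : Finset ℝ, (S : Set ℝ) ⊆ Set.Icc (0:ℝ) A ∧ F S = 1) :
    ∃ C, 0 < C ∧ ∀ X, 0 ≤ X → Th sg (Lam K m s sg F) X ≤ -X ^ 2 / (2 * sg ^ 2) + C * (1 + X) := by
  obtain ⟨C1, hC1, h1⟩ := Pd_log_lower (m := m) hK hs hsg hA F hF hS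
  obtain ⟨C2, hC2, h2⟩ := log_Pd_bound (m := m) hK hs hsg hA F hF
  obtain ⟨C3, hC3, h3⟩ := Lam_bound (m := m) hK hs hsg hA F hF
  set c0 := Real.log (ph sg 0) with hc0
  set C := C1 + C2 with hC
  have j0 : Integrable (ph sg) := ph_int
  have j1 := ph_pow_int hsg 1
  have j2 := ph_pow_int hsg 2
  set I1 := ∫ t, ph sg t * t ^ 1 with hI1
  set I2 := ∫ t, ph sg t * t ^ 2 with hI2
  have hI20 : 0 ≤ I2 := integral_nonneg fun t => mul_nonneg (ph_nonneg _ _) (by positivity)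
  refine ⟨|c0| + 2 * C + 2 * C * I2 + |I1| / sg ^ 2, by positivity, fun X hX => ?_⟩
  set h : ℝ → ℝ := fun t => (c0 - X ^ 2 / (2 * sg ^ 2) + C * (2 + X)) * ph sg t +
    (-(X / sg ^ 2)) * (ph sg t * t ^ 1) + (2 * C) * (ph sg t * t ^ 2) with hh
  have hhi : Integrable h := ((j0.const_mul _).add (j1.const_mul _)).add (j2.const_mul _)
  have hpt : ∀ y, ph sg (y - X) * Lam K m s sg F y ≤ h (y - X) := by
    intro y
    set t := y - X with ht
    have hy : y = X + t := by rw [ht]; ring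
    have e : h t = ph sg t * ((c0 - X ^ 2 / (2 * sg ^ 2) + C * (2 + X)) - X / sg ^ 2 * t +
        2 * C * t ^ 2) := by rw [hh]; ring
    rw [e]
    apply mul_le_mul_of_nonneg_left _ (ph_nonneg _ _)
    unfold Lam
    rw [log_ph hsg, ← hc0]
    have hlog : - Real.log (Pd K m s sg F y) ≤ C * (2 + X + 2 * t ^ 2) := by
      rcases le_or_gt 0 y with h0 | h0
      · have a1 := h1 y h0
        have a2 : 1 + y ≤ 2 + X + 2 * t ^ 2 := by
          rw [hy]; linarith [sq_nonneg (t - 1), sq_nonneg t]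
        have a3 : C1 * (1 + y) ≤ C * (2 + X + 2 * t ^ 2) := by
          apply mul_le_mul (by linarith) a2 (by linarith) (by positivity)
        linarith
      · have a1 := h2 y
        have a2 : y ^ 2 ≤ t ^ 2 := by
          have : t = y - X := ht
          nlinarith
        have a3 : C2 * (1 + y ^ 2) ≤ C * (2 + X + 2 * t ^ 2) := by
          apply mul_le_mul (by linarith) (by linarith [sq_nonneg t]) (by positivity) (by positivity)
        linarith [neg_abs_le (Real.log (Pd K m s sg F y))]
    have hsq : X ^ 2 / (2 * sg ^ 2) + X / sg ^ 2 * t ≤ y ^ 2 / (2 * sg ^ 2) := by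
      have e : X ^ 2 / (2 * sg ^ 2) + X / sg ^ 2 * t = (X ^ 2 + 2 * X * t) / (2 * sg ^ 2) := by
        field_simp
      rw [e]
      gcongr
      rw [hy]; linarith [sq_nonneg t]
    linarith
  have hIntg : Th sg (Lam K m s sg F) X ≤ ∫ y, h (y - X) := by
    apply integral_mono (Th_int hsg (Lam_cont hK hs hsg F hF) h3 X) (hhi.comp_sub_right X)
    exact hpt
  rw [integral_sub_right_eq_self h X] at hIntg
  have eh : ∫ t, h t = (c0 - X ^ 2 / (2 * sg ^ 2) + C * (2 + X)) * 1 + (-(X / sg ^ 2)) * I1 +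
      (2 * C) * I2 := by
    have j01 : Integrable (fun t => (c0 - X ^ 2 / (2 * sg ^ 2) + C * (2 + X)) * ph sg t +
        (-(X / sg ^ 2)) * (ph sg t * t ^ 1)) := (j0.const_mul _).add (j1.const_mul _)
    simp only [hh]
    rw [integral_add j01 (j2.const_mul _),
      integral_add (j0.const_mul _) (j1.const_mul _), integral_const_mul, integral_const_mul,
      integral_const_mul, ph_total hsg]
  rw [eh] at hIntg
  have k1 : (-(X / sg ^ 2)) * I1 ≤ |I1| / sg ^ 2 * X := by
    have : (-(X / sg ^ 2)) * I1 = X / sg ^ 2 * (-I1) := by ring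
    rw [this]
    have : X / sg ^ 2 * (-I1) ≤ X / sg ^ 2 * |I1| := by
      apply mul_le_mul_of_nonneg_left (neg_le_abs I1) (by positivity)
    linarith [show X / sg ^ 2 * |I1| = |I1| / sg ^ 2 * X by ring]
  have k2 : 0 ≤ |c0| * X := by positivity
  have k3 : 0 ≤ C * X := by positivity
  have k4 : 0 ≤ C * I2 * X := by positivity
  have k5 : 0 ≤ |I1| / sg ^ 2 := by positivity
  have k6 : -X ^ 2 / (2 * sg ^ 2) = -(X ^ 2 / (2 * sg ^ 2)) := by ring
  rw [k6]
  linarith [le_abs_self c0]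

lemma Th_lower {K m s sg : ℝ} (hK : 0 < K) (hs : 0 < s) (hsg : 0 < sg) {A : ℝ} (hA : 0 < A)
    (F : Measure ℝ) [IsProbabilityMeasure F] (hF : F (Set.Icc 0 A)ᶜ = 0) :
    ∃ C, 0 < C ∧ ∀ X, 0 ≤ X → -C ≤ Th sg (Lam K m s sg F) (-X) := by
  obtain ⟨C3, hC3, h3⟩ := Lam_bound (m := m) hK hs hsg hA F hF
  have j0 : Integrable (ph sg) := ph_int
  have j2 := ph_pow_int hsg 2
  have hi : Integrable (fun y => ph sg y * (1 + y ^ 2)) := by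
    refine (j0.add j2).congr (Filter.Eventually.of_forall fun y => ?_)
    simp only [Pi.add_apply]; ring
  set I := ∫ y, ph sg y * (1 + y ^ 2) with hI
  have hI0 : 0 ≤ I := integral_nonneg fun t => mul_nonneg (ph_nonneg _ _) (by positivity)
  refine ⟨C3 * I + 1, by positivity, fun X hX => ?_⟩
  have hpt : ∀ y, (-C3) * (ph sg y * (1 + y ^ 2)) ≤ ph sg (y - -X) * Lam K m s sg F y := by
    intro y
    rcases le_or_gt y 0 with h0 | h0
    · have hPle : Pd K m s sg F y ≤ ph sg y := by
        unfold Pd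
        have h1 : ∀ᵐ x ∂F, x ∈ Set.Icc 0 A := hF
        have h2 : ∫ x, pd K m s sg x y ∂F ≤ ∫ x, ph sg y ∂F := by
          apply integral_mono_ae (pd_int_F K m s sg y F) (integrable_const _)
          filter_upwards [h1] with x hx
          unfold pd
          have h4 : ∫ g, ph sg (y - K * x * Real.exp (2 * g)) ∂(gam m s) ≤ ∫ g, ph sg y ∂(gam m s) := by
            apply integral_mono (pd_integrable K m s sg x y) (integrable_const _)
            intro g
            apply ph_anti
            have : 0 ≤ K * x * Real.exp (2 * g) := mul_nonneg (mul_nonneg hK.le hx.1) (Real.exp_pos _).le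
            rw [abs_of_nonpos h0, abs_of_nonpos (by linarith)]
            linarith
          simpa using h4
        simpa using h2
      have hL : 0 ≤ Lam K m s sg F y := by
        unfold Lam
        have := Real.log_le_log (Pd_pos (m := m) hK hs hsg F hF y) hPle
        linarith
      have a1 : 0 ≤ ph sg (y - -X) * Lam K m s sg F y := mul_nonneg (ph_nonneg _ _) hL
      have a2 : 0 ≤ C3 * (ph sg y * (1 + y ^ 2)) :=
        mul_nonneg hC3.le (mul_nonneg (ph_nonneg _ _) (by positivity))
      linarith
    · have hle : ph sg (y - -X) ≤ ph sg y := by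
        apply ph_anti
        rw [abs_of_pos h0, abs_of_pos (by linarith)]
        linarith
      have a1 : -(C3 * (1 + y ^ 2)) ≤ Lam K m s sg F y :=
        (neg_le_neg (h3 y)).trans (neg_abs_le _)
      have a2 := mul_le_mul_of_nonneg_left a1 (ph_nonneg sg (y - -X))
      have a3 := mul_le_mul_of_nonneg_right hle (by positivity : 0 ≤ C3 * (1 + y ^ 2))
      linarith
  have hIntg := integral_mono (hi.const_mul (-C3)) (Th_int hsg (Lam_cont (m := m) hK hs hsg F hF) h3 (-X)) hpt
  rw [integral_const_mul, ← hI] at hIntg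
  change -(C3 * I + 1) ≤ ∫ y, ph sg (y - -X) * Lam K m s sg F y
  linarith

lemma main_contra {K m s sg : ℝ} (hK : 0 < K) (hs : 0 < s) (hsg : 0 < sg) {A b c : ℝ} (hA : 0 < A)
    (hb : 0 < b) (hc : 0 < c)
    (F : Measure ℝ) [IsProbabilityMeasure F] (hF : F (Set.Icc 0 A)ᶜ = 0)
    (α β γ : ℝ)
    (hkkt : ∀ᵐ x ∂F, ii K m s sg F x = α + β * x + γ * (b * x * Real.log (1 + c * x))) :
    ∃ S : Finset ℝ, (S : Set ℝ) ⊆ Set.Icc (0:ℝ) A ∧ F S = 1 := by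
  by_contra hS
  have hz := zeros_near_zero hK hs hsg hA hc F hF α β γ b hkkt hS
  obtain ⟨C3, hC3, h3⟩ := Lam_bound (m := m) hK hs hsg hA F hF
  have hLc := Lam_cont (m := m) hK hs hsg F hF
  obtain ⟨θ, hθ⟩ := Th_series hsg hLc hC3 h3
  have hcoef := coef_eq hK hs hsg hA hb hc F hF α β γ hz hθ
  have hodd : ∀ X : ℝ, HasSum (fun k => θ k * X ^ k - θ k * (-X) ^ k)
      (Th sg (Lam K m s sg F) X - Th sg (Lam K m s sg F) (-X)) := fun X => (hθ X).sub (hθ (-X))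
  have hg : ∀ k : ℕ, 3 ≤ k → 0 < b * c ^ (k - 1) / ((k:ℝ) - 1) := by
    intro k hk
    have : (3:ℝ) ≤ k := by exact_mod_cast hk
    have : 0 < (k:ℝ) - 1 := by linarith
    positivity
  have hKm : ∀ k : ℕ, 0 < K ^ k * mom m s k := fun k => mul_pos (pow_pos hK k) (mom_pos m s k)
  rcases le_or_gt γ 0 with hγ | hγ
  · obtain ⟨C1, hC1, hup⟩ := Th_upper (m := m) hK hs hsg hA F hF hS
    obtain ⟨C2, hC2, hlo⟩ := Th_lower (m := m) hK hs hsg hA F hF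
    have hθ0 : ∀ k : ℕ, 3 ≤ k → Odd k → 0 ≤ θ k := by
      intro k hk ho
      have h := hcoef k hk ho
      have h1 : 0 ≤ θ k * (K ^ k * mom m s k) := by
        rw [← mul_assoc, h]
        have := mul_nonneg (neg_nonneg.2 hγ) (hg k hk).le
        linarith
      exact nonneg_of_mul_nonneg_left h1 (hKm k)
    have key : ∀ X : ℝ, 0 ≤ X → 2 * θ 1 * X ≤ Th sg (Lam K m s sg F) X - Th sg (Lam K m s sg F) (-X) := by
      intro X hX
      refine hasSum_le ?_ (hasSum_ite_eq 1 (2 * θ 1 * X)) (hodd X)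
      intro k
      by_cases hk1 : k = 1
      · subst hk1; rw [if_pos rfl]; apply le_of_eq; ring
      · rw [if_neg hk1]
        rcases Nat.even_or_odd k with he | ho
        · rw [he.neg_pow]; linarith
        · rw [ho.neg_pow]
          have hk3 : 3 ≤ k := by rcases ho with ⟨j, hj⟩; omega
          have := mul_nonneg (hθ0 k hk3 ho) (pow_nonneg hX k)
          linarith
    set D := C1 + C2 + 2 * |θ 1| with hD
    have hD0 : 0 < D := by positivity
    set X := 4 * sg ^ 2 * D + 1 with hX
    have hX1 : 1 ≤ X := by have : 0 ≤ 4 * sg ^ 2 * D := by positivity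
                           linarith
    have a1 := key X (by linarith)
    have a2 := hup X (by linarith)
    have a3 := hlo X (by linarith)
    have a4 : -|θ 1| * X ≤ θ 1 * X := by
      apply mul_le_mul_of_nonneg_right (neg_abs_le _) (by linarith)
    have a5 : X ^ 2 / (2 * sg ^ 2) ≤ D * (1 + X) := by
      have e : -X ^ 2 / (2 * sg ^ 2) = -(X ^ 2 / (2 * sg ^ 2)) := by ring
      rw [e] at a2
      have : 0 ≤ C2 * X := by positivity
      have : 0 ≤ |θ 1| := abs_nonneg _
      rw [hD]
      linarith
    rw [div_le_iff₀ (by positivity)] at a5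
    have a6 : D * (1 + X) * (2 * sg ^ 2) ≤ D * (2 * X) * (2 * sg ^ 2) := by gcongr; linarith
    have a7 : X * X ≤ (4 * sg ^ 2 * D) * X := by linarith
    have a8 := le_of_mul_le_mul_right a7 (by linarith)
    linarith
  · obtain ⟨C1, hC1, hbd⟩ := Th_bound hsg hLc hC3 h3
    have hθ0 : ∀ k : ℕ, 3 ≤ k → Odd k → θ k < 0 := by
      intro k hk ho
      have h := hcoef k hk ho
      have h1 : θ k * (K ^ k * mom m s k) < 0 := by
        rw [← mul_assoc, h]
        have := mul_pos hγ (hg k hk)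
        linarith
      exact neg_of_mul_neg_left h1 (hKm k).le
    have h30 := hθ0 3 le_rfl (by decide)
    have key : ∀ X : ℝ, 0 ≤ X → Th sg (Lam K m s sg F) X - Th sg (Lam K m s sg F) (-X) ≤
        2 * θ 1 * X + 2 * θ 3 * X ^ 3 := by
      intro X hX
      refine hasSum_le ?_ (hodd X) ((hasSum_ite_eq 1 (2 * θ 1 * X)).add (hasSum_ite_eq 3 (2 * θ 3 * X ^ 3)))
      intro k
      by_cases hk1 : k = 1
      · subst hk1; rw [if_pos rfl, if_neg (by norm_num)]; apply le_of_eq; ring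
      · rw [if_neg hk1]
        by_cases hk3 : k = 3
        · subst hk3; rw [if_pos rfl]; apply le_of_eq; ring
        · rw [if_neg hk3]
          rcases Nat.even_or_odd k with he | ho
          · rw [he.neg_pow]; linarith
          · rw [ho.neg_pow]
            have hk3 : 3 ≤ k := by rcases ho with ⟨j, hj⟩; omega
            have := mul_nonneg (neg_nonneg.2 (hθ0 k hk3 ho).le) (pow_nonneg hX k)
            linarith
    set p := -θ 3 with hp
    have hp0 : 0 < p := by linarith
    set D := 2 * C1 + |θ 1| with hD
    have hD0 : 0 < D := by positivity
    set X := D / p + 1 with hX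
    have hX1 : 1 ≤ X := by have : 0 ≤ D / p := by positivity
                           linarith
    have a1 := key X (by linarith)
    have a2 := (abs_le.1 (hbd X)).1
    have a3 := (abs_le.1 (hbd (-X))).2
    rw [neg_sq] at a3
    have a4 : θ 1 * X ≤ |θ 1| * X := mul_le_mul_of_nonneg_right (le_abs_self _) (by linarith)
    have a5 : X ≤ X ^ 2 := by nlinarith
    have a6 : |θ 1| * X ≤ |θ 1| * X ^ 2 := by gcongr
    have a7 : C1 * 1 ≤ C1 * X ^ 2 := by gcongr; linarith
    have e3 : θ 3 * X ^ 3 = -(p * X * X ^ 2) := by rw [hp]; ring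
    have a8 : p * X * X ^ 2 ≤ D * X ^ 2 := by
      rw [hD]
      linarith
    have a9 := le_of_mul_le_mul_right a8 (by positivity)
    have a10 : p * X = D + p := by rw [hX]; field_simp
    linarith

/-- discreteness of the capacity-achieving input distribution. The
(unique) `F* ∈ Ω` with `I(F*) = C` is discrete with finitely many mass points:
there is a finite `S ⊆ [0, A]` with `F*(S) = 1`. -/
theorem optimal_input_is_discrete
    (K m s sg A ε b c Eth : ℝ)
    (hK : 0 < K) (hs : 0 < s) (hsg : 0 < sg) (hA : 0 < A) (hε : 0 < ε)
    (hb : 0 < b) (hc : 0 < c) (hE : 0 ≤ Eth)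
    (hne : ∃ F : Measure ℝ, feasible A ε b c Eth F)
    (hCfin : capacity K m s sg A ε b c Eth ≠ ⊤)
    (Fstar : Measure ℝ) (hFstar : feasible A ε b c Eth Fstar)
    (hopt : mutualInfo K m s sg Fstar = capacity K m s sg A ε b c Eth) :
    ∃ S : Finset ℝ, ↑S ⊆ Set.Icc (0 : ℝ) A ∧ Fstar ↑S = 1 := by
  obtain ⟨α, β, γ, hkkt⟩ := kkt hK hs hsg hA hc Fstar hFstar hopt
  obtain ⟨hFp, hFs, -, -⟩ := hFstar
  exact main_contra hK hs hsg hA hb hc Fstar hFs α β γ hkkt
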